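/- Let (X_t : t ∈ ℝ) be a zero-mean stationary Gaussian process with continuous paths and covariance kernel R(t) = ∫ e^{itx} μ(dx), where μ is a finite non-null symmetric measure on ℝ with μ([x,∞)) > 0 for all x > 0 and μ([x,∞)) regularly varying with index −α, 0 < α < 2. Define τ_u^+ = inf{t ≥ 0 : X_t ≤ u}, τ_u^- = sup{t ≤ 0 : X_t ≤ u}, and δ_u = (h(u^{−2}))^{−1}. Then, conditionally on [X_0 > u], as u → ∞, δ_u^{−1}(τ_u^+ − τ_u^-) converges in distribution to τ_*^+ − τ_*^-, where τ_*^+ = inf{t ≥ 0 : Y_t ≤ 0}, τ_*^- = sup{t < 0 : Y_t ≤ 0}, and Y_t = √(2C_α) B(t) + R(0) T* − (C_α/R(0)) |t|^α with B a fractional Brownian motion with Hurst index α/2 independent of the standard exponential T*. -/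

import Mathlib

open MeasureTheory ProbabilityTheory Filter

/-- A real-valued stochastic process is a (zero-mean) Gaussian process if every finite
linear combination of its values has a centered Gaussian distribution. -/
def IsZeroMeanGaussianProcess {Ω : Type*} [MeasurableSpace Ω] (P : Measure Ω)
    (X : ℝ → Ω → ℝ) : Prop :=
  (∀ t, Measurable (X t)) ∧
  ∀ (n : ℕ) (t : Fin n → ℝ) (c : Fin n → ℝ),
    ∃ v : NNReal, P.map (fun ω => ∑ i, c i * X (t i) ω) = gaussianReal 0 v

section PowerIntegral

open Real Set

/-- `∫₀^∞ r^{a-1} / (1 + r) dr = Γ(a) Γ(1-a)` as a Lebesgue integral. -/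
lemma lintegral_rpow_div_one_add {a : ℝ} (ha0 : 0 < a) (ha1 : a < 1) :
    ∫⁻ r in Ioi (0 : ℝ), ENNReal.ofReal (r ^ (a - 1) / (1 + r))
      = ENNReal.ofReal (Gamma a * Gamma (1 - a)) := by
  have h1 : ∀ r ∈ Ioi (0 : ℝ), ENNReal.ofReal (r ^ (a - 1) / (1 + r))
      = ∫⁻ w in Ioi (0 : ℝ), ENNReal.ofReal (r ^ (a - 1) * exp (-((1 + r) * w))) := by
    intro r hr
    have hr' : (0 : ℝ) < r := hr
    have hi := integral_rpow_mul_exp_neg_mul_Ioi (a := 1) (r := 1 + r) one_pos (by linarith)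
    have hint := integrableOn_rpow_mul_exp_neg_mul_rpow (p := 1) (s := 0) (b := 1 + r)
      (by norm_num) (by norm_num) (by linarith)
    simp only [sub_self, rpow_zero, one_mul, rpow_one, Gamma_one, mul_one] at hi hint
    rw [← ofReal_integral_eq_lintegral_ofReal]
    · rw [integral_const_mul, hi, div_eq_mul_inv, one_div]
    · refine Integrable.const_mul ?_ _
      refine hint.congr_fun (fun x _ => ?_) measurableSet_Ioi
      simp only [neg_mul]
    · exact ae_of_all _ fun w => by positivity
  rw [setLIntegral_congr_fun measurableSet_Ioi h1]
  rw [lintegral_lintegral_swap]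
  · have h2 : ∀ w ∈ Ioi (0 : ℝ),
        ∫⁻ r in Ioi (0 : ℝ), ENNReal.ofReal (r ^ (a - 1) * exp (-((1 + r) * w)))
          = ENNReal.ofReal (Gamma a * (exp (-w) * w ^ ((1 - a) - 1))) := by
      intro w hw
      have hw' : (0 : ℝ) < w := hw
      have hi := integral_rpow_mul_exp_neg_mul_Ioi (a := a) (r := w) ha0 hw'
      have hint := integrableOn_rpow_mul_exp_neg_mul_rpow (p := 1) (s := a - 1) (b := w)
        (by linarith) (by norm_num) hw'
      rw [← ofReal_integral_eq_lintegral_ofReal]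
      · congr 1
        have : ∀ r : ℝ, r ^ (a - 1) * exp (-((1 + r) * w))
            = exp (-w) * (r ^ (a - 1) * exp (-(w * r))) := by
          intro r
          rw [show -((1 + r) * w) = -w + -(w * r) by ring, exp_add]; ring
        simp_rw [this]
        rw [integral_const_mul, hi, one_div, inv_rpow hw'.le, ← rpow_neg hw'.le]
        rw [show 1 - a - 1 = -a by ring]; ring
      · have : ∀ r : ℝ, r ^ (a - 1) * exp (-((1 + r) * w))
            = exp (-w) * (r ^ (a - 1) * exp (-w * r ^ (1 : ℝ))) := by
          intro r
          rw [show -((1 + r) * w) = -w + -(w * r) by ring, exp_add, rpow_one,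
            show -w * r = -(w * r) by ring]; ring
        simp_rw [this]
        exact hint.const_mul _
      · filter_upwards [ae_restrict_mem measurableSet_Ioi] with r hr
        have : (0 : ℝ) < r := hr
        positivity
    rw [setLIntegral_congr_fun measurableSet_Ioi h2]
    rw [← ofReal_integral_eq_lintegral_ofReal]
    · rw [integral_const_mul, ← Gamma_eq_integral (by linarith)]
    · exact (GammaIntegral_convergent (by linarith)).const_mul _
    · filter_upwards [ae_restrict_mem measurableSet_Ioi] with w hw
      have : (0 : ℝ) < w := hw
      have := Gamma_pos_of_pos ha0
      positivity
  · refine Measurable.aemeasurable ?_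
    fun_prop

/-- `∫₀^∞ s^{α-1} / (1 + s²) ds = π / (2 sin(πα/2))` as a Lebesgue integral. -/
lemma lintegral_rpow_div_one_add_sq {α : ℝ} (hα0 : 0 < α) (hα2 : α < 2) :
    ∫⁻ s in Ioi (0 : ℝ), ENNReal.ofReal (s ^ (α - 1) / (1 + s ^ 2))
      = ENNReal.ofReal (π / (2 * sin (π * α / 2))) := by
  have h := lintegral_rpow_div_one_add (a := α / 2) (by linarith) (by linarith)
  have himg : (fun s : ℝ => s ^ 2) '' Ioi 0 = Ioi 0 := by
    ext x; constructor
    · rintro ⟨s, hs, rfl⟩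
      have : (0 : ℝ) < s := hs
      exact mem_Ioi.2 (by positivity)
    · intro hx
      exact ⟨√x, sqrt_pos.2 hx, sq_sqrt (le_of_lt hx)⟩
  rw [← himg, lintegral_image_eq_lintegral_abs_deriv_mul measurableSet_Ioi
    (f' := fun s => 2 * s)] at h
  · have h2 : ∀ s ∈ Ioi (0 : ℝ), ENNReal.ofReal |2 * s|
        * ENNReal.ofReal ((s ^ 2) ^ (α / 2 - 1) / (1 + s ^ 2))
        = 2 * ENNReal.ofReal (s ^ (α - 1) / (1 + s ^ 2)) := by
      intro s hs
      have hs' : (0 : ℝ) < s := hs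
      rw [← ENNReal.ofReal_mul (abs_nonneg _),
        show (2 : ENNReal) = ENNReal.ofReal 2 by simp, ← ENNReal.ofReal_mul (by norm_num)]
      congr 1
      rw [abs_of_pos (by positivity), ← rpow_natCast, ← rpow_mul hs'.le,
        show α - 1 = ((2 : ℕ) : ℝ) * (α / 2 - 1) + 1 by push_cast; ring, rpow_add hs', rpow_one]
      ring
    rw [setLIntegral_congr_fun measurableSet_Ioi h2, lintegral_const_mul' _ _ (by simp),
      Gamma_mul_Gamma_one_sub] at h
    have h3 : ENNReal.ofReal (π / sin (π * (α / 2)))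
        = 2 * ENNReal.ofReal (π / (2 * sin (π * α / 2))) := by
      rw [show (2 : ENNReal) = ENNReal.ofReal 2 by simp, ← ENNReal.ofReal_mul (by norm_num)]
      congr 1
      rw [show π * (α / 2) = π * α / 2 by ring]
      field_simp
    rw [h3] at h
    exact (ENNReal.mul_right_inj (by simp) (by simp)).1 h
  · intro s _
    simpa using (hasDerivAt_pow 2 s).hasDerivWithinAt
  · intro s hs t ht hst
    exact (sq_eq_sq₀ (le_of_lt hs) (le_of_lt ht)).1 hst

/-- `∫₀^∞ (1 - cos y) e^{-sy} dy = 1 / (s (1 + s²))`. -/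
lemma lintegral_one_sub_cos_mul_exp {s : ℝ} (hs : 0 < s) :
    ∫⁻ y in Ioi (0 : ℝ), ENNReal.ofReal ((1 - cos y) * exp (-(s * y)))
      = ENNReal.ofReal (1 / (s * (1 + s ^ 2))) := by
  have hderiv : ∀ y : ℝ, HasDerivAt
      (fun y => exp (-(s * y)) * (-(1 / s) + (s * cos y - sin y) / (1 + s ^ 2)))
      ((1 - cos y) * exp (-(s * y))) y := by
    intro y
    have h1 : HasDerivAt (fun y => exp (-(s * y))) (exp (-(s * y)) * -(s * 1)) y :=
      (((hasDerivAt_id y).const_mul s).neg).exp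
    have h2 : HasDerivAt (fun y => (-(1 / s) + (s * cos y - sin y) / (1 + s ^ 2)))
        ((s * -sin y - cos y) / (1 + s ^ 2)) y :=
      ((((hasDerivAt_cos y).const_mul s).sub (hasDerivAt_sin y)).div_const _).const_add _
    refine (h1.mul h2).congr_deriv ?_
    field_simp
    ring
  have hnn : ∀ y ∈ Ioi (0 : ℝ), 0 ≤ (1 - cos y) * exp (-(s * y)) := fun y _ =>
    mul_nonneg (by linarith [cos_le_one y]) (exp_pos _).le
  have hlim : Tendsto (fun y => exp (-(s * y)) * (-(1 / s) + (s * cos y - sin y) / (1 + s ^ 2)))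
      atTop (nhds 0) := by
    have he : Tendsto (fun y : ℝ => exp (-(s * y))) atTop (nhds 0) :=
      tendsto_exp_neg_atTop_nhds_zero.comp (tendsto_id.const_mul_atTop hs)
    refine squeeze_zero_norm (a := fun y => exp (-(s * y)) * (1 / s + (s + 1) / (1 + s ^ 2))) ?_ ?_
    · intro y
      rw [norm_mul, norm_of_nonneg (exp_pos _).le]
      refine mul_le_mul_of_nonneg_left ?_ (exp_pos _).le
      refine (norm_add_le _ _).trans ?_
      rw [norm_neg, norm_of_nonneg (by positivity : 0 ≤ 1 / s), norm_div,
        norm_of_nonneg (by positivity : 0 ≤ 1 + s ^ 2)]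
      gcongr
      refine (norm_sub_le _ _).trans ?_
      rw [norm_mul, norm_of_nonneg hs.le]
      have h1 : ‖cos y‖ ≤ 1 := abs_cos_le_one y
      have h2 : ‖sin y‖ ≤ 1 := abs_sin_le_one y
      nlinarith
    · simpa using he.mul_const _
  have hcont : ContinuousWithinAt
      (fun y => exp (-(s * y)) * (-(1 / s) + (s * cos y - sin y) / (1 + s ^ 2))) (Ici 0) 0 :=
    (hderiv 0).continuousAt.continuousWithinAt
  rw [← ofReal_integral_eq_lintegral_ofReal]
  · rw [integral_Ioi_of_hasDerivAt_of_nonneg hcont (fun y _ => hderiv y) hnn hlim]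
    congr 1
    simp only [mul_zero, neg_zero, exp_zero, cos_zero, sin_zero]
    field_simp
    ring
  · exact integrableOn_Ioi_deriv_of_nonneg hcont (fun y _ => hderiv y) hnn hlim
  · filter_upwards [ae_restrict_mem measurableSet_Ioi] with y hy using hnn y hy

/-- `∫₀^∞ (1 - cos y) α y^{-α-1} dy = π / (2 Γ(α) sin(πα/2))`. -/
lemma lintegral_one_sub_cos_mul_rpow {α : ℝ} (hα0 : 0 < α) (hα2 : α < 2) :
    ∫⁻ y in Ioi (0 : ℝ), ENNReal.ofReal ((1 - cos y) * (α * y ^ (-α - 1)))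
      = ENNReal.ofReal (π / (Gamma α * sin (π * α / 2)) / 2) := by
  have hG : 0 < Gamma α := Gamma_pos_of_pos hα0
  have h1 : ∀ y ∈ Ioi (0 : ℝ), ENNReal.ofReal ((1 - cos y) * (α * y ^ (-α - 1)))
      = ∫⁻ s in Ioi (0 : ℝ),
        ENNReal.ofReal ((Gamma α)⁻¹ * s ^ α * ((1 - cos y) * exp (-(s * y)))) := by
    intro y hy
    have hy' : (0 : ℝ) < y := hy
    have hc : 0 ≤ 1 - cos y := by linarith [cos_le_one y]
    have hi := integral_rpow_mul_exp_neg_mul_Ioi (a := α + 1) (r := y) (by linarith) hy'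
    have hint := integrableOn_rpow_mul_exp_neg_mul_rpow (p := 1) (s := α) (b := y)
      (by linarith) (by norm_num) hy'
    simp only [rpow_one, add_sub_cancel_right] at hi hint
    have heq : ∀ s : ℝ, (Gamma α)⁻¹ * s ^ α * ((1 - cos y) * exp (-(s * y)))
        = ((Gamma α)⁻¹ * (1 - cos y)) * (s ^ α * exp (-y * s)) := by
      intro s; rw [show -y * s = -(s * y) by ring]; ring
    rw [← ofReal_integral_eq_lintegral_ofReal]
    · simp_rw [heq]
      rw [integral_const_mul]
      simp_rw [neg_mul]
      rw [hi, Gamma_add_one hα0.ne', one_div, inv_rpow hy'.le, ← rpow_neg hy'.le,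
        show -(α + 1) = -α - 1 by ring]
      congr 1
      field_simp
    · simp_rw [heq]; exact hint.const_mul _
    · filter_upwards [ae_restrict_mem measurableSet_Ioi] with s hs
      have : (0 : ℝ) < s := hs
      positivity
  rw [setLIntegral_congr_fun measurableSet_Ioi h1, lintegral_lintegral_swap]
  · have h2 : ∀ s ∈ Ioi (0 : ℝ), ∫⁻ y in Ioi (0 : ℝ),
        ENNReal.ofReal ((Gamma α)⁻¹ * s ^ α * ((1 - cos y) * exp (-(s * y))))
        = ENNReal.ofReal (Gamma α)⁻¹ * ENNReal.ofReal (s ^ (α - 1) / (1 + s ^ 2)) := by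
      intro s hs
      have hs' : (0 : ℝ) < s := hs
      have : ∀ y : ℝ, ENNReal.ofReal ((Gamma α)⁻¹ * s ^ α * ((1 - cos y) * exp (-(s * y))))
          = ENNReal.ofReal ((Gamma α)⁻¹ * s ^ α)
            * ENNReal.ofReal ((1 - cos y) * exp (-(s * y))) := fun y =>
        ENNReal.ofReal_mul (by positivity)
      simp_rw [this]
      rw [lintegral_const_mul' _ _ (by simp), lintegral_one_sub_cos_mul_exp hs',
        ← ENNReal.ofReal_mul (by positivity), ← ENNReal.ofReal_mul (by positivity),
        rpow_sub hs', rpow_one]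
      congr 1
      field_simp
    rw [setLIntegral_congr_fun measurableSet_Ioi h2, lintegral_const_mul' _ _ (by simp),
      lintegral_rpow_div_one_add_sq hα0 hα2, ← ENNReal.ofReal_mul (by positivity)]
    congr 1
    field_simp
  · refine Measurable.aemeasurable ?_
    fun_prop

/-- The constant `C_α = π / (Γ(α) sin(πα/2))` is positive. -/
lemma pi_div_Gamma_mul_sin_pos {α : ℝ} (hα0 : 0 < α) (hα2 : α < 2) :
    0 < π / (Gamma α * sin (π * α / 2)) := by
  have h1 : 0 < sin (π * α / 2) :=
    sin_pos_of_pos_of_lt_pi (by positivity) (by nlinarith [pi_pos])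
  have h2 := Gamma_pos_of_pos hα0
  positivity

lemma one_sub_cos_le_sq (y : ℝ) : 1 - cos y ≤ y ^ 2 / 2 := by
  linarith [one_sub_sq_div_two_le_cos (x := y)]

end PowerIntegral

section RegularVariation

open Real Set

variable {μ : Measure ℝ} [IsFiniteMeasure μ] {α : ℝ}

lemma antitone_measureReal_Ici (μ : Measure ℝ) [IsFiniteMeasure μ] :
    Antitone fun x : ℝ => μ.real (Ici x) := fun _ _ h => measureReal_mono (Ici_subset_Ici.2 h)

/-- A Potter-type bound for a regularly varying tail. -/
lemma exists_potter_bound (hpos : ∀ x > (0 : ℝ), 0 < μ.real (Ici x))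
    (hrv : ∀ c > (0 : ℝ),
      Tendsto (fun x : ℝ => μ.real (Ici (c * x)) / μ.real (Ici x)) atTop (nhds (c ^ (-α))))
    {β : ℝ} (hβ0 : 0 < β) (hβ : α < β) :
    ∃ C > 0, ∃ x₀ > 0, ∀ z ≥ x₀, ∀ x > 0, x ≤ z →
      μ.real (Ici x) ≤ C * (z / x) ^ β * μ.real (Ici z) := by
  have h1 := hrv (1 / 2) (by norm_num)
  have h2 : ((1 : ℝ) / 2) ^ (-α) < 2 ^ β := by
    rw [one_div, inv_rpow (by norm_num), rpow_neg (by norm_num), inv_inv]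
    exact rpow_lt_rpow_of_exponent_lt (by norm_num) hβ
  obtain ⟨x₁, hx₁⟩ := eventually_atTop.1 (h1.eventually_lt_const h2)
  set x₀ := max x₁ 1 with hx₀
  have hx₀pos : 0 < x₀ := lt_max_of_lt_right one_pos
  have hhalf : ∀ z ≥ x₀, μ.real (Ici (z / 2)) ≤ 2 ^ β * μ.real (Ici z) := by
    intro z hz
    have := hx₁ z ((le_max_left _ _).trans hz)
    rw [div_lt_iff₀ (hpos z (hx₀pos.trans_le hz))] at this
    rw [show z / 2 = 1 / 2 * z by ring]
    exact this.le
  have key : ∀ k : ℕ, ∀ z ≥ x₀, ∀ x ≥ x₀, x ≤ z → z / 2 ^ k ≤ x →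
      μ.real (Ici x) ≤ 2 ^ β * (z / x) ^ β * μ.real (Ici z) := by
    intro k
    induction k with
    | zero =>
      intro z hz x hx hxz hk
      have : x = z := le_antisymm hxz (by simpa using hk)
      subst this
      have hx0 : 0 < x := hx₀pos.trans_le hx
      rw [div_self hx0.ne', one_rpow, mul_one]
      exact le_mul_of_one_le_left measureReal_nonneg (one_le_rpow (by norm_num) hβ0.le)
    | succ k ih =>
      intro z hz x hx hxz hk
      have hx0 : 0 < x := hx₀pos.trans_le hx
      have hz0 : 0 < z := hx₀pos.trans_le hz
      have hG : 0 ≤ μ.real (Ici z) := measureReal_nonneg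
      rcases le_or_gt (z / 2) x with h | h
      · refine (antitone_measureReal_Ici μ h).trans ((hhalf z hz).trans ?_)
        refine mul_le_mul_of_nonneg_right ?_ hG
        exact le_mul_of_one_le_right (by positivity)
          (one_le_rpow ((one_le_div hx0).2 hxz) hβ0.le)
      · have h3 := ih (z / 2) (hx.le.trans h.le) x hx h.le (by
          rw [div_div]; rwa [pow_succ, mul_comm] at hk)
        refine h3.trans ?_
        have h4 : (z / x) ^ β = 2 ^ β * (z / 2 / x) ^ β := by
          rw [← mul_rpow (by norm_num) (by positivity)]
          congr 1; ring
        rw [h4]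
        calc 2 ^ β * (z / 2 / x) ^ β * μ.real (Ici (z / 2))
            ≤ 2 ^ β * (z / 2 / x) ^ β * (2 ^ β * μ.real (Ici z)) := by
              gcongr; exact hhalf z hz
          _ = _ := by ring
  have key' : ∀ z ≥ x₀, ∀ x ≥ x₀, x ≤ z →
      μ.real (Ici x) ≤ 2 ^ β * (z / x) ^ β * μ.real (Ici z) := by
    intro z hz x hx hxz
    have hx0 : 0 < x := hx₀pos.trans_le hx
    obtain ⟨k, hk⟩ := pow_unbounded_of_one_lt (z / x) (one_lt_two)
    refine key k z hz x hx hxz ?_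
    rw [div_le_iff₀ (by positivity)]
    rw [div_lt_iff₀ hx0] at hk
    linarith
  set M := max 1 (μ.real (Ici 0) / μ.real (Ici x₀)) with hM
  have hM1 : 1 ≤ M := le_max_left _ _
  refine ⟨2 ^ β * M, by positivity, x₀, hx₀pos, fun z hz x hx hxz => ?_⟩
  have hz0 : 0 < z := hx₀pos.trans_le hz
  have hG : 0 ≤ μ.real (Ici z) := measureReal_nonneg
  rcases le_or_gt x₀ x with h | h
  · refine (key' z hz x h hxz).trans ?_
    refine mul_le_mul_of_nonneg_right ?_ hG
    refine mul_le_mul_of_nonneg_right ?_ (by positivity)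
    exact le_mul_of_one_le_right (by positivity) hM1
  · have h0 : μ.real (Ici x) ≤ M * μ.real (Ici x₀) := by
      refine (antitone_measureReal_Ici μ hx.le).trans ?_
      rw [← div_le_iff₀ (hpos x₀ hx₀pos)]
      exact le_max_right _ _
    refine h0.trans ?_
    have h5 := key' z hz x₀ le_rfl hz
    calc M * μ.real (Ici x₀) ≤ M * (2 ^ β * (z / x₀) ^ β * μ.real (Ici z)) := by gcongr
      _ ≤ M * (2 ^ β * (z / x) ^ β * μ.real (Ici z)) := by gcongr
      _ = _ := by ring

/-- Integration by parts for `1 - cos` against a finite measure. -/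
lemma setIntegral_one_sub_cos_eq {K x : ℝ} (hx : 0 < x) (hK : cos K = 1) :
    ∫ z in Ioo 0 (K * x), (1 - cos (z / x)) ∂μ = ∫ y in Ioc 0 K, sin y * μ.real (Ici (y * x)) := by
  rcases le_or_gt K 0 with hK0 | hK0
  · rw [Ioo_eq_empty (by nlinarith), Ioc_eq_empty (by linarith)]; simp
  have hsin : ∀ a, ∫ y in (0 : ℝ)..a, sin y = 1 - cos a := by
    intro a; rw [integral_sin, cos_zero]
  have h1 : ∀ z ∈ Ioo 0 (K * x), 1 - cos (z / x)
      = ∫ y in Ioc 0 K, (Iic (z / x)).indicator sin y := by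
    intro z hz
    have hz0 : 0 ≤ z / x := div_nonneg hz.1.le hx.le
    have hzK : z / x ≤ K := ((div_lt_iff₀ hx).2 hz.2).le
    rw [setIntegral_indicator measurableSet_Iic, Ioc_inter_Iic, min_eq_right hzK,
      ← intervalIntegral.integral_of_le hz0, hsin]
  rw [setIntegral_congr_fun measurableSet_Ioo h1, integral_integral_swap]
  · have h2 : ∀ y ∈ Ioc 0 K, ∫ z in Ioo 0 (K * x), (Iic (z / x)).indicator sin y ∂μ
        = sin y * μ.real (Ici (y * x)) - sin y * μ.real (Ici (K * x)) := by
      intro y hy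
      have h3 : ∀ z, (Iic (z / x)).indicator sin y = (Ici (y * x)).indicator (fun _ => sin y) z := by
        intro z
        simp only [indicator, mem_Iic, mem_Ici, le_div_iff₀ hx]
      simp_rw [h3]
      rw [setIntegral_indicator measurableSet_Ici, setIntegral_const, smul_eq_mul, mul_comm,
        ← mul_sub]
      congr 1
      have h4 : Ioo 0 (K * x) ∩ Ici (y * x) = Ici (y * x) \ Ici (K * x) := by
        ext z
        simp only [mem_inter_iff, mem_Ioo, mem_Ici, Set.mem_sdiff, not_le]
        have : 0 < y * x := mul_pos hy.1 hx
        constructor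
        · rintro ⟨⟨_, h⟩, h'⟩; exact ⟨h', h⟩
        · rintro ⟨h', h⟩; exact ⟨⟨this.trans_le h', h⟩, h'⟩
      rw [h4, measureReal_sdiff (Ici_subset_Ici.2 (mul_le_mul_of_nonneg_right hy.2 hx.le))
        measurableSet_Ici]
    rw [setIntegral_congr_fun measurableSet_Ioc h2, integral_sub, integral_mul_const,
      ← intervalIntegral.integral_of_le (f := sin) hK0.le, hsin, hK]
    · simp
    · refine Measure.integrableOn_of_bounded (M := μ.real univ) (by simp) ?_ ?_
      · exact (continuous_sin.measurable.mul ((antitone_measureReal_Ici μ).measurable.comp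
          (measurable_id.mul_const x))).aestronglyMeasurable
      · refine ae_of_all _ fun y => ?_
        rw [norm_mul, norm_of_nonneg measureReal_nonneg]
        calc ‖sin y‖ * μ.real (Ici (y * x)) ≤ 1 * μ.real univ := by
              gcongr
              · exact abs_sin_le_one y
              · exact measure_ne_top _ _
              · exact subset_univ _
          _ = _ := one_mul _
    · exact ((continuous_sin.integrableOn_Icc).mono_set Ioc_subset_Icc_self).mul_const _
  · refine Integrable.of_bound (C := 1) ?_ ?_
    · refine Measurable.aestronglyMeasurable ?_
      have : (Function.uncurry fun z y => (Iic (z / x)).indicator sin y)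
          = {p : ℝ × ℝ | p.2 ≤ p.1 / x}.indicator (fun p => sin p.2) := by
        ext p; simp [Function.uncurry, indicator]
      rw [this]
      exact (by fun_prop : Measurable fun p : ℝ × ℝ => sin p.2).indicator
        (measurableSet_le (by fun_prop) (by fun_prop))
    · refine ae_of_all _ fun p => ?_
      simp only [Function.uncurry]
      exact (norm_indicator_le_norm_self _ _).trans (abs_sin_le_one _)

lemma integrableOn_sin_mul_rpow (hα2 : α < 2) (K : ℝ) :
    IntegrableOn (fun y => sin y * y ^ (-α)) (Ioc 0 K) := by
  rcases le_or_gt K 0 with hK0 | hK0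
  · rw [Ioc_eq_empty (by linarith)]; simp
  have hb : IntegrableOn (fun y : ℝ => y ^ (1 - α)) (Ioc 0 K) :=
    (intervalIntegrable_iff_integrableOn_Ioc_of_le hK0.le).1
      (intervalIntegral.intervalIntegrable_rpow' (by linarith))
  refine Integrable.mono' hb (by fun_prop : Measurable _).aestronglyMeasurable ?_
  filter_upwards [ae_restrict_mem measurableSet_Ioc] with y hy
  have hy0 : 0 < y := hy.1
  rw [norm_mul, norm_of_nonneg (by positivity : 0 ≤ y ^ (-α)), sub_eq_add_neg, rpow_add hy0,
    rpow_one]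
  gcongr
  exact (abs_sin_lt_abs hy0.ne').le.trans_eq (abs_of_pos hy0)

lemma integrableOn_one_sub_cos_mul_rpow (hα0 : 0 < α) (hα2 : α < 2) :
    IntegrableOn (fun y => (1 - cos y) * (α * y ^ (-α - 1))) (Ioi 0) := by
  refine ⟨(by fun_prop : Measurable _).aestronglyMeasurable, ?_⟩
  rw [hasFiniteIntegral_iff_ofReal]
  · rw [lintegral_one_sub_cos_mul_rpow hα0 hα2]; exact ENNReal.ofReal_lt_top
  · filter_upwards [ae_restrict_mem measurableSet_Ioi] with y hy
    have : (0 : ℝ) < y := hy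
    have := cos_le_one y
    exact mul_nonneg (by linarith) (by positivity)

lemma integral_one_sub_cos_mul_rpow (hα0 : 0 < α) (hα2 : α < 2) :
    ∫ y in Ioi 0, (1 - cos y) * (α * y ^ (-α - 1)) = π / (Gamma α * sin (π * α / 2)) / 2 := by
  rw [integral_eq_lintegral_of_nonneg_ae, lintegral_one_sub_cos_mul_rpow hα0 hα2,
    ENNReal.toReal_ofReal]
  · have := pi_div_Gamma_mul_sin_pos hα0 hα2; positivity
  · filter_upwards [ae_restrict_mem measurableSet_Ioi] with y hy
    have : (0 : ℝ) < y := hy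
    have := cos_le_one y
    exact mul_nonneg (by linarith) (by positivity)
  · exact (by fun_prop : Measurable _).aestronglyMeasurable

lemma setIntegral_sin_mul_rpow_eq (hα0 : 0 < α) (hα2 : α < 2) {K : ℝ} (hK0 : 0 < K)
    (hK : cos K = 1) :
    ∫ y in Ioc 0 K, sin y * y ^ (-α) = ∫ y in (0)..K, (1 - cos y) * (α * y ^ (-α - 1)) := by
  have hi1 := integrableOn_sin_mul_rpow hα2 K
  have hi2 : IntegrableOn (fun y => (1 - cos y) * (α * y ^ (-α - 1))) (Ioc 0 K) :=
    (integrableOn_one_sub_cos_mul_rpow hα0 hα2).mono_set Ioc_subset_Ioi_self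
  rw [intervalIntegral.integral_of_le hK0.le, ← sub_eq_zero, ← integral_sub hi1 hi2,
    ← intervalIntegral.integral_of_le hK0.le]
  have hmain := intervalIntegral.integral_eq_sub_of_hasDerivAt_of_le
    (f := fun y => (1 - cos y) * y ^ (-α)) hK0.le (f' := fun y => sin y * y ^ (-α)
      - (1 - cos y) * (α * y ^ (-α - 1))) ?_ ?_ ?_
  · rw [hmain]; simp [hK]
  · intro y hy
    rcases eq_or_lt_of_le hy.1 with h | h
    · subst h
      refine ContinuousAt.continuousWithinAt ?_
      have hz : (fun y : ℝ => (1 - cos y) * y ^ (-α)) 0 = 0 := by simp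
      unfold ContinuousAt
      rw [hz]
      have hb : Tendsto (fun y : ℝ => |y| ^ (2 - α) / 2) (nhds 0) (nhds 0) := by
        have : ContinuousAt (fun y : ℝ => |y| ^ (2 - α) / 2) 0 :=
          (continuous_abs.continuousAt.rpow_const (Or.inr (by linarith))).div_const _
        have h2 := this.tendsto
        simpa [zero_rpow (by linarith : (2 - α) ≠ 0)] using h2
      refine squeeze_zero_norm (fun y => ?_) hb
      have hc : 0 ≤ 1 - cos y := by linarith [cos_le_one y]
      rw [norm_mul, norm_of_nonneg hc]
      rcases eq_or_ne y 0 with rfl | hy0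
      · simp [zero_rpow (by linarith : (2 - α) ≠ 0)]
      have hy1 : 0 < |y| := abs_pos.2 hy0
      calc (1 - cos y) * ‖y ^ (-α)‖ ≤ |y| ^ 2 / 2 * |y| ^ (-α) := by
            gcongr
            · rw [sq_abs]; exact one_sub_cos_le_sq y
            · exact abs_rpow_le_abs_rpow _ _
        _ = _ := by
            rw [sub_eq_add_neg, rpow_add hy1, rpow_two]; ring
    · refine ContinuousAt.continuousWithinAt ?_
      exact (by fun_prop : Continuous fun y => 1 - cos y).continuousAt.mul
        (continuousAt_rpow_const _ _ (Or.inl h.ne'))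
  · intro y hy
    have h1 : HasDerivAt (fun y => 1 - cos y) (sin y) y := by
      simpa using (hasDerivAt_cos y).const_sub 1
    have h2 := hasDerivAt_rpow_const (p := -α) (Or.inl hy.1.ne')
    refine (h1.mul h2).congr_deriv ?_
    ring
  · exact (intervalIntegrable_iff_integrableOn_Ioc_of_le hK0.le).2 (hi1.sub hi2)

lemma tendsto_setIntegral_sin_mul_tail (hpos : ∀ x > (0 : ℝ), 0 < μ.real (Ici x))
    (hrv : ∀ c > (0 : ℝ),
      Tendsto (fun x : ℝ => μ.real (Ici (c * x)) / μ.real (Ici x)) atTop (nhds (c ^ (-α))))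
    (hα0 : 0 < α) (hα2 : α < 2) (K : ℝ) :
    Tendsto (fun x => ∫ y in Ioc 0 K, sin y * (μ.real (Ici (y * x)) / μ.real (Ici x))) atTop
      (nhds (∫ y in Ioc 0 K, sin y * y ^ (-α))) := by
  rcases le_or_gt K 0 with hK0 | hK0
  · rw [Ioc_eq_empty (by linarith)]; simp
  set β := (α + 2) / 2 with hβ
  obtain ⟨C, hC, x₀, hx₀, hpot⟩ := exists_potter_bound hpos hrv (β := β) (by linarith)
    (by linarith)
  have hb : IntegrableOn (fun y : ℝ => C * y ^ (1 - β) + 1) (Ioc 0 K) :=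
    ((intervalIntegrable_iff_integrableOn_Ioc_of_le hK0.le).1
      (intervalIntegral.intervalIntegrable_rpow' (by linarith))).const_mul C |>.add
      (by simp)
  refine tendsto_integral_filter_of_dominated_convergence (fun y => C * y ^ (1 - β) + 1) ?_ ?_ hb ?_
  · refine Eventually.of_forall fun x => ?_
    exact (continuous_sin.measurable.mul (((antitone_measureReal_Ici μ).measurable.comp
          (measurable_id.mul_const x)).div_const _)).aestronglyMeasurable
  · filter_upwards [eventually_ge_atTop x₀] with x hx
    filter_upwards [ae_restrict_mem measurableSet_Ioc] with y hy
    have hy0 : 0 < y := hy.1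
    have hx0 : 0 < x := hx₀.trans_le hx
    have hGx := hpos x hx0
    rw [norm_mul, norm_of_nonneg (div_nonneg measureReal_nonneg hGx.le)]
    rcases le_or_gt y 1 with h | h
    · have h1 := hpot x hx (y * x) (by positivity) (by nlinarith)
      rw [← div_le_iff₀ hGx] at h1
      have h2 : x / (y * x) = y⁻¹ := by field_simp
      rw [h2, inv_rpow hy0.le, ← rpow_neg hy0.le] at h1
      calc ‖sin y‖ * (μ.real (Ici (y * x)) / μ.real (Ici x)) ≤ y * (C * y ^ (-β)) := by
            gcongr
            exact (abs_sin_lt_abs hy0.ne').le.trans_eq (abs_of_pos hy0)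
        _ = C * y ^ (1 - β) := by rw [sub_eq_add_neg, rpow_add hy0, rpow_one]; ring
        _ ≤ _ := by linarith
    · have h1 : μ.real (Ici (y * x)) / μ.real (Ici x) ≤ 1 :=
        div_le_one_of_le₀ (antitone_measureReal_Ici μ (by nlinarith)) hGx.le
      have h2 : 0 ≤ C * y ^ (1 - β) := by positivity
      calc ‖sin y‖ * (μ.real (Ici (y * x)) / μ.real (Ici x)) ≤ 1 * 1 := by
            gcongr
            exact abs_sin_le_one y
        _ ≤ _ := by linarith
  · filter_upwards [ae_restrict_mem measurableSet_Ioc] with y hy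
    exact (hrv y hy.1).const_mul _

lemma integral_one_sub_cos_eq_two_mul (hsymm : μ.map (fun x => -x) = μ) (x : ℝ) :
    ∫ z, (1 - cos (z / x)) ∂μ = 2 * ∫ z in Ioi 0, (1 - cos (z / x)) ∂μ := by
  have hint : Integrable (fun z => 1 - cos (z / x)) μ := by
    refine Integrable.of_bound (C := 2) (by fun_prop) (ae_of_all _ fun z => ?_)
    rw [norm_eq_abs, abs_le]; constructor <;> linarith [cos_le_one (z / x), neg_one_le_cos (z / x)]
  have h1 : ∫ z in Iic 0, (1 - cos (z / x)) ∂μ = ∫ z in Iio 0, (1 - cos (z / x)) ∂μ := by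
    rw [← Iio_union_right, setIntegral_union (by simp) (measurableSet_singleton _)
      hint.integrableOn hint.integrableOn]
    have : ∫ z in ({0} : Set ℝ), (1 - cos (z / x)) ∂μ = 0 := by
      rw [integral_singleton]; simp
    rw [this, add_zero]
  have h2 : ∫ z in Iio 0, (1 - cos (z / x)) ∂μ = ∫ z in Ioi 0, (1 - cos (z / x)) ∂μ := by
    conv_lhs => rw [← hsymm]
    rw [setIntegral_map measurableSet_Iio (by fun_prop) (by fun_prop)]
    simp [neg_div]
  rw [← integral_add_compl measurableSet_Iic hint (s := Iic (0 : ℝ)), compl_Iic, h1, h2]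
  ring

/-- The Abelian theorem: `∫ (1 - cos (z / x)) μ(dz) ∼ C_α μ([x, ∞))`. -/
theorem tendsto_integral_one_sub_cos_div_tail (hsymm : μ.map (fun x => -x) = μ)
    (hpos : ∀ x > (0 : ℝ), 0 < μ.real (Ici x))
    (hrv : ∀ c > (0 : ℝ),
      Tendsto (fun x : ℝ => μ.real (Ici (c * x)) / μ.real (Ici x)) atTop (nhds (c ^ (-α))))
    (hα0 : 0 < α) (hα2 : α < 2) :
    Tendsto (fun x => (∫ z, (1 - cos (z / x)) ∂μ) / μ.real (Ici x)) atTop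
      (nhds (π / (Gamma α * sin (π * α / 2)))) := by
  set J := π / (Gamma α * sin (π * α / 2)) / 2 with hJ
  suffices h : Tendsto (fun x => (∫ z in Ioi 0, (1 - cos (z / x)) ∂μ) / μ.real (Ici x)) atTop
      (nhds J) by
    have h2 := h.const_mul 2
    rw [show 2 * J = π / (Gamma α * sin (π * α / 2)) by rw [hJ]; ring] at h2
    refine h2.congr fun x => ?_
    rw [integral_one_sub_cos_eq_two_mul hsymm]; ring
  have hint : ∀ x, Integrable (fun z => 1 - cos (z / x)) μ := by
    intro x
    refine Integrable.of_bound (C := 2) (by fun_prop) (ae_of_all _ fun z => ?_)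
    rw [norm_eq_abs, abs_le]; constructor <;> linarith [cos_le_one (z / x), neg_one_le_cos (z / x)]
  have hKt : Tendsto (fun N : ℕ => ((N : ℝ) * (2 * π))) atTop atTop :=
    tendsto_natCast_atTop_atTop.atTop_mul_const (by positivity)
  have hJK := intervalIntegral_tendsto_integral_Ioi 0
    (integrableOn_one_sub_cos_mul_rpow hα0 hα2) hKt
  rw [integral_one_sub_cos_mul_rpow hα0 hα2] at hJK
  have htail : Tendsto (fun N : ℕ => 2 * ((N : ℝ) * (2 * π)) ^ (-α)) atTop (nhds 0) := by
    simpa using ((tendsto_rpow_neg_atTop hα0).comp hKt).const_mul 2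
  rw [Metric.tendsto_atTop']
  intro ε hε
  obtain ⟨N, hN1, hN2, hN0⟩ := ((Metric.tendsto_nhds.1 hJK (ε / 4) (by positivity)).and
    ((htail.eventually_lt_const (by positivity : 0 < ε / 4)).and (eventually_gt_atTop 0))).exists
  set K : ℝ := N * (2 * π) with hK
  have hK0 : 0 < K := by have : (0 : ℝ) < N := by exact_mod_cast hN0
                         positivity
  have hcos : cos K = 1 := cos_nat_mul_two_pi N
  have hI := tendsto_setIntegral_sin_mul_tail hpos hrv hα0 hα2 K
  rw [setIntegral_sin_mul_rpow_eq hα0 hα2 hK0 hcos] at hI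
  have hT := (hrv K hK0).const_mul 2
  obtain ⟨x₁, hx₁⟩ := eventually_atTop.1 ((Metric.tendsto_nhds.1 hI (ε / 4) (by positivity)).and
    ((hT.eventually_lt_const hN2).and (eventually_gt_atTop 0)))
  refine ⟨x₁, fun x hx => ?_⟩
  obtain ⟨h1, h2, hx0⟩ := hx₁ x hx.le
  have hsplit : ∫ z in Ioi 0, (1 - cos (z / x)) ∂μ
      = ∫ z in Ioo 0 (K * x), (1 - cos (z / x)) ∂μ + ∫ z in Ici (K * x), (1 - cos (z / x)) ∂μ := by
    rw [← Ioo_union_Ici_eq_Ioi (by positivity : 0 < K * x), setIntegral_union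
      (by rw [Set.disjoint_left]; rintro z hz hz'; exact absurd hz.2 (not_lt.2 hz'))
      measurableSet_Ici (hint x).integrableOn (hint x).integrableOn]
  have hR0 : 0 ≤ ∫ z in Ici (K * x), (1 - cos (z / x)) ∂μ :=
    integral_nonneg fun z => by simpa using cos_le_one (z / x)
  have hR1 : ∫ z in Ici (K * x), (1 - cos (z / x)) ∂μ ≤ 2 * μ.real (Ici (K * x)) := by
    have : ∫ z in Ici (K * x), (1 - cos (z / x)) ∂μ ≤ ∫ z in Ici (K * x), (2 : ℝ) ∂μ :=
      integral_mono (hint x).integrableOn (integrable_const _)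
        fun z => by linarith [neg_one_le_cos (z / x)]
    simpa [mul_comm] using this
  have hGx := hpos x hx0
  have hI' : (∫ z in Ioo 0 (K * x), (1 - cos (z / x)) ∂μ) / μ.real (Ici x)
      = ∫ y in Ioc 0 K, sin y * (μ.real (Ici (y * x)) / μ.real (Ici x)) := by
    rw [setIntegral_one_sub_cos_eq hx0 hcos, ← integral_div]
    simp_rw [mul_div_assoc]
  rw [hsplit, add_div, hI']
  have hR2 : (∫ z in Ici (K * x), (1 - cos (z / x)) ∂μ) / μ.real (Ici x)
      ≤ 2 * (μ.real (Ici (K * x)) / μ.real (Ici x)) := by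
    rw [← mul_div_assoc]; gcongr
  have hR3 : 0 ≤ (∫ z in Ici (K * x), (1 - cos (z / x)) ∂μ) / μ.real (Ici x) := by positivity
  rw [Real.dist_eq, abs_lt] at h1 hN1 ⊢
  constructor <;> linarith [h1.1, h1.2, hN1.1, hN1.2]

end RegularVariation

section TailInverse

open Real Set

variable {μ : Measure ℝ} [IsFiniteMeasure μ] {α : ℝ}

lemma tendsto_measureReal_Ici_atTop (μ : Measure ℝ) [IsFiniteMeasure μ] :
    Tendsto (fun x : ℝ => μ.real (Ici x)) atTop (nhds 0) := by
  have h := tendsto_measure_iInter_atTop (μ := μ) (s := fun x : ℝ => Ici x)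
    (fun _ => measurableSet_Ici.nullMeasurableSet) (fun _ _ h => Ici_subset_Ici.2 h)
    ⟨0, measure_ne_top _ _⟩
  have h0 : (⋂ x : ℝ, Ici x) = ∅ := by
    ext y; simp only [mem_iInter, mem_Ici, mem_empty_iff_false, iff_false, not_forall, not_le]
    exact ⟨y + 1, by linarith⟩
  rw [h0, measure_empty] at h
  exact (ENNReal.tendsto_toReal ENNReal.zero_ne_top).comp h

variable {h : ℝ → ℝ} (hh : ∀ y : ℝ, h y = sInf {x : ℝ | 0 ≤ x ∧ μ.real (Ici x) ≤ y})

include hh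

lemma tendsto_tailInverse (hpos : ∀ x > (0 : ℝ), 0 < μ.real (Ici x)) :
    Tendsto h (nhdsWithin 0 (Ioi 0)) atTop := by
  refine tendsto_atTop.2 fun M => ?_
  have hM : 0 < μ.real (Ici (max M 1)) := hpos _ (lt_max_of_lt_right one_pos)
  filter_upwards [Ioo_mem_nhdsGT hM] with y hy
  rw [hh]
  refine le_csInf ?_ fun x hx => ?_
  · obtain ⟨x, h1, h2⟩ := (((tendsto_measureReal_Ici_atTop μ).eventually_lt_const hy.1).and
      (eventually_ge_atTop 0)).exists
    exact ⟨x, h2, h1.le⟩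
  · by_contra! hlt
    have := antitone_measureReal_Ici μ (hlt.le.trans (le_max_left M 1))
    have h3 := hx.2
    simp only at this
    linarith [hy.2]

lemma tendsto_tail_tailInverse_div (hpos : ∀ x > (0 : ℝ), 0 < μ.real (Ici x))
    (hrv : ∀ c > (0 : ℝ),
      Tendsto (fun x : ℝ => μ.real (Ici (c * x)) / μ.real (Ici x)) atTop (nhds (c ^ (-α)))) :
    Tendsto (fun y => μ.real (Ici (h y)) / y) (nhdsWithin 0 (Ioi 0)) (nhds 1) := by
  have ht := tendsto_tailInverse hh hpos
  have hc : ∀ c > (0 : ℝ), Tendsto (fun y => μ.real (Ici (h y)) / μ.real (Ici (c * h y)))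
      (nhdsWithin 0 (Ioi 0)) (nhds (c ^ α)) := by
    intro c hc
    have := (((hrv c hc).comp ht).inv₀ (by positivity))
    rw [← rpow_neg hc.le, neg_neg] at this
    exact this.congr fun y => by simp
  have hcont : Tendsto (fun c : ℝ => c ^ α) (nhds 1) (nhds 1) := by
    have := (continuousAt_rpow_const 1 α (Or.inl one_ne_zero)).tendsto
    rwa [one_rpow] at this
  rw [tendsto_order]
  constructor
  · intro a ha
    obtain ⟨c, hca, hc0, hc1⟩ := (((hcont.mono_left nhdsWithin_le_nhds).eventually_const_lt ha).and
      (Ioo_mem_nhdsLT (zero_lt_one (α := ℝ)))).exists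
    filter_upwards [(hc c hc0).eventually_const_lt hca, ht.eventually_gt_atTop 0,
      self_mem_nhdsWithin] with y h1 h2 h3
    refine h1.trans_le ?_
    have h4 : y ≤ μ.real (Ici (c * h y)) := by
      by_contra! hlt
      have : h y ≤ c * h y := by
        conv_lhs => rw [hh]
        exact csInf_le ⟨0, fun x hx => hx.1⟩ ⟨by positivity, hlt.le⟩
      nlinarith
    exact div_le_div_of_nonneg_left measureReal_nonneg h3 h4
  · intro a ha
    obtain ⟨c, hca, hc1, hc2⟩ := (((hcont.mono_left nhdsWithin_le_nhds).eventually_lt_const ha).and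
      (Ioo_mem_nhdsGT (one_lt_two (α := ℝ)))).exists
    filter_upwards [(hc c (by linarith)).eventually_lt_const hca, ht.eventually_gt_atTop 0,
      self_mem_nhdsWithin] with y h1 h2 h3
    refine lt_of_le_of_lt ?_ h1
    have h4 : μ.real (Ici (c * h y)) ≤ y := by
      have h5 : sInf {x : ℝ | 0 ≤ x ∧ μ.real (Ici x) ≤ y} < c * h y := by
        rw [← hh]; nlinarith
      obtain ⟨x, h6, h7⟩ := (tendsto_measureReal_Ici_atTop μ).eventually_lt_const
        (show (0 : ℝ) < y from h3) |>.and (eventually_ge_atTop 0) |>.exists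
      obtain ⟨z, hx, hlt⟩ := exists_lt_of_csInf_lt
        (show {x : ℝ | 0 ≤ x ∧ μ.real (Ici x) ≤ y}.Nonempty from ⟨x, h7, h6.le⟩) h5
      exact (antitone_measureReal_Ici μ hlt.le).trans hx.2
    exact div_le_div_of_nonneg_left measureReal_nonneg (hpos _ (by nlinarith)) h4

end TailInverse

section SpectralIncrement

open Real Set

variable {μ : Measure ℝ} [IsFiniteMeasure μ] {α : ℝ}

/-- The variogram `t ↦ ∫ (1 - cos (t z)) μ(dz)` of the stationary process with spectral
measure `μ`. -/
noncomputable def variogram (μ : Measure ℝ) (t : ℝ) : ℝ := ∫ z, (1 - cos (t * z)) ∂μ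

lemma variogram_abs (μ : Measure ℝ) (t : ℝ) : variogram μ |t| = variogram μ t := by
  rcases abs_cases t with h | h <;> simp [variogram, h.1]

@[simp] lemma variogram_zero (μ : Measure ℝ) : variogram μ 0 = 0 := by simp [variogram]

variable (hsymm : μ.map (fun x => -x) = μ) (hpos : ∀ x > (0 : ℝ), 0 < μ.real (Ici x))
    (hrv : ∀ c > (0 : ℝ),
      Tendsto (fun x : ℝ => μ.real (Ici (c * x)) / μ.real (Ici x)) atTop (nhds (c ^ (-α))))
    (hα0 : 0 < α) (hα2 : α < 2)

include hsymm hpos hrv hα0 hα2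

lemma tendsto_variogram_div_tail :
    Tendsto (fun x => variogram μ x⁻¹ / μ.real (Ici x)) atTop
      (nhds (π / (Gamma α * sin (π * α / 2)))) := by
  refine (tendsto_integral_one_sub_cos_div_tail hsymm hpos hrv hα0 hα2).congr fun x => ?_
  simp only [variogram, div_eq_inv_mul]

variable {h δ : ℝ → ℝ} (hh : ∀ y : ℝ, h y = sInf {x : ℝ | 0 ≤ x ∧ μ.real (Ici x) ≤ y})
  (hδ : ∀ u : ℝ, δ u = (h (u ^ (-2 : ℝ)))⁻¹)

omit hsymm hpos hrv hα0 hα2 [IsFiniteMeasure μ] in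
lemma tendsto_rpow_neg_two : Tendsto (fun u : ℝ => u ^ (-2 : ℝ)) atTop (nhdsWithin 0 (Ioi 0)) := by
  refine tendsto_nhdsWithin_iff.2 ⟨tendsto_rpow_neg_atTop (by norm_num), ?_⟩
  filter_upwards [eventually_gt_atTop 0] with u hu
  exact rpow_pos_of_pos hu _

include hh hδ

omit hsymm hrv hα0 hα2 in
lemma tendsto_inv_timeScale : Tendsto (fun u => (δ u)⁻¹) atTop atTop := by
  refine ((tendsto_tailInverse hh hpos).comp tendsto_rpow_neg_two).congr fun u => ?_
  simp [hδ]

omit hsymm hα0 hα2 in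
lemma tendsto_mul_tail {c : ℝ} (hc : 0 < c) :
    Tendsto (fun u => u ^ 2 * μ.real (Ici (c * (δ u)⁻¹))) atTop (nhds (c ^ (-α))) := by
  have h1 := (tendsto_tail_tailInverse_div hh hpos hrv).comp tendsto_rpow_neg_two
  have h2 := (hrv c hc).comp (tendsto_inv_timeScale hpos hh hδ)
  have h3 := h1.mul h2
  rw [one_mul] at h3
  refine h3.congr' ?_
  filter_upwards [eventually_gt_atTop 0,
    (tendsto_inv_timeScale hpos hh hδ).eventually_gt_atTop 0] with u hu hu2
  have e : h (u ^ (-2 : ℝ)) = (δ u)⁻¹ := by simp [hδ]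
  have := (hpos _ hu2).ne'
  simp only [Function.comp, e]
  rw [rpow_neg hu.le, rpow_two]
  generalize μ.real (Ici (δ u)⁻¹) = a at *
  field_simp

lemma tendsto_scaled_variogram (t : ℝ) :
    Tendsto (fun u => u ^ 2 * variogram μ (δ u * t)) atTop
      (nhds (π / (Gamma α * sin (π * α / 2)) * |t| ^ α)) := by
  rcases eq_or_ne t 0 with rfl | ht
  · simp [zero_rpow hα0.ne']
  have ht' : 0 < |t| := abs_pos.2 ht
  have hinv := tendsto_inv_timeScale hpos hh hδ
  have h1 := (tendsto_variogram_div_tail hsymm hpos hrv hα0 hα2).comp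
    (hinv.const_mul_atTop (inv_pos.2 ht'))
  have h2 := tendsto_mul_tail hpos hrv hh hδ (inv_pos.2 ht')
  rw [rpow_neg (inv_pos.2 ht').le, inv_rpow ht'.le, inv_inv] at h2
  refine (h1.mul h2).congr' ?_
  filter_upwards [hinv.eventually_gt_atTop 0] with u hu
  have := (hpos _ (mul_pos (inv_pos.2 ht') hu)).ne'
  have e : variogram μ ((|t|⁻¹ * (δ u)⁻¹)⁻¹) = variogram μ (δ u * t) := by
    rw [← variogram_abs μ (δ u * t), abs_mul, abs_of_pos (inv_pos.1 hu)]
    congr 1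
    rw [mul_inv, inv_inv, inv_inv, mul_comm]
  simp only [Function.comp, e]
  generalize μ.real (Ici (|t|⁻¹ * (δ u)⁻¹)) = a at *
  field_simp

lemma exists_scaled_variogram_le (K : ℝ) :
    ∃ c, ∀ᶠ u in atTop, ∀ t, |t| ≤ K → u ^ 2 * variogram μ (δ u * t) ≤ c := by
  set C := π / (Gamma α * sin (π * α / 2))
  set L := max K 1
  have hL : 0 < L := lt_max_of_lt_right one_pos
  have hC : 0 < C := pi_div_Gamma_mul_sin_pos hα0 hα2
  have hinv := tendsto_inv_timeScale hpos hh hδ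
  obtain ⟨x₀, hx₀⟩ := eventually_atTop.1
    (((tendsto_variogram_div_tail hsymm hpos hrv hα0 hα2).eventually_lt_const
      (show C < 2 * C by linarith)).and (eventually_gt_atTop 0))
  have h2 := tendsto_mul_tail hpos hrv hh hδ (inv_pos.2 hL)
  refine ⟨2 * C * (L⁻¹ ^ (-α) + 1), ?_⟩
  filter_upwards [h2.eventually_lt_const (lt_add_one _), hinv.eventually_gt_atTop 0,
    (hinv.const_mul_atTop (inv_pos.2 hL)).eventually_ge_atTop x₀] with u h3 hu h4 t ht
  rcases eq_or_ne t 0 with rfl | ht0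
  · simp; positivity
  have ht' : 0 < |t| := abs_pos.2 ht0
  have hx : L⁻¹ * (δ u)⁻¹ ≤ |t|⁻¹ * (δ u)⁻¹ := by
    gcongr
    exact ht.trans (le_max_left _ _)
  obtain ⟨h5, h6⟩ := hx₀ _ (h4.trans hx)
  rw [div_lt_iff₀ (hpos _ h6)] at h5
  have e : variogram μ ((|t|⁻¹ * (δ u)⁻¹)⁻¹) = variogram μ (δ u * t) := by
    rw [← variogram_abs μ (δ u * t), abs_mul, abs_of_pos (inv_pos.1 hu)]
    congr 1
    rw [mul_inv, inv_inv, inv_inv, mul_comm]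
  rw [e] at h5
  calc u ^ 2 * variogram μ (δ u * t) ≤ u ^ 2 * (2 * C * μ.real (Ici (L⁻¹ * (δ u)⁻¹))) := by
        gcongr
        refine h5.le.trans ?_
        gcongr
        exact measure_ne_top _ _
    _ = 2 * C * (u ^ 2 * μ.real (Ici (L⁻¹ * (δ u)⁻¹))) := by ring
    _ ≤ _ := by gcongr

omit hh hδ in
lemma exists_variogram_half_le :
    ∃ s₀ > 0, ∀ s > 0, s ≤ s₀ → variogram μ (s / 2) ≤ 2 ^ (-α / 2) * variogram μ s := by
  set C := π / (Gamma α * sin (π * α / 2))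
  have hC : 0 < C := pi_div_Gamma_mul_sin_pos hα0 hα2
  have h1 := tendsto_variogram_div_tail hsymm hpos hrv hα0 hα2
  have h2 := h1.comp (tendsto_id.const_mul_atTop (two_pos (α := ℝ)))
  have h3 := (h2.mul (hrv 2 two_pos)).div h1 hC.ne'
  have h4 : C * 2 ^ (-α) / C < 2 ^ (-α / 2) := by
    rw [mul_div_cancel_left₀ _ hC.ne']
    exact rpow_lt_rpow_of_exponent_lt (by norm_num) (by linarith)
  obtain ⟨x₀, hx₀⟩ := eventually_atTop.1 ((h3.eventually_lt_const h4).and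
    ((eventually_gt_atTop 0).and (h1.eventually_const_lt hC)))
  have hx₀0 := (hx₀ x₀ le_rfl).2.1
  refine ⟨x₀⁻¹, inv_pos.2 hx₀0, fun s hs hs0 => ?_⟩
  obtain ⟨h5, h6, h7⟩ := hx₀ s⁻¹ ((le_inv_comm₀ hs hx₀0).1 hs0)
  have h8 := (hpos _ h6)
  have h9 := hpos (2 * s⁻¹) (by positivity)
  have e : (2 * s⁻¹)⁻¹ = s / 2 := by field_simp
  rw [inv_inv] at h7
  have h10 : 0 < variogram μ s := (div_pos_iff_of_pos_right h8).1 h7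
  simp only [Function.comp, id, Pi.div_apply, e, inv_inv] at h5
  rw [div_lt_iff₀ h7, div_mul_div_cancel₀ h9.ne', ← mul_div_assoc, div_lt_div_iff_of_pos_right h8] at h5
  exact h5.le

lemma exists_scaled_variogram_dyadic_le {r : ℝ} (hr : 0 < r) :
    ∃ c, 0 ≤ c ∧ ∀ᶠ u in atTop, ∀ k : ℕ,
      u ^ 2 * variogram μ (δ u * (r / 2 ^ k)) ≤ c * ((2 : ℝ) ^ (-α / 2)) ^ k := by
  obtain ⟨s₀, hs₀, hs⟩ := exists_variogram_half_le hsymm hpos hrv hα0 hα2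
  have hinv := tendsto_inv_timeScale hpos hh hδ
  set C := π / (Gamma α * sin (π * α / 2))
  have hC : 0 < C := pi_div_Gamma_mul_sin_pos hα0 hα2
  refine ⟨C * |r| ^ α + 1, by positivity, ?_⟩
  filter_upwards [(tendsto_scaled_variogram hsymm hpos hrv hα0 hα2 hh hδ r).eventually_lt_const
    (lt_add_one _), hinv.eventually_gt_atTop 0, hinv.eventually_ge_atTop (r / s₀)] with u h1 h2 h3 k
  have hδ0 : 0 < δ u := inv_pos.1 h2
  have h4 : δ u * r ≤ s₀ := by
    rw [div_le_iff₀ hs₀] at h3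
    calc δ u * r ≤ δ u * ((δ u)⁻¹ * s₀) := by gcongr
      _ = s₀ := by field_simp
  induction k with
  | zero => simpa using h1.le
  | succ k ih =>
    have h5 := hs (δ u * (r / 2 ^ k)) (by positivity) (le_trans (by
      gcongr; exact div_le_self hr.le (one_le_pow₀ (by norm_num))) h4)
    calc u ^ 2 * variogram μ (δ u * (r / 2 ^ (k + 1)))
        = u ^ 2 * variogram μ (δ u * (r / 2 ^ k) / 2) := by
          congr 2; rw [pow_succ]; field_simp
      _ ≤ u ^ 2 * (2 ^ (-α / 2) * variogram μ (δ u * (r / 2 ^ k))) := by gcongr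
      _ = 2 ^ (-α / 2) * (u ^ 2 * variogram μ (δ u * (r / 2 ^ k))) := by ring
      _ ≤ 2 ^ (-α / 2) * ((C * |r| ^ α + 1) * ((2 : ℝ) ^ (-α / 2)) ^ k) := by gcongr
      _ = _ := by rw [pow_succ]; ring

end SpectralIncrement

section GaussianSpan

open Real Set

variable {Ω : Type*} [MeasurableSpace Ω] {P : Measure Ω} {X : ℝ → Ω → ℝ}
  {Z W : Ω → ℝ}

namespace IsZeroMeanGaussianProcess

lemma exists_map_eq_gaussianReal (hX : IsZeroMeanGaussianProcess P X)
    (hZ : Z ∈ Submodule.span ℝ (range X)) :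
    Measurable Z ∧ ∃ v : NNReal, P.map Z = gaussianReal 0 v := by
  obtain ⟨c, rfl⟩ := (Finsupp.mem_span_range_iff_exists_finsupp).1 hZ
  have e : (c.sum fun i a => a • X i) = fun ω => ∑ i : Fin c.support.card,
      c (c.support.equivFin.symm i) * X (c.support.equivFin.symm i) ω := by
    ext ω
    rw [Finsupp.sum, Finset.sum_apply, ← Finset.sum_coe_sort,
      ← Equiv.sum_comp c.support.equivFin.symm]
    rfl
  rw [e]
  exact ⟨Finset.measurable_sum _ fun i _ => (hX.1 _).const_mul _, hX.2 _ _ _⟩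

lemma memLp (hX : IsZeroMeanGaussianProcess P X) (hZ : Z ∈ Submodule.span ℝ (range X))
    {p : ENNReal} (hp : p ≠ ⊤) : MemLp Z p P := by
  obtain ⟨hm, v, hv⟩ := hX.exists_map_eq_gaussianReal hZ
  have := memLp_id_gaussianReal' (μ := 0) (v := v) p hp
  rw [← hv] at this
  exact (memLp_map_measure_iff (by fun_prop) hm.aemeasurable).1 this

lemma integrable_mul (hX : IsZeroMeanGaussianProcess P X) (hZ : Z ∈ Submodule.span ℝ (range X))
    (hW : W ∈ Submodule.span ℝ (range X)) : Integrable (fun ω => Z ω * W ω) P :=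
  (hX.memLp hZ (p := 2) ENNReal.ofNat_ne_top).integrable_mul
    (hX.memLp hW (p := 2) ENNReal.ofNat_ne_top)

lemma map_eq_gaussianReal (hX : IsZeroMeanGaussianProcess P X)
    (hZ : Z ∈ Submodule.span ℝ (range X)) :
    P.map Z = gaussianReal 0 (∫ ω, Z ω ^ 2 ∂P).toNNReal := by
  obtain ⟨hm, v, hv⟩ := hX.exists_map_eq_gaussianReal hZ
  have h1 : ∫ ω, Z ω ^ 2 ∂P = v := by
    rw [← variance_fun_id_gaussianReal (μ := 0) (v := v),
      variance_of_integral_eq_zero (by fun_prop) (by simp), ← hv,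
      integral_map hm.aemeasurable (by fun_prop)]
  rw [hv, h1, Real.toNNReal_coe]

lemma integral_exp_mul_I (hX : IsZeroMeanGaussianProcess P X)
    (hZ : Z ∈ Submodule.span ℝ (range X)) :
    ∫ ω, Complex.exp (Z ω * Complex.I) ∂P
      = Complex.exp (-((∫ ω, Z ω ^ 2 ∂P : ℝ) : ℂ) / 2) := by
  have h1 := charFun_gaussianReal (μ := 0) (v := (∫ ω, Z ω ^ 2 ∂P).toNNReal) 1
  rw [← hX.map_eq_gaussianReal hZ, charFun_apply_real,
    integral_map (hX.exists_map_eq_gaussianReal hZ).1.aemeasurable (by fun_prop),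
    Real.coe_toNNReal _ (by positivity)] at h1
  simp only [Complex.ofReal_one, one_mul] at h1
  rw [h1]
  congr 1
  simp
  ring

lemma indepFun (hX : IsZeroMeanGaussianProcess P X) [IsProbabilityMeasure P]
    (hZ : Z ∈ Submodule.span ℝ (range X))
    (hW : W ∈ Submodule.span ℝ (range X)) (h : ∫ ω, Z ω * W ω ∂P = 0) : IndepFun Z W P := by
  have hZm := (hX.exists_map_eq_gaussianReal hZ).1
  have hWm := (hX.exists_map_eq_gaussianReal hW).1
  rw [indepFun_iff_charFun_prod hZm.aemeasurable hWm.aemeasurable]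
  intro t
  obtain ⟨a, b⟩ := t
  have key : ∀ V ∈ Submodule.span ℝ (range X), ∀ c : ℝ, charFun (P.map V) c =
      Complex.exp (-((∫ ω, (c * V ω) ^ 2 ∂P : ℝ) : ℂ) / 2) := by
    intro V hV c
    rw [charFun_apply_real, integral_map (hX.exists_map_eq_gaussianReal hV).1.aemeasurable
      (by fun_prop)]
    have := hX.integral_exp_mul_I (Submodule.smul_mem _ c hV)
    simp only [Pi.smul_apply, smul_eq_mul] at this
    rw [← this]
    simp
  simp only
  rw [key Z hZ, key W hW, ← Complex.exp_add, charFun_apply, integral_map (by fun_prop)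
    (by fun_prop)]
  have := hX.integral_exp_mul_I (Submodule.add_mem _ (Submodule.smul_mem _ a hZ)
    (Submodule.smul_mem _ b hW))
  have e : ∫ ω, (a * Z ω + b * W ω) ^ 2 ∂P
      = ∫ ω, (a * Z ω) ^ 2 ∂P + ∫ ω, (b * W ω) ^ 2 ∂P := by
    have i1 := hX.integrable_mul hZ hZ
    have i2 := hX.integrable_mul hW hW
    have i3 := hX.integrable_mul hZ hW
    calc ∫ ω, (a * Z ω + b * W ω) ^ 2 ∂P
        = ∫ ω, ((a ^ 2 * (Z ω * Z ω) + b ^ 2 * (W ω * W ω)) + 2 * a * b * (Z ω * W ω)) ∂P := by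
          congr 1; ext ω; ring
      _ = ∫ ω, a ^ 2 * (Z ω * Z ω) ∂P + ∫ ω, b ^ 2 * (W ω * W ω) ∂P := by
          rw [integral_add (f := fun ω => a ^ 2 * (Z ω * Z ω) + b ^ 2 * (W ω * W ω))
            ((i1.const_mul _).add (i2.const_mul _)) (i3.const_mul _),
            integral_const_mul, h, mul_zero, add_zero,
            integral_add (i1.const_mul _) (i2.const_mul _)]
      _ = _ := by congr 1 <;> (congr 1; ext ω; ring)
  simp only [Pi.add_apply, Pi.smul_apply, smul_eq_mul, e] at this
  rw [← add_div, ← neg_add, ← Complex.ofReal_add, ← this]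
  simp [WithLp.prod_inner_apply, mul_comm]

/-- Markov's inequality for the moments of order `2 * p` of a centered Gaussian variable. -/
lemma measureReal_lt_abs_le (hX : IsZeroMeanGaussianProcess P X) [IsProbabilityMeasure P]
    (hZ : Z ∈ Submodule.span ℝ (range X)) (p : ℕ) {x : ℝ} (hx : 0 < x) :
    P.real {ω | x < |Z ω|} ≤ (∫ y, y ^ (2 * p) ∂(gaussianReal 0 1)) *
      (∫ ω, Z ω ^ 2 ∂P) ^ p / x ^ (2 * p) := by
  set v := ∫ ω, Z ω ^ 2 ∂P with hv
  have hv0 : 0 ≤ v := by positivity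
  have hZm := (hX.exists_map_eq_gaussianReal hZ).1
  have hmap : P.map Z = (gaussianReal 0 1).map (fun y => √v * y) := by
    rw [hX.map_eq_gaussianReal hZ, gaussianReal_map_const_mul, mul_zero, mul_one]
    congr 1
    ext
    simp [sq_sqrt hv0, ← hv, hv0]
  have hmom : ∫ ω, Z ω ^ (2 * p) ∂P = (∫ y, y ^ (2 * p) ∂(gaussianReal 0 1)) * v ^ p := by
    rw [← integral_map (φ := Z) (f := fun y => y ^ (2 * p)) hZm.aemeasurable (by fun_prop), hmap,
      integral_map (by fun_prop) (by fun_prop), ← integral_mul_const]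
    congr 1; ext y
    rw [mul_pow, pow_mul (√v), sq_sqrt hv0]; ring
  have hint : Integrable (fun ω => Z ω ^ (2 * p)) P := by
    have := (hX.memLp hZ (p := (2 * p : ℕ)) (ENNReal.natCast_ne_top _)).integrable_norm_pow'
    refine this.congr (ae_of_all _ fun ω => ?_)
    simp only [norm_eq_abs]
    rw [pow_mul, sq_abs, ← pow_mul]
  have hM := mul_meas_ge_le_integral_of_nonneg (μ := P) (f := fun ω => Z ω ^ (2 * p))
    (ae_of_all _ fun ω => by simp only [pow_mul]; positivity) hint (x ^ (2 * p))
  rw [hmom] at hM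
  rw [le_div_iff₀ (by positivity), mul_comm]
  refine le_trans ?_ hM
  gcongr
  · exact measure_ne_top _ _
  · intro hlt
    rw [pow_mul, pow_mul, ← sq_abs (Z _)]
    gcongr

end IsZeroMeanGaussianProcess

end GaussianSpan

section ConditionalExceedance

open Real Set

lemma gaussianPDFReal_add_div_mul {m : NNReal} (hm : m ≠ 0) {u : ℝ} (hu : u ≠ 0) (s : ℝ) :
    gaussianPDFReal 0 m (m / u * s + u)
      = gaussianPDFReal 0 m u * exp (-s - m * s ^ 2 / (2 * u ^ 2)) := by
  have hm' : (m : ℝ) ≠ 0 := by exact_mod_cast hm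
  rw [gaussianPDFReal, gaussianPDFReal, mul_assoc _ (exp _) (exp _), ← exp_add]
  congr 2
  field_simp
  ring

lemma setIntegral_Ioi_gaussianReal {m : NNReal} (hm : m ≠ 0) {u : ℝ} (hu : 0 < u) (g : ℝ → ℂ) :
    ∫ x in Ioi u, g (u * (x - u) / m) ∂(gaussianReal 0 m)
      = (gaussianPDFReal 0 m u * (m / u) : ℝ) *
        ∫ s in Ioi 0, exp (-s - m * s ^ 2 / (2 * u ^ 2)) • g s := by
  have hm' : (0 : ℝ) < m := by exact_mod_cast hm.bot_lt
  set F : ℝ → ℂ := (Ioi u).indicator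
    (fun x => gaussianPDFReal 0 m x • g (u * (x - u) / m)) with hF
  have h1 : ∫ x in Ioi u, g (u * (x - u) / m) ∂(gaussianReal 0 m) = ∫ x, F x := by
    rw [← integral_indicator measurableSet_Ioi, integral_gaussianReal_eq_integral_smul hm]
    congr 1; ext x
    rw [hF]
    by_cases hx : x ∈ Ioi u <;> simp [hx]
  have h2 : ∫ s, F (m / u * s + u) = (u / m : ℝ) * ∫ x, F x := by
    rw [Measure.integral_comp_mul_left (fun y => F (y + u)) (m / u : ℝ),
      integral_add_right_eq_self, inv_div, abs_of_pos (by positivity), Complex.real_smul]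
  have h3 : ∫ s, F (m / u * s + u) = (gaussianPDFReal 0 m u : ℝ) *
      ∫ s in Ioi 0, exp (-s - m * s ^ 2 / (2 * u ^ 2)) • g s := by
    rw [← integral_indicator measurableSet_Ioi, ← integral_const_mul]
    congr 1; ext s
    rw [hF]
    have hmem : (m / u * s + u ∈ Ioi u) ↔ s ∈ Ioi (0 : ℝ) := by
      simp only [mem_Ioi, lt_add_iff_pos_left]
      exact mul_pos_iff_of_pos_left (by positivity)
    by_cases hs : s ∈ Ioi (0 : ℝ)
    · rw [indicator_of_mem (hmem.2 hs), indicator_of_mem hs,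
        gaussianPDFReal_add_div_mul hm hu.ne']
      have : u * (m / u * s + u - u) / m = s := by field_simp; ring
      rw [this]
      simp only [Complex.real_smul]
      push_cast; ring
    · rw [indicator_of_notMem (fun h => hs (hmem.1 h)), indicator_of_notMem hs, mul_zero]
  rw [h1]
  have h4 := h2.symm.trans h3
  have : (∫ x, F x) = (m / u : ℝ) * ((u / m : ℝ) * ∫ x, F x) := by
    rw [← mul_assoc, ← Complex.ofReal_mul]
    rw [show (m / u * (u / m) : ℝ) = 1 by field_simp]; simp
  rw [this, h4]
  push_cast; ring

lemma tendsto_setIntegral_exp_smul {ι : Type*} {l : Filter ι} [l.IsCountablyGenerated]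
    {m : NNReal} {u : ι → ℝ} (hu : Tendsto u l atTop) {g : ι → ℝ → ℂ} {g' : ℝ → ℂ}
    (hgm : ∀ n, Measurable (g n)) (hg1 : ∀ n s, ‖g n s‖ ≤ 1)
    (hg : ∀ s, Tendsto (fun n => g n s) l (nhds (g' s))) :
    Tendsto (fun n => ∫ s in Ioi (0 : ℝ), exp (-s - m * s ^ 2 / (2 * u n ^ 2)) • g n s) l
      (nhds (∫ s in Ioi (0 : ℝ), exp (-s) • g' s)) := by
  refine tendsto_integral_filter_of_dominated_convergence (fun s => exp (-s))
    (Eventually.of_forall fun n => ?_) (Eventually.of_forall fun n => ae_of_all _ fun s => ?_)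
    (integrableOn_exp_neg_Ioi 0) (ae_of_all _ fun s => ?_)
  · exact ((by fun_prop : Measurable fun s : ℝ => exp (-s - m * s ^ 2 / (2 * u n ^ 2))).smul
      (hgm n)).aestronglyMeasurable
  · rw [norm_smul, norm_of_nonneg (exp_pos _).le]
    calc exp (-s - m * s ^ 2 / (2 * u n ^ 2)) * ‖g n s‖ ≤ exp (-s) * 1 := by
          gcongr
          · have : 0 ≤ m * s ^ 2 / (2 * u n ^ 2) := by positivity
            linarith
          · exact hg1 n s
      _ = _ := mul_one _
  · refine Tendsto.smul ?_ (hg s)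
    have h1 : Tendsto (fun n => m * s ^ 2 / (2 * u n ^ 2)) l (nhds 0) :=
      tendsto_const_nhds.div_atTop
        (((tendsto_pow_atTop two_ne_zero).comp hu).const_mul_atTop two_pos)
    have h2 := (tendsto_const_nhds (x := -s)).sub h1
    rw [sub_zero] at h2
    exact (continuous_exp.tendsto _).comp h2

variable {Ω : Type*} [MeasurableSpace Ω] {P : Measure Ω}

lemma integral_cond_eq (A : Set Ω) (f : Ω → ℂ) :
    ∫ ω, f ω ∂(P[|A]) = ((P.real A)⁻¹ : ℝ) * ∫ ω in A, f ω ∂P := by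
  rw [ProbabilityTheory.cond, integral_smul_measure, ENNReal.toReal_inv]
  rfl

/-- Under the conditional law given an exceedance of a high level `u`, the normalised overshoot
of a centered Gaussian variable is asymptotically standard exponential. -/
lemma tendsto_integral_cond_overshoot {ι : Type*} {l : Filter ι} [l.IsCountablyGenerated]
    {m : NNReal} (hm : m ≠ 0) {W : Ω → ℝ} (hWm : Measurable W) (hW : P.map W = gaussianReal 0 m)
    {u : ι → ℝ} (hu : Tendsto u l atTop) {g : ι → ℝ → ℂ} {g' : ℝ → ℂ}
    (hgm : ∀ n, Measurable (g n)) (hg1 : ∀ n s, ‖g n s‖ ≤ 1)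
    (hg : ∀ s, Tendsto (fun n => g n s) l (nhds (g' s))) :
    Tendsto (fun n => ∫ ω, g n (u n * (W ω - u n) / m) ∂(P[|{ω | u n < W ω}])) l
      (nhds (∫ s in Ioi (0 : ℝ), exp (-s) • g' s)) := by
  have hm' : (0 : ℝ) < m := by exact_mod_cast hm.bot_lt
  have hset : ∀ (f : ℝ → ℂ) (_ : Measurable f) (n : ι),
      ∫ ω in {ω | u n < W ω}, f (u n * (W ω - u n) / m) ∂P
        = ∫ x in Ioi (u n), f (u n * (x - u n) / m) ∂(gaussianReal 0 m) := by
    intro f hf n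
    have hf' : Measurable fun x => f (u n * (x - u n) / m) := hf.comp (by fun_prop)
    rw [← hW, setIntegral_map measurableSet_Ioi hf'.aestronglyMeasurable hWm.aemeasurable]
    rfl
  have h1 := tendsto_setIntegral_exp_smul (m := m) hu hgm hg1 hg
  have h2 := tendsto_setIntegral_exp_smul (m := m) hu (g := fun _ _ => 1) (g' := fun _ => 1)
    (fun _ => measurable_const) (fun _ _ => by simp) (fun _ => tendsto_const_nhds)
  have h3 : (∫ s in Ioi (0 : ℝ), exp (-s) • (1 : ℂ)) = 1 := by
    rw [integral_smul_const, integral_exp_neg_Ioi_zero]; simp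
  rw [h3] at h2
  have h4 := h1.div h2 one_ne_zero
  rw [div_one] at h4
  refine h4.congr' ?_
  filter_upwards [hu.eventually_gt_atTop 0] with n hn
  have hK : ((gaussianPDFReal 0 m (u n) * (m / u n) : ℝ) : ℂ) ≠ 0 := by
    rw [Complex.ofReal_ne_zero]
    have := gaussianPDFReal_pos 0 m (u n) hm
    positivity
  have hA : ((P.real {ω | u n < W ω} : ℝ) : ℂ)
      = ∫ ω in {ω | u n < W ω}, (1 : ℂ) ∂P := by
    simp
  rw [integral_cond_eq, hset _ (hgm n), Complex.ofReal_inv, hA, hset (fun _ => 1) measurable_const,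
    setIntegral_Ioi_gaussianReal hm hn, setIntegral_Ioi_gaussianReal hm hn (fun _ => 1),
    Pi.div_apply, mul_comm _⁻¹, ← div_eq_mul_inv, mul_div_mul_left _ _ hK]

lemma tendsto_measureReal_cond_overshoot {ι : Type*} {l : Filter ι} [l.IsCountablyGenerated]
    {m : NNReal} (hm : m ≠ 0) {W : Ω → ℝ} (hWm : Measurable W) (hW : P.map W = gaussianReal 0 m)
    {u : ι → ℝ} (hu : Tendsto u l atTop) {L : ℝ} (hL : 0 ≤ L) :
    Tendsto (fun n => (P[|{ω | u n < W ω}]).real {ω | L < u n * (W ω - u n) / m}) l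
      (nhds (exp (-L))) := by
  have h := tendsto_integral_cond_overshoot hm hWm hW hu
    (g := fun _ => (Ioi L).indicator fun _ => 1) (g' := (Ioi L).indicator fun _ => 1)
    (fun _ => measurable_const.indicator measurableSet_Ioi)
    (fun _ s => (norm_indicator_le_norm_self _ _).trans (by simp)) (fun _ => tendsto_const_nhds)
  have h1 : (∫ s in Ioi (0 : ℝ), exp (-s) • (Ioi L).indicator (fun _ => (1 : ℂ)) s)
      = (exp (-L) : ℝ) := by
    have : (fun s => exp (-s) • (Ioi L).indicator (fun _ => (1 : ℂ)) s)
        = (Ioi L).indicator fun s => ((exp (-s) : ℝ) : ℂ) := by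
      ext s; by_cases hs : s ∈ Ioi L <;> simp [hs]
    rw [this, setIntegral_indicator measurableSet_Ioi,
      inter_eq_self_of_subset_right (Ioi_subset_Ioi hL), integral_complex_ofReal,
      integral_exp_neg_Ioi]
  rw [h1] at h
  have h2 := (Complex.continuous_re.tendsto _).comp h
  rw [Complex.ofReal_re] at h2
  refine h2.congr fun n => ?_
  have : (fun ω => (Ioi L).indicator (fun _ => (1 : ℂ)) (u n * (W ω - u n) / m))
      = {ω | L < u n * (W ω - u n) / m}.indicator fun _ => (1 : ℂ) := by
    ext ω; simp only [indicator, mem_Ioi, mem_ofPred_eq]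
  rw [Function.comp, this, integral_indicator
    (measurableSet_lt measurable_const (by fun_prop))]
  simp

lemma integral_cond_mul_of_indepFun {Z W : Ω → ℝ} (h : IndepFun Z W P) (hZ : Measurable Z)
    (hW : Measurable W) {φ ψ : ℝ → ℂ} (hφ : Measurable φ) (hψ : Measurable ψ) {A : Set ℝ}
    (hA : MeasurableSet A) :
    ∫ ω, φ (Z ω) * ψ (W ω) ∂(P[|W ⁻¹' A])
      = (∫ ω, φ (Z ω) ∂P) * ∫ ω, ψ (W ω) ∂(P[|W ⁻¹' A]) := by
  have h1 : ∀ f : Ω → ℂ, ∫ ω in W ⁻¹' A, f ω ∂P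
      = ∫ ω, f ω * A.indicator (fun _ => 1) (W ω) ∂P := by
    intro f
    rw [← integral_indicator (hW hA)]
    congr 1; ext ω
    by_cases hω : W ω ∈ A
    · rw [indicator_of_mem (show ω ∈ W ⁻¹' A from hω), indicator_of_mem hω, mul_one]
    · rw [indicator_of_notMem (show ω ∉ W ⁻¹' A from hω), indicator_of_notMem hω, mul_zero]
  rw [integral_cond_eq, integral_cond_eq, h1, h1]
  have h2 := (h.comp hφ (hψ.mul (measurable_const.indicator hA : Measurable
    (A.indicator fun _ => (1 : ℂ))))).integral_fun_mul_eq_mul_integral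
    (hφ.comp hZ).aestronglyMeasurable
    ((hψ.mul (measurable_const.indicator hA)).comp hW).aestronglyMeasurable
  simp only [Function.comp, Pi.mul_apply] at h2
  simp only [mul_assoc]
  rw [h2]; ring

lemma cond_preimage_of_indepFun [IsFiniteMeasure P] {Z W : Ω → ℝ} (h : IndepFun Z W P) (hW : Measurable W)
    {A B : Set ℝ} (hA : MeasurableSet A) (hB : MeasurableSet B) (h0 : P (W ⁻¹' A) ≠ 0) :
    (P[|W ⁻¹' A]) (Z ⁻¹' B) = P (Z ⁻¹' B) := by
  rw [cond_apply (hW hA), inter_comm, h.measure_inter_preimage_eq_mul _ _ hB hA, mul_comm, mul_assoc,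
    ENNReal.mul_inv_cancel h0 (measure_ne_top _ _), mul_one]

end ConditionalExceedance

section StandardExponential

open Real Set

variable {Ω : Type*} [MeasurableSpace Ω] {Q : Measure Ω} [IsProbabilityMeasure Q] {T : Ω → ℝ}

lemma map_eq_expMeasure (hT : Measurable T)
    (hexp : ∀ x : ℝ, 0 ≤ x → Q {ω | x < T ω} = ENNReal.ofReal (exp (-x))) :
    Q.map T = expMeasure 1 := by
  have := Measure.isProbabilityMeasure_map (μ := Q) hT.aemeasurable
  have := isProbabilityMeasure_expMeasure (r := 1) one_pos
  have key : ∀ x, 0 ≤ x → Q.real {ω | T ω ≤ x} = 1 - exp (-x) := by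
    intro x hx
    have h1 := probReal_compl_eq_one_sub (μ := Q) (measurableSet_lt measurable_const hT)
      (s := {ω | x < T ω})
    rw [measureReal_def Q {ω | x < T ω}, hexp x hx, ENNReal.toReal_ofReal (exp_pos _).le] at h1
    rw [← h1]
    congr 1
    ext ω
    simp
  refine Measure.eq_of_cdf _ _ (StieltjesFunction.ext fun x => ?_)
  rw [cdf_expMeasure_eq one_pos, cdf_eq_real, map_measureReal_apply hT measurableSet_Iic]
  split_ifs with hx
  · rw [one_mul]
    exact key x hx
  · have h0 := key 0 le_rfl
    rw [neg_zero, exp_zero, sub_self] at h0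
    refine le_antisymm (h0 ▸ measureReal_mono fun ω hω => ?_) measureReal_nonneg
    exact le_trans (mem_Iic.1 hω) (not_le.1 hx).le

lemma expMeasure_one_eq :
    expMeasure 1 = (volume.restrict (Ici 0)).withDensity
      (fun x => ENNReal.ofReal (exp (-x))) := by
  rw [expMeasure, gammaMeasure, ← withDensity_indicator measurableSet_Ici]
  congr 1
  ext x
  have := exponentialPDF_eq 1 x
  rw [exponentialPDF, exponentialPDFReal] at this
  rw [gammaPDF, this, indicator_apply]
  by_cases hx : 0 ≤ x <;> simp [hx]

lemma integral_comp_standardExponential (hT : Measurable T)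
    (hexp : ∀ x : ℝ, 0 ≤ x → Q {ω | x < T ω} = ENNReal.ofReal (exp (-x)))
    {g : ℝ → ℂ} (hg : Measurable g) :
    ∫ ω, g (T ω) ∂Q = ∫ s in Ioi 0, exp (-s) • g s := by
  rw [← integral_map hT.aemeasurable (by fun_prop), map_eq_expMeasure hT hexp, expMeasure_one_eq,
    integral_withDensity_eq_integral_toReal_smul (by fun_prop) (by simp),
    integral_Ici_eq_integral_Ioi]
  simp only [ENNReal.toReal_ofReal (exp_pos _).le]

lemma map_standardExponential_le_volume (hT : Measurable T)
    (hexp : ∀ x : ℝ, 0 ≤ x → Q {ω | x < T ω} = ENNReal.ofReal (exp (-x))) (A : Set ℝ) :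
    Q.map T A ≤ volume A := by
  rw [map_eq_expMeasure hT hexp, expMeasure_one_eq]
  have h1 : (volume.restrict (Ici (0 : ℝ))).withDensity (fun x => ENNReal.ofReal (exp (-x)))
      ≤ (volume.restrict (Ici (0 : ℝ))).withDensity 1 := by
    refine withDensity_mono ?_
    filter_upwards [ae_restrict_mem measurableSet_Ici] with x hx
    simpa using hx
  rw [withDensity_one] at h1
  exact (h1 A).trans (Measure.restrict_apply_le _ _)

end StandardExponential

section Residual

open Real Set

/-- The part of `X t` uncorrelated with `X 0`, when `X` is stationary with variance `m` and
covariance `m - V`. -/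
noncomputable def originResidual {Ω : Type*} (m : ℝ) (V : ℝ → ℝ) (X : ℝ → Ω → ℝ) (t : ℝ) : Ω → ℝ :=
  X t - ((m - V t) / m) • X 0

variable {Ω : Type*} [MeasurableSpace Ω] {P : Measure Ω} {X : ℝ → Ω → ℝ} {m : ℝ} {V : ℝ → ℝ}

omit [MeasurableSpace Ω] in
lemma originResidual_mem_span (m : ℝ) (V : ℝ → ℝ) (t : ℝ) :
    originResidual m V X t ∈ Submodule.span ℝ (range X) :=
  sub_mem (Submodule.subset_span (mem_range_self _))
    (Submodule.smul_mem _ _ (Submodule.subset_span (mem_range_self _)))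

variable (hX : IsZeroMeanGaussianProcess P X) (hm : m ≠ 0) (hV0 : V 0 = 0)
  (hV : ∀ t, V (-t) = V t) (hcov : ∀ s t, ∫ ω, X s ω * X t ω ∂P = m - V (s - t))

include hX hm hV0 hcov

lemma integral_originResidual_mul_zero (t : ℝ) : ∫ ω, originResidual m V X t ω * X 0 ω ∂P = 0 := by
  have hi : ∀ s t, Integrable (fun ω => X s ω * X t ω) P := fun s t =>
    hX.integrable_mul (Submodule.subset_span (mem_range_self _))
      (Submodule.subset_span (mem_range_self _))
  have h1 : ∀ ω, originResidual m V X t ω * X 0 ω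
      = X t ω * X 0 ω - (m - V t) / m * (X 0 ω * X 0 ω) := by
    intro ω
    simp only [originResidual, Pi.sub_apply, Pi.smul_apply, smul_eq_mul]
    ring
  simp_rw [h1]
  rw [integral_sub (hi _ _) ((hi _ _).const_mul _), integral_const_mul, hcov, hcov]
  simp only [sub_zero, hV0]
  field_simp
  ring

include hV

lemma integral_originResidual_mul_originResidual (s t : ℝ) :
    ∫ ω, originResidual m V X s ω * originResidual m V X t ω ∂P = V s + V t - V (s - t) - V s * V t / m := by
  have hi : ∀ s t, Integrable (fun ω => X s ω * X t ω) P := fun s t =>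
    hX.integrable_mul (Submodule.subset_span (mem_range_self _))
      (Submodule.subset_span (mem_range_self _))
  have h1 : ∀ ω, originResidual m V X s ω * originResidual m V X t ω
      = originResidual m V X s ω * X t ω - (m - V t) / m * (originResidual m V X s ω * X 0 ω) := by
    intro ω
    simp only [originResidual, Pi.sub_apply, Pi.smul_apply, smul_eq_mul]
    ring
  have h2 : ∀ ω, originResidual m V X s ω * X t ω
      = X s ω * X t ω - (m - V s) / m * (X 0 ω * X t ω) := by
    intro ω
    simp only [originResidual, Pi.sub_apply, Pi.smul_apply, smul_eq_mul]
    ring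
  simp_rw [h1]
  have hj : ∀ s t, Integrable (fun ω => originResidual m V X s ω * X t ω) P := fun s t =>
    hX.integrable_mul (originResidual_mem_span m V s) (Submodule.subset_span (mem_range_self _))
  rw [integral_sub (hj _ _) ((hj _ _).const_mul _), integral_const_mul,
    integral_originResidual_mul_zero hX hm hV0 hcov]
  simp_rw [h2]
  rw [integral_sub (hi _ _) ((hi _ _).const_mul _), integral_const_mul, hcov, hcov, zero_sub, hV]
  field_simp
  ring

lemma integral_originResidual_sub_sq (s t : ℝ) :
    ∫ ω, (originResidual m V X s ω - originResidual m V X t ω) ^ 2 ∂P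
      = 2 * V (s - t) - (V s - V t) ^ 2 / m := by
  have hi : ∀ s t, Integrable (fun ω => originResidual m V X s ω * originResidual m V X t ω) P := fun s t =>
    hX.integrable_mul (originResidual_mem_span m V s) (originResidual_mem_span m V t)
  have h1 : ∀ ω, (originResidual m V X s ω - originResidual m V X t ω) ^ 2
      = originResidual m V X s ω * originResidual m V X s ω + originResidual m V X t ω * originResidual m V X t ω
        - 2 * (originResidual m V X s ω * originResidual m V X t ω) := by
    intro ω; ring
  simp_rw [h1]
  have := integral_originResidual_mul_originResidual hX hm hV0 hV hcov
  have ha : Integrable (fun ω => originResidual m V X s ω * originResidual m V X s ω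
      + originResidual m V X t ω * originResidual m V X t ω) P := (hi _ _).add (hi _ _)
  rw [integral_sub ha ((hi _ _).const_mul _), integral_const_mul,
    integral_add (hi _ _) (hi _ _), this, this, this, sub_self, sub_self, hV0]
  ring

lemma integral_sum_originResidual_sq {k : ℕ} (θ t : Fin k → ℝ) :
    ∫ ω, (∑ i, θ i • originResidual m V X (t i)) ω ^ 2 ∂P
      = ∑ i, ∑ j, θ i * θ j * (V (t i) + V (t j) - V (t i - t j) - V (t i) * V (t j) / m) := by
  have hi : ∀ s t, Integrable (fun ω => originResidual m V X s ω * originResidual m V X t ω) P := fun s t =>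
    hX.integrable_mul (originResidual_mem_span m V s) (originResidual_mem_span m V t)
  have h1 : ∀ ω, (∑ i, θ i • originResidual m V X (t i)) ω ^ 2
      = ∑ i, ∑ j, θ i * θ j * (originResidual m V X (t i) ω * originResidual m V X (t j) ω) := by
    intro ω
    simp only [Finset.sum_apply, Pi.smul_apply, smul_eq_mul, sq, Finset.sum_mul_sum]
    refine Finset.sum_congr rfl fun i _ => Finset.sum_congr rfl fun j _ => by ring
  simp_rw [h1]
  rw [integral_finsetSum _ fun i _ => integrable_finsetSum _ fun j _ => (hi _ _).const_mul _]
  refine Finset.sum_congr rfl fun i _ => ?_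
  rw [integral_finsetSum _ fun j _ => (hi _ _).const_mul _]
  refine Finset.sum_congr rfl fun j _ => ?_
  rw [integral_const_mul, integral_originResidual_mul_originResidual hX hm hV0 hV hcov]

end Residual

section FiniteDimensional

open Real Set

/-- The excess of `X` over the level `u`, in the space-time scaling `(u, d)`. -/
def scaledExcess {Ω : Type*} (u d : ℝ) (X : ℝ → Ω → ℝ) (t : ℝ) (ω : Ω) : ℝ :=
  u * (X (d * t) ω - u)

lemma scaledExcess_eq {Ω : Type*} {m : ℝ} (hm : m ≠ 0) (V : ℝ → ℝ) (u d : ℝ)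
    (X : ℝ → Ω → ℝ) (t : ℝ) (ω : Ω) :
    scaledExcess u d X t ω = u * originResidual m V X (d * t) ω
      + ((m - V (d * t)) * (u * (X 0 ω - u) / m) - u ^ 2 * V (d * t) / m) := by
  simp only [scaledExcess, originResidual, Pi.sub_apply, Pi.smul_apply, smul_eq_mul]
  field_simp
  ring

lemma sum_mul_scaledExcess {Ω : Type*} {m : ℝ} (hm : m ≠ 0) (V : ℝ → ℝ) (u d : ℝ)
    (X : ℝ → Ω → ℝ) {k : ℕ} (θ t : Fin k → ℝ) (ω : Ω) :
    ∑ j, θ j * scaledExcess u d X (t j) ω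
      = (∑ j, (u * θ j) • originResidual m V X (d * t j)) ω
        + ∑ j, θ j * ((m - V (d * t j)) * (u * (X 0 ω - u) / m) - u ^ 2 * V (d * t j) / m) := by
  rw [Finset.sum_apply, ← Finset.sum_add_distrib]
  refine Finset.sum_congr rfl fun j _ => ?_
  rw [scaledExcess_eq hm V]
  simp only [Pi.smul_apply, smul_eq_mul]
  ring

variable {Ω : Type*} [MeasurableSpace Ω] {P : Measure Ω} [IsProbabilityMeasure P]
  {X : ℝ → Ω → ℝ} {m : NNReal} {V : ℝ → ℝ}

lemma tendsto_integral_exp_scaledExcess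
    (hX : IsZeroMeanGaussianProcess P X) (hm : m ≠ 0) (hV0 : V 0 = 0)
    (hV : ∀ t, V (-t) = V t) (hcov : ∀ s t, ∫ ω, X s ω * X t ω ∂P = m - V (s - t))
    {u d : ℕ → ℝ} (hu : Tendsto u atTop atTop) {G : ℝ → ℝ}
    (hG : ∀ t, Tendsto (fun n => u n ^ 2 * V (d n * t)) atTop (nhds (G t)))
    {k : ℕ} (θ t : Fin k → ℝ) :
    Tendsto (fun n => ∫ ω, Complex.exp (((∑ j, θ j * scaledExcess (u n) (d n) X (t j) ω : ℝ) : ℂ)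
        * Complex.I) ∂(P[|{ω | u n < X 0 ω}])) atTop
      (nhds (Complex.exp (-((∑ i, ∑ j, θ i * θ j * (G (t i) + G (t j) - G (t i - t j)) : ℝ) : ℂ) / 2)
        * ∫ s in Ioi (0 : ℝ), exp (-s) • Complex.exp (((∑ j, θ j * (m * s - G (t j) / m) : ℝ) : ℂ)
          * Complex.I))) := by
  have hm' : (m : ℝ) ≠ 0 := by exact_mod_cast hm
  have hX0 : X 0 ∈ Submodule.span ℝ (range X) := Submodule.subset_span (mem_range_self _)
  have hW : P.map (X 0) = gaussianReal 0 m := by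
    rw [hX.map_eq_gaussianReal hX0]
    simp_rw [sq]
    rw [hcov, sub_self, hV0, sub_zero, Real.toNNReal_coe]
  have hVt : ∀ t, Tendsto (fun n => V (d n * t)) atTop (nhds 0) := by
    intro t
    have h2 : Tendsto (fun n => (u n ^ 2)⁻¹) atTop (nhds 0) :=
      ((tendsto_pow_atTop two_ne_zero).comp hu).inv_tendsto_atTop
    have := h2.mul (hG t)
    rw [zero_mul] at this
    refine this.congr' ?_
    filter_upwards [hu.eventually_gt_atTop 0] with n hn
    field_simp
  set g : ℕ → ℝ → ℂ := fun n s => Complex.exp (((∑ j, θ j * ((m - V (d n * t j)) * s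
    - u n ^ 2 * V (d n * t j) / m) : ℝ) : ℂ) * Complex.I) with hg
  have hgm : ∀ n, Measurable (g n) := fun n => by
    simp only [hg]; fun_prop
  have key : ∀ n, ∫ ω, Complex.exp (((∑ j, θ j * scaledExcess (u n) (d n) X (t j) ω : ℝ) : ℂ)
        * Complex.I) ∂(P[|{ω | u n < X 0 ω}])
      = Complex.exp (-((∑ i, ∑ j, θ i * θ j * (u n ^ 2 * V (d n * t i) + u n ^ 2 * V (d n * t j)
          - u n ^ 2 * V (d n * (t i - t j)) - u n ^ 2 * V (d n * t i) * V (d n * t j) / m)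
          : ℝ) : ℂ) / 2)
        * ∫ ω, g n (u n * (X 0 ω - u n) / m) ∂(P[|{ω | u n < X 0 ω}]) := by
    intro n
    set Z : Ω → ℝ := ∑ j, (u n * θ j) • originResidual (m : ℝ) V X (d n * t j) with hZ
    have hZs : Z ∈ Submodule.span ℝ (range X) :=
      Submodule.sum_mem _ fun j _ => Submodule.smul_mem _ _ (originResidual_mem_span _ _ _)
    have hZX : ∫ ω, Z ω * X 0 ω ∂P = 0 := by
      have : ∀ ω, Z ω * X 0 ω = ∑ j, (u n * θ j)
          * (originResidual (m : ℝ) V X (d n * t j) ω * X 0 ω) := by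
        intro ω
        simp only [hZ, Finset.sum_apply, Pi.smul_apply, smul_eq_mul, Finset.sum_mul]
        exact Finset.sum_congr rfl fun j _ => by ring
      simp_rw [this]
      rw [integral_finsetSum _ fun j _ =>
        (hX.integrable_mul (originResidual_mem_span _ _ _) hX0).const_mul _]
      refine Finset.sum_eq_zero fun j _ => ?_
      rw [integral_const_mul, integral_originResidual_mul_zero hX hm' hV0 hcov, mul_zero]
    have hind := hX.indepFun hZs hX0 hZX
    have h1 := integral_cond_mul_of_indepFun hind (hX.exists_map_eq_gaussianReal hZs).1 (hX.1 0)
      (φ := fun z => Complex.exp (z * Complex.I)) (ψ := fun x => g n (u n * (x - u n) / m))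
      (by fun_prop) ((hgm n).comp (by fun_prop)) (A := Ioi (u n)) measurableSet_Ioi
    have h2 : X 0 ⁻¹' Ioi (u n) = {ω | u n < X 0 ω} := rfl
    rw [h2, hX.integral_exp_mul_I hZs, hZ, integral_sum_originResidual_sq hX hm' hV0 hV hcov] at h1
    convert h1 using 2
    · ext ω
      rw [sum_mul_scaledExcess hm' V, ← Complex.exp_add, ← add_mul, Complex.ofReal_add]
    · congr 4
      refine Finset.sum_congr rfl fun i _ => Finset.sum_congr rfl fun j _ => ?_
      rw [mul_sub (d n)]
      ring
  simp_rw [key]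
  refine Tendsto.mul ?_ ?_
  · refine (Complex.continuous_exp.tendsto _).comp (Tendsto.div_const (Tendsto.neg ?_) _)
    refine (Complex.continuous_ofReal.tendsto _).comp ?_
    refine tendsto_finsetSum _ fun i _ => tendsto_finsetSum _ fun j _ => ?_
    have := (((hG (t i)).add (hG (t j))).sub (hG (t i - t j))).sub
      (((hG (t i)).mul (hVt (t j))).div_const (m : ℝ))
    simp only [mul_zero, zero_div, sub_zero] at this
    exact this.const_mul _
  · refine tendsto_integral_cond_overshoot hm (hX.1 0) hW hu hgm (fun n s => ?_) fun s => ?_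
    · exact (Complex.norm_exp_ofReal_mul_I _).le
    · refine (Complex.continuous_exp.tendsto _).comp (Tendsto.mul_const _ ?_)
      refine (Complex.continuous_ofReal.tendsto _).comp ?_
      refine tendsto_finsetSum _ fun j _ => Tendsto.const_mul _ ?_
      have := (((tendsto_const_nhds (x := (m : ℝ))).sub (hVt (t j))).mul_const s).sub ((hG (t j)).div_const (m : ℝ))
      rwa [sub_zero] at this

end FiniteDimensional

section CharFunConvergence

open Real Set

variable {Ω Ω' : Type*} [MeasurableSpace Ω] [MeasurableSpace Ω'] {Pn : ℕ → Measure Ω}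
  [∀ n, IsProbabilityMeasure (Pn n)] {Q : Measure Ω'} [IsProbabilityMeasure Q]
  {k : ℕ} {ξ : ℕ → Fin k → Ω → ℝ} {ζ : Fin k → Ω' → ℝ}

lemma charFun_map_toLp {Ω : Type*} [MeasurableSpace Ω] {P : Measure Ω} {k : ℕ}
    {ξ : Fin k → Ω → ℝ} (hξ : ∀ j, Measurable (ξ j)) (θ : EuclideanSpace ℝ (Fin k)) :
    charFun (P.map fun ω => WithLp.toLp 2 fun j => ξ j ω) θ
      = ∫ ω, Complex.exp (((∑ j, θ j * ξ j ω : ℝ) : ℂ) * Complex.I) ∂P := by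
  rw [charFun_apply, integral_map (by fun_prop) (by fun_prop)]
  simp [PiLp.inner_apply]

lemma eventually_measureReal_isClosed_le (hξ : ∀ n j, Measurable (ξ n j))
    (hζ : ∀ j, Measurable (ζ j))
    (h : ∀ θ : Fin k → ℝ, Tendsto
      (fun n => ∫ ω, Complex.exp (((∑ j, θ j * ξ n j ω : ℝ) : ℂ) * Complex.I) ∂(Pn n)) atTop
      (nhds (∫ ω, Complex.exp (((∑ j, θ j * ζ j ω : ℝ) : ℂ) * Complex.I) ∂Q)))
    {F : Set (Fin k → ℝ)} (hF : IsClosed F) {ε : ℝ} (hε : 0 < ε) :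
    ∀ᶠ n in atTop, (Pn n).real {ω | (fun j => ξ n j ω) ∈ F}
      ≤ Q.real {ω | (fun j => ζ j ω) ∈ F} + ε := by
  set μn : ℕ → ProbabilityMeasure (EuclideanSpace ℝ (Fin k)) := fun n =>
    ⟨(Pn n).map fun ω => WithLp.toLp 2 fun j => ξ n j ω,
      Measure.isProbabilityMeasure_map (by fun_prop)⟩ with hμn
  set ν : ProbabilityMeasure (EuclideanSpace ℝ (Fin k)) :=
    ⟨Q.map fun ω => WithLp.toLp 2 fun j => ζ j ω,
      Measure.isProbabilityMeasure_map (by fun_prop)⟩ with hν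
  have h1 : Tendsto μn atTop (nhds ν) := by
    refine ProbabilityMeasure.tendsto_of_tendsto_charFun fun θ => ?_
    have h2 := h θ
    rw [← charFun_map_toLp hζ θ] at h2
    simp_rw [← charFun_map_toLp (hξ _) θ] at h2
    exact h2
  have hF' : IsClosed {x : EuclideanSpace ℝ (Fin k) | WithLp.ofLp x ∈ F} :=
    hF.preimage (by fun_prop)
  have h3 := ProbabilityMeasure.limsup_measure_closed_le_of_tendsto h1 hF'
  have e1 : ∀ n, (μn n : Measure (EuclideanSpace ℝ (Fin k))) {x | WithLp.ofLp x ∈ F}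
      = Pn n {ω | (fun j => ξ n j ω) ∈ F} := fun n =>
    Measure.map_apply (by fun_prop) hF'.measurableSet
  have e2 : (ν : Measure (EuclideanSpace ℝ (Fin k))) {x | WithLp.ofLp x ∈ F}
      = Q {ω | (fun j => ζ j ω) ∈ F} := Measure.map_apply (by fun_prop) hF'.measurableSet
  simp_rw [e1] at h3
  rw [e2] at h3
  have h4 : Q {ω | (fun j => ζ j ω) ∈ F} < Q {ω | (fun j => ζ j ω) ∈ F} + ENNReal.ofReal ε :=
    ENNReal.lt_add_right (measure_ne_top _ _) (by simpa using hε)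
  filter_upwards [eventually_lt_of_limsup_lt (h3.trans_lt h4)] with n hn
  have := ENNReal.toReal_mono (by finiteness) hn.le
  rwa [ENNReal.toReal_add (by finiteness) (by finiteness), ENNReal.toReal_ofReal hε.le] at this

lemma eventually_le_measureReal_isOpen (hξ : ∀ n j, Measurable (ξ n j))
    (hζ : ∀ j, Measurable (ζ j))
    (h : ∀ θ : Fin k → ℝ, Tendsto
      (fun n => ∫ ω, Complex.exp (((∑ j, θ j * ξ n j ω : ℝ) : ℂ) * Complex.I) ∂(Pn n)) atTop
      (nhds (∫ ω, Complex.exp (((∑ j, θ j * ζ j ω : ℝ) : ℂ) * Complex.I) ∂Q)))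
    {U : Set (Fin k → ℝ)} (hU : IsOpen U) {ε : ℝ} (hε : 0 < ε) :
    ∀ᶠ n in atTop, Q.real {ω | (fun j => ζ j ω) ∈ U} - ε
      ≤ (Pn n).real {ω | (fun j => ξ n j ω) ∈ U} := by
  filter_upwards [eventually_measureReal_isClosed_le hξ hζ h hU.isClosed_compl hε] with n hn
  have e1 : {ω | (fun j => ξ n j ω) ∈ Uᶜ} = {ω | (fun j => ξ n j ω) ∈ U}ᶜ := rfl
  have e2 : {ω | (fun j => ζ j ω) ∈ Uᶜ} = {ω | (fun j => ζ j ω) ∈ U}ᶜ := rfl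
  have m1 : MeasurableSet {ω | (fun j => ξ n j ω) ∈ U} :=
    (measurable_pi_lambda _ (hξ n)) hU.measurableSet
  have m2 : MeasurableSet {ω | (fun j => ζ j ω) ∈ U} :=
    (measurable_pi_lambda _ hζ) hU.measurableSet
  rw [e1, e2, probReal_compl_eq_one_sub m1, probReal_compl_eq_one_sub m2] at hn
  linarith

end CharFunConvergence

section LimitProcess

open Real Set

variable {Ω' : Type*} [MeasurableSpace Ω'] {Q : Measure Ω'} [IsProbabilityMeasure Q]
  {W : ℝ → Ω' → ℝ} {T : Ω' → ℝ} {m : ℝ} {G : ℝ → ℝ}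

lemma integral_exp_sum_limit (hW : IsZeroMeanGaussianProcess Q W)
    (hcov : ∀ s t, ∫ ω, W s ω * W t ω ∂Q = G s + G t - G (s - t)) (hT : Measurable T)
    (hexp : ∀ x : ℝ, 0 ≤ x → Q {ω | x < T ω} = ENNReal.ofReal (exp (-x)))
    (hind : ∀ (n : ℕ) (t : Fin n → ℝ), IndepFun (fun ω i => W (t i) ω) T Q)
    {k : ℕ} (θ t : Fin k → ℝ) :
    ∫ ω, Complex.exp (((∑ j, θ j * (W (t j) ω + m * T ω - G (t j) / m) : ℝ) : ℂ)
        * Complex.I) ∂Q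
      = Complex.exp (-((∑ i, ∑ j, θ i * θ j * (G (t i) + G (t j) - G (t i - t j)) : ℝ) : ℂ) / 2)
        * ∫ s in Ioi (0 : ℝ), exp (-s) • Complex.exp (((∑ j, θ j * (m * s - G (t j) / m) : ℝ) : ℂ)
          * Complex.I) := by
  set g : ℝ → ℂ := fun s => Complex.exp (((∑ j, θ j * (m * s - G (t j) / m) : ℝ) : ℂ)
    * Complex.I) with hg
  have hgm : Measurable g := by fun_prop
  have hs : ∀ t, W t ∈ Submodule.span ℝ (range W) := fun t =>
    Submodule.subset_span (mem_range_self _)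
  set Z : Ω' → ℝ := ∑ j, θ j • W (t j) with hZ
  have hZs : Z ∈ Submodule.span ℝ (range W) :=
    Submodule.sum_mem _ fun j _ => Submodule.smul_mem _ _ (hs _)
  have hZ2 : ∫ ω, Z ω ^ 2 ∂Q = ∑ i, ∑ j, θ i * θ j * (G (t i) + G (t j) - G (t i - t j)) := by
    have h1 : ∀ ω, Z ω ^ 2 = ∑ i, ∑ j, θ i * θ j * (W (t i) ω * W (t j) ω) := by
      intro ω
      simp only [hZ, Finset.sum_apply, Pi.smul_apply, smul_eq_mul, sq, Finset.sum_mul_sum]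
      refine Finset.sum_congr rfl fun i _ => Finset.sum_congr rfl fun j _ => by ring
    simp_rw [h1]
    rw [integral_finsetSum _ fun i _ => integrable_finsetSum _ fun j _ =>
      (hW.integrable_mul (hs _) (hs _)).const_mul _]
    refine Finset.sum_congr rfl fun i _ => ?_
    rw [integral_finsetSum _ fun j _ => (hW.integrable_mul (hs _) (hs _)).const_mul _]
    refine Finset.sum_congr rfl fun j _ => ?_
    rw [integral_const_mul, hcov]
  have hZm := (hW.exists_map_eq_gaussianReal hZs).1
  have hZT : IndepFun Z T Q := by
    have := (hind k t).comp (φ := fun x : Fin k → ℝ => ∑ j, θ j * x j) (ψ := id)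
      (by fun_prop) measurable_id
    have e : Z = (fun x : Fin k → ℝ => ∑ j, θ j * x j) ∘ fun ω i => W (t i) ω := by
      ext ω
      simp [hZ]
    rw [e]
    exact this
  have h1 : ∀ ω, Complex.exp (((∑ j, θ j * (W (t j) ω + m * T ω - G (t j) / m) : ℝ) : ℂ)
        * Complex.I) = Complex.exp (Z ω * Complex.I) * g (T ω) := by
    intro ω
    simp only [hg]
    rw [← Complex.exp_add, ← add_mul, ← Complex.ofReal_add]
    congr 3
    simp only [hZ, Finset.sum_apply, Pi.smul_apply, smul_eq_mul, ← Finset.sum_add_distrib]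
    exact Finset.sum_congr rfl fun j _ => by ring
  simp_rw [h1]
  have h2 := (hZT.comp (φ := fun z : ℝ => Complex.exp (z * Complex.I)) (ψ := g) (by fun_prop)
    hgm).integral_fun_mul_eq_mul_integral (by fun_prop) (hgm.comp hT).aestronglyMeasurable
  simp only [Function.comp] at h2
  rw [h2, hW.integral_exp_mul_I hZs, hZ2, integral_comp_standardExponential hT hexp hgm]

end LimitProcess

section Chaining

open Real Set

lemma abs_sub_dyadic_floor_le {f : ℝ → ℝ} (hf : Continuous f) {x : ℕ → ℝ} (hx0 : ∀ k, 0 ≤ x k)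
    (hx : Summable x) {N : ℕ}
    (h : ∀ k, N < k → ∀ i : ℕ, i < 2 ^ k → |f ((i + 1 : ℕ) / 2 ^ k) - f (i / 2 ^ k)| ≤ x k)
    {s : ℝ} (hs : s ∈ Icc (0 : ℝ) 1) :
    |f s - f (⌊s * 2 ^ N⌋₊ / 2 ^ N)| ≤ ∑' k, x (k + (N + 1)) := by
  have hstep : ∀ k, N ≤ k → |f (⌊s * 2 ^ (k + 1)⌋₊ / 2 ^ (k + 1)) - f (⌊s * 2 ^ k⌋₊ / 2 ^ k)|
      ≤ x (k + 1) := by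
    intro k hk
    have hj : ⌊s * 2 ^ k⌋₊ = ⌊s * 2 ^ (k + 1)⌋₊ / 2 := by
      rw [← Nat.floor_div_ofNat]
      congr 1
      simp only [OfNat.ofNat]
      rw [pow_succ, ← mul_assoc]
      exact (mul_div_cancel_right₀ _ two_ne_zero).symm
    have hle : ⌊s * 2 ^ (k + 1)⌋₊ ≤ 2 ^ (k + 1) := by
      refine Nat.floor_le_of_le ?_
      push_cast
      exact mul_le_of_le_one_left (by positivity) hs.2
    generalize ⌊s * 2 ^ (k + 1)⌋₊ = i at *
    rw [hj]
    have hpow : (2 : ℝ) ^ (k + 1) = 2 * 2 ^ k := by ring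
    rcases Nat.even_or_odd' i with ⟨j, rfl | rfl⟩
    · rw [Nat.mul_div_cancel_left _ two_pos, hpow]
      push_cast
      rw [mul_div_mul_left _ _ two_ne_zero, sub_self, abs_zero]
      exact hx0 _
    · rw [show (2 * j + 1) / 2 = j by omega]
      have := h (k + 1) (by omega) (2 * j) (by omega)
      convert this using 4
      rw [hpow]
      push_cast
      rw [mul_div_mul_left _ _ two_ne_zero]
  have hsum : ∀ n, |f (⌊s * 2 ^ (N + n)⌋₊ / 2 ^ (N + n)) - f (⌊s * 2 ^ N⌋₊ / 2 ^ N)|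
      ≤ ∑ j ∈ Finset.range n, x (j + (N + 1)) := by
    intro n
    induction n with
    | zero => simp
    | succ n ih =>
      rw [Finset.sum_range_succ]
      have := hstep (N + n) (by omega)
      rw [show N + n + 1 = n + (N + 1) by ring] at this
      rw [show N + (n + 1) = n + (N + 1) by ring]
      exact (abs_sub_le _ _ _).trans ((add_le_add this ih).trans_eq (add_comm _ _))
  have hlim : Tendsto (fun n => f (⌊s * 2 ^ (N + n)⌋₊ / 2 ^ (N + n))) atTop (nhds (f s)) := by
    refine (hf.tendsto s).comp ?_
    have h1 := (tendsto_nat_floor_mul_div_atTop (R := ℝ) hs.1).comp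
      (tendsto_pow_atTop_atTop_of_one_lt (r := (2 : ℝ)) one_lt_two)
    exact h1.comp (tendsto_add_atTop_nat N) |>.congr fun n => by simp [add_comm]
  refine le_of_tendsto ((hlim.sub_const _).abs) (Eventually.of_forall fun n => (hsum n).trans ?_)
  exact ((summable_nat_add_iff (N + 1)).2 hx).sum_le_tsum _ fun _ _ => hx0 _

lemma abs_cos_sub_cos_le (a b : ℝ) {l : ℝ} (hl : 0 < l) :
    |cos a - cos b| ≤ l * (1 - cos (a - b)) + ((1 - cos a) + (1 - cos b)) / (2 * l) := by
  have h1 : (cos a - cos b) ^ 2 ≤ 2 * (1 - cos (a - b)) * ((1 - cos a) + (1 - cos b)) := by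
    rw [cos_sub]
    have ha := sin_sq_add_cos_sq a
    have hb := sin_sq_add_cos_sq b
    have h2 : (1 - (cos a * cos b + sin a * sin b)) * 2
        = (cos a - cos b) ^ 2 + (sin a - sin b) ^ 2 := by linarith
    have h3 := cos_le_one a
    have h4 := cos_le_one b
    have h5 : (1 - cos a) * 2 = (1 - cos a) ^ 2 + sin a ^ 2 := by linarith
    have h6 : (1 - cos b) * 2 = (1 - cos b) ^ 2 + sin b ^ 2 := by linarith
    -- `sin² ((a + b) / 2) ≤ (1 - cos a) + (1 - cos b)` with `2 sin² ((a + b) / 2) = 1 - cos (a + b)`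
    have h7 : 1 - (cos a * cos b - sin a * sin b) ≤ 2 * ((1 - cos a) + (1 - cos b)) := by
      nlinarith [sq_nonneg (sin a - sin b), sq_nonneg (2 - cos a - cos b)]
    have h8 : (cos a - cos b) ^ 2
        = (1 - (cos a * cos b + sin a * sin b)) * (1 - (cos a * cos b - sin a * sin b)) := by
      nlinarith
    rw [h8]
    have h9 : 0 ≤ 1 - (cos a * cos b + sin a * sin b) := by nlinarith
    nlinarith
  have hA : 0 ≤ 1 - cos (a - b) := by linarith [cos_le_one (a - b)]
  have hB : 0 ≤ (1 - cos a) + (1 - cos b) := by linarith [cos_le_one a, cos_le_one b]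
  generalize 1 - cos (a - b) = A at *
  generalize (1 - cos a) + (1 - cos b) = B at *
  refine abs_le_of_sq_le_sq (h1.trans ?_) (by positivity)
  have h2 : (l * A + B / (2 * l)) ^ 2 = 2 * A * B + (l * A - B / (2 * l)) ^ 2 := by
    field_simp
    ring
  rw [h2]
  nlinarith [sq_nonneg (l * A - B / (2 * l))]

lemma abs_variogram_sub_le (μ : Measure ℝ) [IsFiniteMeasure μ] (s t : ℝ) {l : ℝ} (hl : 0 < l) :
    |variogram μ s - variogram μ t|
      ≤ l * variogram μ (s - t) + (variogram μ s + variogram μ t) / (2 * l) := by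
  have hi : ∀ t, Integrable (fun z => 1 - cos (t * z)) μ := fun t => by
    refine Integrable.of_bound (by fun_prop) 2 (Eventually.of_forall fun z => ?_)
    rw [norm_eq_abs, abs_le]
    constructor <;> linarith [cos_le_one (t * z), neg_one_le_cos (t * z)]
  simp only [variogram]
  have hj : Integrable (fun z => (1 - cos (s * z)) + (1 - cos (t * z))) μ := (hi s).add (hi t)
  rw [← integral_sub (hi s) (hi t), ← integral_const_mul, ← integral_add (hi s) (hi t),
    ← integral_div, ← integral_add ((hi _).const_mul _) (hj.div_const _)]
  refine (abs_integral_le_integral_abs).trans (integral_mono ((hi s).sub (hi t)).abs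
    (((hi _).const_mul _).add (hj.div_const _)) fun z => ?_)
  have := abs_cos_sub_cos_le (s * z) (t * z) hl
  rw [← sub_mul] at this
  rw [sub_sub_sub_cancel_left, abs_sub_comm]
  exact this

end Chaining

section Oscillation

open Real Set

variable {Ω : Type*} [MeasurableSpace Ω] {P : Measure Ω}

lemma measure_lt_ne_zero_of_map_eq_gaussianReal {m : NNReal} (hm : m ≠ 0) {W : Ω → ℝ}
    (hWm : Measurable W) (hW : P.map W = gaussianReal 0 m) (u : ℝ) : P {ω | u < W ω} ≠ 0 := by
  intro h
  have h1 : gaussianReal 0 m (Ioi u) = 0 := by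
    rw [← hW, Measure.map_apply hWm measurableSet_Ioi]
    exact h
  have h2 := gaussianReal_absolutelyContinuous' 0 hm h1
  rw [Real.volume_Ioi] at h2
  exact ENNReal.top_ne_zero h2

variable [IsProbabilityMeasure P] {X : ℝ → Ω → ℝ} {m : NNReal} {V : ℝ → ℝ}

omit [IsProbabilityMeasure P] in
lemma IsZeroMeanGaussianProcess.map_zero_eq (hX : IsZeroMeanGaussianProcess P X) (hV0 : V 0 = 0)
    (hcov : ∀ s t, ∫ ω, X s ω * X t ω ∂P = m - V (s - t)) : P.map (X 0) = gaussianReal 0 m := by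
  rw [hX.map_eq_gaussianReal (Submodule.subset_span (mem_range_self _))]
  simp_rw [sq]
  rw [hcov, sub_self, hV0, sub_zero, Real.toNNReal_coe]

lemma cond_measureReal_residual_increment_le (hX : IsZeroMeanGaussianProcess P X) (hm : m ≠ 0)
    (hV0 : V 0 = 0) (hV : ∀ t, V (-t) = V t)
    (hcov : ∀ s t, ∫ ω, X s ω * X t ω ∂P = m - V (s - t)) (u a s t : ℝ) (p : ℕ) {x y : ℝ}
    (hx : 0 < x) (hy : a ^ 2 * V (s - t) ≤ y) :
    (P[|{ω | u < X 0 ω}]).real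
        {ω | x < |a * (originResidual m V X s ω - originResidual m V X t ω)|}
      ≤ (∫ z, z ^ (2 * p) ∂(gaussianReal 0 1)) * (2 * y) ^ p / x ^ (2 * p) := by
  have hm' : (m : ℝ) ≠ 0 := by exact_mod_cast hm
  have hX0 : X 0 ∈ Submodule.span ℝ (range X) := Submodule.subset_span (mem_range_self _)
  set Z : Ω → ℝ := a • (originResidual (m : ℝ) V X s - originResidual (m : ℝ) V X t) with hZ
  have hZs : Z ∈ Submodule.span ℝ (range X) := Submodule.smul_mem _ _
    (sub_mem (originResidual_mem_span _ _ _) (originResidual_mem_span _ _ _))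
  have hZX : ∫ ω, Z ω * X 0 ω ∂P = 0 := by
    have : ∀ ω, Z ω * X 0 ω = a * (originResidual (m : ℝ) V X s ω * X 0 ω)
        - a * (originResidual (m : ℝ) V X t ω * X 0 ω) := by
      intro ω
      simp only [hZ, Pi.smul_apply, Pi.sub_apply, smul_eq_mul]
      ring
    have hi : ∀ t, Integrable (fun ω => a * (originResidual (m : ℝ) V X t ω * X 0 ω)) P := fun t =>
      (hX.integrable_mul (originResidual_mem_span _ _ _) hX0).const_mul _
    simp_rw [this]
    rw [integral_sub (hi _) (hi _)]
    simp_rw [integral_const_mul, integral_originResidual_mul_zero hX hm' hV0 hcov]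
    simp
  have hZ2 : ∫ ω, Z ω ^ 2 ∂P ≤ 2 * y := by
    have : ∀ ω, Z ω ^ 2
        = a ^ 2 * (originResidual (m : ℝ) V X s ω - originResidual (m : ℝ) V X t ω) ^ 2 := by
      intro ω
      simp only [hZ, Pi.smul_apply, Pi.sub_apply, smul_eq_mul]
      ring
    simp_rw [this]
    rw [integral_const_mul, integral_originResidual_sub_sq hX hm' hV0 hV hcov]
    have : 0 ≤ a ^ 2 * ((V s - V t) ^ 2 / m) := by positivity
    nlinarith
  have hmeas : MeasurableSet {z : ℝ | x < |z|} :=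
    measurableSet_lt measurable_const measurable_id.abs
  have h1 := cond_preimage_of_indepFun (hX.indepFun hZs hX0 hZX) (hX.1 0) (A := Ioi u)
    measurableSet_Ioi hmeas (measure_lt_ne_zero_of_map_eq_gaussianReal hm (hX.1 0)
      (hX.map_zero_eq hV0 hcov) u)
  have h2 : (P[|{ω | u < X 0 ω}]).real {ω | x < |Z ω|} = P.real {ω | x < |Z ω|} :=
    congrArg ENNReal.toReal h1
  refine h2.trans_le ((hX.measureReal_lt_abs_le hZs p hx).trans ?_)
  have h3 : 0 ≤ ∫ ω, Z ω ^ 2 ∂P := integral_nonneg fun _ => sq_nonneg _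
  have h4 : 0 ≤ ∫ z : ℝ, z ^ (2 * p) ∂(gaussianReal 0 1) :=
    integral_nonneg fun z => by rw [pow_mul]; positivity
  gcongr

omit [MeasurableSpace Ω] in
lemma abs_drift_sub_le {m L c c' b u d σ s t : ℝ} {V : ℝ → ℝ} (hm : 0 < m)
    (hlip : ∀ s t l, 0 < l → |V s - V t| ≤ l * V (s - t) + (V s + V t) / (2 * l))
    (hu : 1 ≤ u) (hσ0 : 0 ≤ σ) (hσ : σ ≤ L) (hc : 0 ≤ c) (hc' : 0 ≤ c')
    (hb0 : 0 < b) (hb1 : b < 1) (k : ℕ) (hst : u ^ 2 * V (d * s - d * t) ≤ c * (b ^ 4) ^ k)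
    (hs : u ^ 2 * V (d * s) ≤ c') (ht : u ^ 2 * V (d * t) ≤ c') :
    |((m - V (d * s)) * σ - u ^ 2 * V (d * s) / m) - ((m - V (d * t)) * σ - u ^ 2 * V (d * t) / m)|
      ≤ (L + 1 / m) * (c + c') * b ^ k := by
  have h1 : ((m - V (d * s)) * σ - u ^ 2 * V (d * s) / m)
      - ((m - V (d * t)) * σ - u ^ 2 * V (d * t) / m)
      = -((V (d * s) - V (d * t)) * (σ + u ^ 2 / m)) := by ring
  have hu2 : 1 ≤ u ^ 2 := one_le_pow₀ hu
  have h2 : σ + u ^ 2 / m ≤ u ^ 2 * (L + 1 / m) := by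
    have : L ≤ u ^ 2 * L := le_mul_of_one_le_left (hσ0.trans hσ) hu2
    have e : u ^ 2 * (L + 1 / m) = u ^ 2 * L + u ^ 2 / m := by ring
    linarith
  set B := b ^ k with hB
  have hBpos : 0 < B := by positivity
  have hB1 : B ≤ 1 := pow_le_one₀ hb0.le hb1.le
  have h3 := hlip (d * s) (d * t) (B ^ 2)⁻¹ (by positivity)
  have h4 : u ^ 2 * |V (d * s) - V (d * t)| ≤ (c + c') * B := by
    have e1 : (b ^ 4) ^ k = B ^ 4 := by rw [hB, ← pow_mul, ← pow_mul, mul_comm]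
    rw [e1] at hst
    calc u ^ 2 * |V (d * s) - V (d * t)|
        ≤ u ^ 2 * ((B ^ 2)⁻¹ * V (d * s - d * t)
          + (V (d * s) + V (d * t)) / (2 * (B ^ 2)⁻¹)) := by gcongr
      _ = (B ^ 2)⁻¹ * (u ^ 2 * V (d * s - d * t))
          + (u ^ 2 * V (d * s) + u ^ 2 * V (d * t)) * B ^ 2 / 2 := by
          field_simp
      _ ≤ (B ^ 2)⁻¹ * (c * B ^ 4) + (c' + c') * B ^ 2 / 2 := by gcongr
      _ = (c + c') * B * B := by field_simp; ring
      _ ≤ (c + c') * B := mul_le_of_le_one_right (by positivity) hB1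
  rw [h1, abs_neg, abs_mul, abs_of_nonneg (by positivity : 0 ≤ σ + u ^ 2 / m)]
  calc |V (d * s) - V (d * t)| * (σ + u ^ 2 / m)
      ≤ |V (d * s) - V (d * t)| * (u ^ 2 * (L + 1 / m)) := by gcongr
    _ = (L + 1 / m) * (u ^ 2 * |V (d * s) - V (d * t)|) := by ring
    _ ≤ (L + 1 / m) * ((c + c') * B) := by
      have : 0 ≤ L := hσ0.trans hσ
      gcongr
    _ = _ := by ring

end Oscillation

section OscillationBound

open Real Set

lemma measureReal_iUnion_le_tsum {Ω : Type*} [MeasurableSpace Ω] {μ : Measure Ω}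
    [IsFiniteMeasure μ] {A : ℕ → Set Ω} {x : ℕ → ℝ} (hx : Summable x)
    (h : ∀ k, μ.real (A k) ≤ x k) : μ.real (⋃ k, A k) ≤ ∑' k, x k := by
  have hx0 : ∀ k, 0 ≤ x k := fun k => measureReal_nonneg.trans (h k)
  refine ENNReal.toReal_le_of_le_ofReal (tsum_nonneg hx0) ((measure_iUnion_le _).trans ?_)
  rw [ENNReal.ofReal_tsum_of_nonneg hx0 hx]
  exact ENNReal.tsum_le_tsum fun k =>
    (ENNReal.le_ofReal_iff_toReal_le (measure_ne_top _ _) (hx0 k)).2 (h k)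

variable {Ω : Type*} [MeasurableSpace Ω] {P : Measure Ω} [IsProbabilityMeasure P]
  {X : ℝ → Ω → ℝ} {m : NNReal} {V : ℝ → ℝ}

/-- With high conditional probability, the rescaled excess process is uniformly close to its
values on a fine dyadic grid. -/
lemma exists_forall_cond_oscillation_le (hX : IsZeroMeanGaussianProcess P X)
    (hXc : ∀ ω, Continuous fun t => X t ω) (hm : m ≠ 0)
    (hV0 : V 0 = 0) (hV : ∀ t, V (-t) = V t)
    (hlip : ∀ s t l, 0 < l → |V s - V t| ≤ l * V (s - t) + (V s + V t) / (2 * l))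
    (hcov : ∀ s t, ∫ ω, X s ω * X t ω ∂P = m - V (s - t))
    {u d : ℕ → ℝ} (hu : Tendsto u atTop atTop) {b : ℝ} (hb0 : 0 < b) (hb1 : b < 1) (p r : ℝ)
    (hdy : ∃ c, 0 ≤ c ∧ ∀ᶠ n in atTop, ∀ k : ℕ,
      u n ^ 2 * V (d n * (r / 2 ^ k)) ≤ c * (b ^ 4) ^ k)
    (hloc : ∀ K, ∃ c, ∀ᶠ n in atTop, ∀ t, |t| ≤ K → u n ^ 2 * V (d n * t) ≤ c)
    {η ε : ℝ} (hη : 0 < η) (hε : 0 < ε) :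
    ∃ N0 : ℕ, ∀ N ≥ N0, ∀ᶠ n in atTop, (P[|{ω | u n < X 0 ω}]).real
      {ω | ∃ s ∈ Icc (0 : ℝ) 1, η < |scaledExcess (u n) (d n) X (p + r * s) ω
        - scaledExcess (u n) (d n) X (p + r * (⌊s * 2 ^ N⌋₊ / 2 ^ N)) ω|} ≤ ε := by
  have hm' : (0 : ℝ) < m := by exact_mod_cast hm.bot_lt
  obtain ⟨c, hc, hdy⟩ := hdy
  obtain ⟨c₀, hloc⟩ := hloc (|p| + |r|)
  set c' := max c₀ 0 with hc'
  obtain ⟨L, hL0, hL⟩ : ∃ L : ℝ, 0 ≤ L ∧ exp (-L) < ε / 4 :=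
    ((eventually_ge_atTop 0).and
      (tendsto_exp_neg_atTop_nhds_zero.eventually_lt_const (by positivity))).exists
  obtain ⟨e, he⟩ : ∃ e : ℕ, (b ^ 2) ^ e < 1 / 4 :=
    exists_pow_lt_of_lt_one (by norm_num) (pow_lt_one₀ hb0.le hb1 two_ne_zero)
  set M := (∫ z : ℝ, z ^ (2 * e) ∂(gaussianReal 0 1)) * (2 * c) ^ e with hM
  have hM0 : 0 ≤ M := mul_nonneg (integral_nonneg fun z => by
    rw [pow_mul]; positivity) (by positivity)
  set a := 1 + (L + 1 / m) * (c + c') with ha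
  have ha0 : 0 ≤ a := by positivity
  have hsumb : Summable fun k : ℕ => a * b ^ k :=
    (summable_geometric_of_lt_one hb0.le hb1).mul_left _
  have hsumh : Summable fun k : ℕ => M * (1 / 2 : ℝ) ^ k :=
    summable_geometric_two.mul_left _
  have ev : ∀ᶠ N : ℕ in atTop, ∑' k, a * b ^ (k + (N + 1)) ≤ η
      ∧ ∑' k, M * (1 / 2 : ℝ) ^ (k + (N + 1)) ≤ ε / 2 :=
    (((tendsto_sum_nat_add fun k => a * b ^ k).comp
      (tendsto_add_atTop_nat 1)).eventually_le_const hη).and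
    (((tendsto_sum_nat_add fun k => M * (1 / 2 : ℝ) ^ k).comp
      (tendsto_add_atTop_nat 1)).eventually_le_const (by positivity))
  obtain ⟨N0, hN0⟩ := eventually_atTop.1 ev
  refine ⟨N0, fun N hN => ?_⟩
  obtain ⟨hN1, hN2⟩ := hN0 N hN
  have hS := tendsto_measureReal_cond_overshoot hm (hX.1 0) (hX.map_zero_eq hV0 hcov) hu hL0
  filter_upwards [hdy, hloc, hu.eventually_ge_atTop 1,
    hS.eventually_lt_const (show exp (-L) < ε / 2 by linarith)] with n hdy hloc hun hSn
  have hP0 := measure_lt_ne_zero_of_map_eq_gaussianReal hm (hX.1 0) (hX.map_zero_eq hV0 hcov) (u n)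
  have := cond_isProbabilityMeasure hP0
  set Pn := P[|{ω | u n < X 0 ω}] with hPn
  set τ : ℕ → ℕ → ℝ := fun k i => p + r * (i / 2 ^ k) with hτ
  set D : ℕ → ℕ → Set Ω := fun k i => {ω | b ^ k < |u n *
    (originResidual m V X (d n * τ k (i + 1)) ω - originResidual m V X (d n * τ k i) ω)|} with hD
  have hτd : ∀ k i, d n * τ k (i + 1) - d n * τ k i = d n * (r / 2 ^ k) := by
    intro k i
    simp only [hτ]
    push_cast
    ring
  have hDle : ∀ k i, Pn.real (D k i) ≤ M * (1 / 4) ^ k := by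
    intro k i
    refine (cond_measureReal_residual_increment_le hX hm hV0 hV hcov (u n) (u n)
      (d n * τ k (i + 1)) (d n * τ k i) e (pow_pos hb0 k) (y := c * (b ^ 4) ^ k)
      (by rw [hτd]; exact hdy k)).trans ?_
    have h1 : (2 * (c * (b ^ 4) ^ k)) ^ e / (b ^ k) ^ (2 * e) = (2 * c) ^ e * ((b ^ 2) ^ e) ^ k := by
      rw [div_eq_iff (by positivity), ← mul_assoc, mul_pow, mul_assoc]
      congr 1
      simp only [← pow_mul, ← pow_add]
      congr 1
      ring
    rw [mul_div_assoc, h1, ← mul_assoc]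
    gcongr
  have hU : Pn.real (⋃ k, ⋃ i ∈ Finset.range (2 ^ (k + (N + 1))), D (k + (N + 1)) i) ≤ ε / 2 := by
    refine (measureReal_iUnion_le_tsum ((summable_nat_add_iff (N + 1)).2 hsumh) fun k => ?_).trans
      hN2
    refine (measureReal_biUnion_finset_le _ _).trans ((Finset.sum_le_card_nsmul _ _ _ fun i _ =>
      hDle _ i).trans_eq ?_)
    rw [Finset.card_range, nsmul_eq_mul]
    push_cast
    rw [mul_left_comm, ← mul_pow]
    norm_num
  have hE : Pn.real {ω | u n < X 0 ω}ᶜ = 0 := by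
    rw [measureReal_def, hPn, cond_apply (measurableSet_lt measurable_const (hX.1 0))]
    simp
  have hsub : {ω | ∃ s ∈ Icc (0 : ℝ) 1, η < |scaledExcess (u n) (d n) X (p + r * s) ω
        - scaledExcess (u n) (d n) X (p + r * (⌊s * 2 ^ N⌋₊ / 2 ^ N)) ω|}
      ⊆ ({ω | u n < X 0 ω}ᶜ ∪ {ω | L < u n * (X 0 ω - u n) / m})
        ∪ ⋃ k, ⋃ i ∈ Finset.range (2 ^ (k + (N + 1))), D (k + (N + 1)) i := by
    rintro ω ⟨s, hs, hlt⟩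
    by_contra hω
    simp only [mem_union, mem_iUnion, not_or, not_exists, mem_compl_iff, mem_ofPred_eq,
      not_lt, hD, Finset.mem_range] at hω
    obtain ⟨⟨hω1, hω2⟩, hω3⟩ := hω
    refine absurd hlt (not_lt.2 (le_trans ?_ hN1))
    refine abs_sub_dyadic_floor_le (f := fun s => scaledExcess (u n) (d n) X (p + r * s) ω)
      (x := fun k => a * b ^ k) ?_ (fun k => by positivity) hsumb ?_ hs
    · simp only [scaledExcess]
      exact continuous_const.mul (((hXc ω).comp (by fun_prop)).sub continuous_const)
    intro k hk i hi
    have hk' : k - (N + 1) + (N + 1) = k := by omega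
    have h3 := hω3 (k - (N + 1)) i (by rwa [hk'])
    rw [hk'] at h3
    have hτle : ∀ i : ℕ, i ≤ 2 ^ k → |τ k i| ≤ |p| + |r| := by
      intro i hi
      refine (abs_add_le _ _).trans (add_le_add_right ?_ _)
      rw [abs_mul]
      refine mul_le_of_le_one_right (abs_nonneg _) ?_
      rw [abs_of_nonneg (by positivity), div_le_one (by positivity)]
      exact_mod_cast hi
    have h4 := abs_drift_sub_le (σ := u n * (X 0 ω - u n) / m) (m := m) (d := d n)
      (s := τ k (i + 1)) (t := τ k i) hm' hlip hun
      (by have := sub_nonneg.2 (not_le.1 hω1).le; positivity) hω2 hc (le_max_right c₀ 0) hb0 hb1 k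
      (by rw [hτd]; exact hdy k)
      ((hloc _ (hτle _ (by omega))).trans (le_max_left _ _))
      ((hloc _ (hτle _ (by omega))).trans (le_max_left _ _))
    show |scaledExcess (u n) (d n) X (τ k (i + 1)) ω - scaledExcess (u n) (d n) X (τ k i) ω| ≤ _
    rw [scaledExcess_eq hm'.ne' V, scaledExcess_eq hm'.ne' V, add_sub_add_comm, ← mul_sub]
    refine (abs_add_le _ _).trans ((add_le_add h3 h4).trans_eq ?_)
    rw [ha]
    ring
  calc _ ≤ _ := measureReal_mono hsub
    _ ≤ _ := measureReal_union_le _ _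
    _ ≤ _ := add_le_add_left (measureReal_union_le _ _) _
    _ ≤ ε := by linarith

end OscillationBound

section Positivity

open Real Set

lemma tendsto_dyadic_floor {s : ℝ} (hs : 0 ≤ s) :
    Tendsto (fun n : ℕ => (⌊s * 2 ^ n⌋₊ : ℝ) / 2 ^ n) atTop (nhds s) :=
  (tendsto_nat_floor_mul_div_atTop (R := ℝ) hs).comp
    (tendsto_pow_atTop_atTop_of_one_lt (r := (2 : ℝ)) one_lt_two)

lemma dyadic_floor_le {s : ℝ} (hs : s ≤ 1) (n : ℕ) : ⌊s * 2 ^ n⌋₊ < 2 ^ n + 1 := by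
  refine Nat.lt_succ_of_le (Nat.floor_le_of_le ?_)
  push_cast
  exact mul_le_of_le_one_left (by positivity) hs

/-- Convergence of the probability that a continuous process stays positive on `[0, 1]`, from
convergence on dyadic grids, control of the oscillation between grid points, and continuity of the
law of the minimum of the limit over a grid. -/
lemma tendsto_measureReal_forall_pos {Ω Ω' : Type*} [MeasurableSpace Ω] [MeasurableSpace Ω']
    {Pn : ℕ → Measure Ω} [∀ n, IsProbabilityMeasure (Pn n)] {Q : Measure Ω'}
    [IsProbabilityMeasure Q] {Y : ℕ → ℝ → Ω → ℝ} {Z : ℝ → Ω' → ℝ}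
    (hZm : ∀ t, Measurable (Z t)) (hZ : ∀ ω, Continuous fun t => Z t ω)
    (hclosed : ∀ N : ℕ, ∀ ε > 0, ∀ᶠ n in atTop,
      (Pn n).real {ω | ∀ i : Fin (2 ^ N + 1), 0 ≤ Y n ((i : ℕ) / 2 ^ N) ω}
        ≤ Q.real {ω | ∀ i : Fin (2 ^ N + 1), 0 ≤ Z ((i : ℕ) / 2 ^ N) ω} + ε)
    (hopen : ∀ N : ℕ, ∀ η > 0, ∀ ε > 0, ∀ᶠ n in atTop,
      Q.real {ω | ∀ i : Fin (2 ^ N + 1), η < Z ((i : ℕ) / 2 ^ N) ω} - ε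
        ≤ (Pn n).real {ω | ∀ i : Fin (2 ^ N + 1), η < Y n ((i : ℕ) / 2 ^ N) ω})
    (hosc : ∀ η > 0, ∀ ε > 0, ∃ N0 : ℕ, ∀ N ≥ N0, ∀ᶠ n in atTop, (Pn n).real
      {ω | ∃ s ∈ Icc (0 : ℝ) 1, η < |Y n s ω - Y n (⌊s * 2 ^ N⌋₊ / 2 ^ N) ω|} ≤ ε)
    {K : ℝ} (hK : ∀ N : ℕ, ∀ η > 0,
      Q.real {ω | ∀ i : Fin (2 ^ N + 1), 0 ≤ Z ((i : ℕ) / 2 ^ N) ω}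
        ≤ Q.real {ω | ∀ i : Fin (2 ^ N + 1), η < Z ((i : ℕ) / 2 ^ N) ω} + K * η) :
    Tendsto (fun n => (Pn n).real {ω | ∀ s ∈ Icc (0 : ℝ) 1, 0 < Y n s ω}) atTop
      (nhds (Q.real {ω | ∀ s ∈ Icc (0 : ℝ) 1, 0 < Z s ω})) := by
  set q := Q.real {ω | ∀ s ∈ Icc (0 : ℝ) 1, 0 < Z s ω} with hq
  have hlower : ∀ ε > 0, ∀ᶠ n in atTop,
      q - ε ≤ (Pn n).real {ω | ∀ s ∈ Icc (0 : ℝ) 1, 0 < Y n s ω} := by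
    intro ε hε
    have hmono : Monotone fun j : ℕ => {ω | ∀ s ∈ Icc (0 : ℝ) 1, 1 / ((j : ℝ) + 1) < Z s ω} := by
      intro i j hij ω hω s hs
      exact (one_div_le_one_div_of_le (by positivity) (by gcongr)).trans_lt (hω s hs)
    have hunion : ⋃ j : ℕ, {ω | ∀ s ∈ Icc (0 : ℝ) 1, 1 / ((j : ℝ) + 1) < Z s ω}
        = {ω | ∀ s ∈ Icc (0 : ℝ) 1, 0 < Z s ω} := by
      ext ω
      simp only [mem_iUnion, mem_ofPred_eq]
      constructor
      · rintro ⟨j, hj⟩ s hs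
        exact lt_trans (by positivity) (hj s hs)
      · intro h
        obtain ⟨s₀, hs₀, hmin⟩ := isCompact_Icc.exists_isMinOn
          (nonempty_Icc.2 (zero_le_one (α := ℝ))) (hZ ω).continuousOn
        obtain ⟨j, hj⟩ := exists_nat_one_div_lt (h s₀ hs₀)
        exact ⟨j, fun s hs => hj.trans_le (hmin hs)⟩
    have hlim := tendsto_measure_iUnion_atTop (μ := Q) hmono
    rw [hunion] at hlim
    have hlim' := (ENNReal.tendsto_toReal (measure_ne_top Q _)).comp hlim
    obtain ⟨j, hj⟩ := (hlim'.eventually_const_lt (show q - ε / 3 < q by linarith)).exists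
    have hη : 0 < 1 / ((j : ℝ) + 1) := by positivity
    set η := 1 / ((j : ℝ) + 1)
    obtain ⟨N, hN⟩ := hosc η hη (ε / 3) (by positivity)
    filter_upwards [hN N le_rfl, hopen N η hη (ε / 3) (by positivity)] with n h1 h2
    have h3 : Q.real {ω | ∀ s ∈ Icc (0 : ℝ) 1, η < Z s ω}
        ≤ Q.real {ω | ∀ i : Fin (2 ^ N + 1), η < Z ((i : ℕ) / 2 ^ N) ω} := by
      refine measureReal_mono fun ω hω i => hω _ ⟨by positivity, ?_⟩
      rw [div_le_one (by positivity)]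
      exact_mod_cast Nat.lt_succ_iff.1 i.2
    have h4 : (Pn n).real {ω | ∀ i : Fin (2 ^ N + 1), η < Y n ((i : ℕ) / 2 ^ N) ω}
        ≤ (Pn n).real {ω | ∀ s ∈ Icc (0 : ℝ) 1, 0 < Y n s ω} + (Pn n).real
          {ω | ∃ s ∈ Icc (0 : ℝ) 1, η < |Y n s ω - Y n (⌊s * 2 ^ N⌋₊ / 2 ^ N) ω|} := by
      refine (measureReal_mono fun ω hω => ?_).trans (measureReal_union_le _ _)
      by_contra hcon
      simp only [mem_union, mem_ofPred_eq, not_or, not_forall, not_exists, not_and, not_lt] at hcon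
      obtain ⟨⟨s, hs, hs0⟩, hle⟩ := hcon
      have h5 := (abs_le.1 (hle s hs)).1
      have h6 := hω ⟨⌊s * 2 ^ N⌋₊, dyadic_floor_le hs.2 N⟩
      simp only at h6
      linarith
    have h5 : q - ε / 3 < Q.real {ω | ∀ s ∈ Icc (0 : ℝ) 1, η < Z s ω} := hj
    linarith
  have hupper : ∀ ε > 0, ∀ᶠ n in atTop,
      (Pn n).real {ω | ∀ s ∈ Icc (0 : ℝ) 1, 0 < Y n s ω} ≤ q + ε := by
    intro ε hε
    obtain ⟨η, hη, hKη⟩ : ∃ η > 0, K * η < ε / 3 := by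
      have : Tendsto (fun η => K * η) (nhdsWithin 0 (Ioi 0)) (nhds 0) :=
        tendsto_nhdsWithin_of_tendsto_nhds (by
          simpa using (continuous_const_mul K).tendsto 0)
      exact ((eventually_mem_nhdsWithin).and
        (this.eventually_lt_const (show 0 < ε / 3 by positivity))).exists
    set A : ℕ → Set Ω' := fun N => {ω | ∀ i : Fin (2 ^ N + 1), η < Z ((i : ℕ) / 2 ^ N) ω} with hA
    have hanti : Antitone A := by
      refine antitone_nat_of_succ_le fun N ω hω i => ?_
      have e : ((2 * (i : ℕ) : ℕ) : ℝ) / 2 ^ (N + 1) = (i : ℕ) / 2 ^ N := by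
        rw [pow_succ', Nat.cast_mul, Nat.cast_ofNat, mul_div_mul_left _ _ two_ne_zero]
      have h1 : η < Z (((2 * (i : ℕ) : ℕ) : ℝ) / 2 ^ (N + 1)) ω :=
        hω ⟨2 * i, by have := i.2; rw [pow_succ]; omega⟩
      rwa [e] at h1
    have hAm : ∀ N, NullMeasurableSet (A N) Q := fun N => by
      have : A N = ⋂ i : Fin (2 ^ N + 1), {ω | η < Z ((i : ℕ) / 2 ^ N) ω} := by
        ext ω; simp [hA]
      rw [this]
      exact (MeasurableSet.iInter fun i =>
        measurableSet_lt measurable_const (hZm _)).nullMeasurableSet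
    have hlim := tendsto_measure_iInter_atTop hAm hanti ⟨0, measure_ne_top Q _⟩
    have hlim' := (ENNReal.tendsto_toReal (measure_ne_top Q _)).comp hlim
    have hle : (Q (⋂ N, A N)).toReal ≤ q := by
      refine measureReal_mono fun ω hω s hs => hη.trans_le ?_
      refine ge_of_tendsto (((hZ ω).tendsto s).comp (tendsto_dyadic_floor hs.1))
        (Eventually.of_forall fun N => ?_)
      exact (mem_iInter.1 hω N ⟨⌊s * 2 ^ N⌋₊, dyadic_floor_le hs.2 N⟩).le
    obtain ⟨N, hN⟩ := (hlim'.eventually_lt_const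
      (show (Q (⋂ N, A N)).toReal < q + ε / 3 by linarith)).exists
    filter_upwards [hclosed N (ε / 3) (by positivity)] with n hn
    have h1 : (Pn n).real {ω | ∀ s ∈ Icc (0 : ℝ) 1, 0 < Y n s ω}
        ≤ (Pn n).real {ω | ∀ i : Fin (2 ^ N + 1), 0 ≤ Y n ((i : ℕ) / 2 ^ N) ω} := by
      refine measureReal_mono fun ω hω i => (hω _ ⟨by positivity, ?_⟩).le
      rw [div_le_one (by positivity)]
      exact_mod_cast Nat.lt_succ_iff.1 i.2
    have h2 : Q.real (A N) < q + ε / 3 := hN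
    have h3 := hK N η hη
    linarith
  rw [Metric.tendsto_atTop']
  intro ε hε
  obtain ⟨n₀, h⟩ := eventually_atTop.1
    ((hlower (ε / 2) (by positivity)).and (hupper (ε / 2) (by positivity)))
  refine ⟨n₀, fun n hn => ?_⟩
  rw [Real.dist_eq, abs_lt]
  constructor <;> linarith [(h n hn.le).1, (h n hn.le).2]

end Positivity

section PositivityLimit

open Real Set

variable {Ω' : Type*} {T : Ω' → ℝ} [MeasurableSpace Ω'] {Q : Measure Ω'} [IsProbabilityMeasure Q]

/-- A shift of a random variable by an independent multiple of a standard exponential variable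
has a density bounded by the inverse of the factor. -/
lemma measureReal_add_mul_mem_Icc_le (hT : Measurable T)
    (hexp : ∀ x : ℝ, 0 ≤ x → Q {ω | x < T ω} = ENNReal.ofReal (exp (-x)))
    {M : Ω' → ℝ} (hM : Measurable M) (hind : IndepFun M T Q) {m η : ℝ} (hm : 0 < m) (hη : 0 ≤ η) :
    Q.real {ω | M ω + m * T ω ∈ Icc 0 η} ≤ m⁻¹ * η := by
  have hS : MeasurableSet {x : ℝ × ℝ | x.1 + m * x.2 ∈ Icc 0 η} :=
    (show Measurable fun x : ℝ × ℝ => x.1 + m * x.2 by fun_prop) measurableSet_Icc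
  have := Measure.isProbabilityMeasure_map (μ := Q) hT.aemeasurable
  have := Measure.isProbabilityMeasure_map (μ := Q) hM.aemeasurable
  have h1 : Q {ω | M ω + m * T ω ∈ Icc 0 η} ≤ ENNReal.ofReal (m⁻¹ * η) := by
    have e : Q {ω | M ω + m * T ω ∈ Icc 0 η}
        = Q.map (fun ω => (M ω, T ω)) {x : ℝ × ℝ | x.1 + m * x.2 ∈ Icc 0 η} := by
      rw [Measure.map_apply (hM.prodMk hT) hS]
      rfl
    rw [e, (indepFun_iff_map_prod_eq_prod_map_map hM.aemeasurable hT.aemeasurable).1 hind,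
      Measure.prod_apply hS]
    calc _ ≤ ∫⁻ _, ENNReal.ofReal (m⁻¹ * η) ∂(Q.map M) := by
          refine lintegral_mono fun x => (map_standardExponential_le_volume hT hexp _).trans ?_
          calc _ ≤ volume (Icc (-x / m) ((η - x) / m)) := by
                refine measure_mono fun t ht => ?_
                have h0 : 0 ≤ x + m * t := ht.1
                have h1 : x + m * t ≤ η := ht.2
                exact ⟨by rw [div_le_iff₀ hm]; linarith, by rw [le_div_iff₀ hm]; linarith⟩
            _ = _ := by
                rw [Real.volume_Icc]
                congr 1
                field_simp
                ring
      _ = _ := by simp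
  exact ENNReal.toReal_le_of_le_ofReal (by positivity) h1

lemma measureReal_forall_nonneg_le (hT : Measurable T)
    (hexp : ∀ x : ℝ, 0 ≤ x → Q {ω | x < T ω} = ENNReal.ofReal (exp (-x)))
    {k : ℕ} {w : Fin (k + 1) → Ω' → ℝ} (hw : ∀ i, Measurable (w i))
    (hind : IndepFun (fun ω i => w i ω) T Q) (c : Fin (k + 1) → ℝ)
    {m η : ℝ} (hm : 0 < m) (hη : 0 ≤ η) :
    Q.real {ω | ∀ i, 0 ≤ w i ω + m * T ω - c i}
      ≤ Q.real {ω | ∀ i, η < w i ω + m * T ω - c i} + m⁻¹ * η := by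
  set φ : (Fin (k + 1) → ℝ) → ℝ := fun x =>
    Finset.univ.inf' Finset.univ_nonempty fun i => x i - c i with hφ
  have hφm : Measurable φ := by
    refine Continuous.measurable (Continuous.finset_inf'_apply _ fun i _ => ?_)
    fun_prop
  have hwm : Measurable fun ω i => w i ω := measurable_pi_lambda _ hw
  have hind' : IndepFun (fun ω => φ fun i => w i ω) T Q := hind.comp hφm measurable_id
  refine le_trans ((measureReal_mono fun ω hω => ?_).trans (measureReal_union_le _ _))
    (add_le_add_right (measureReal_add_mul_mem_Icc_le hT hexp (hφm.comp hwm) hind' hm hη) _)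
  by_cases h : ∀ i, η < w i ω + m * T ω - c i
  · exact Or.inl h
  · push Not at h
    obtain ⟨i, hi⟩ := h
    refine Or.inr ⟨?_, ?_⟩
    · obtain ⟨j, -, hj⟩ := Finset.exists_mem_eq_inf' Finset.univ_nonempty fun i => w i ω - c i
      have := hω j
      simp only [Function.comp, hφ, hj]
      linarith
    · have := Finset.inf'_le (fun i => w i ω - c i) (Finset.mem_univ i)
      simp only [Function.comp, hφ]
      linarith

variable {Ω : Type*} [MeasurableSpace Ω] {P : Measure Ω} [IsProbabilityMeasure P]
  {X : ℝ → Ω → ℝ} {W : ℝ → Ω' → ℝ} {V G : ℝ → ℝ} {m : NNReal} {u d : ℕ → ℝ}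

lemma tendsto_cond_measureReal_forall_pos (hX : IsZeroMeanGaussianProcess P X)
    (hXc : ∀ ω, Continuous fun t => X t ω) (hm : m ≠ 0)
    (hV0 : V 0 = 0) (hV : ∀ t, V (-t) = V t)
    (hlip : ∀ s t l, 0 < l → |V s - V t| ≤ l * V (s - t) + (V s + V t) / (2 * l))
    (hcov : ∀ s t, ∫ ω, X s ω * X t ω ∂P = m - V (s - t))
    (hu : Tendsto u atTop atTop)
    (hG : ∀ t, Tendsto (fun n => u n ^ 2 * V (d n * t)) atTop (nhds (G t)))
    {b : ℝ} (hb0 : 0 < b) (hb1 : b < 1)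
    (hloc : ∀ K, ∃ c, ∀ᶠ n in atTop, ∀ t, |t| ≤ K → u n ^ 2 * V (d n * t) ≤ c)
    (hW : IsZeroMeanGaussianProcess Q W) (hWc : ∀ ω, Continuous fun t => W t ω)
    (hGc : Continuous G) (hWcov : ∀ s t, ∫ ω, W s ω * W t ω ∂Q = G s + G t - G (s - t))
    (hT : Measurable T)
    (hexp : ∀ x : ℝ, 0 ≤ x → Q {ω | x < T ω} = ENNReal.ofReal (exp (-x)))
    (hind : ∀ (n : ℕ) (t : Fin n → ℝ), IndepFun (fun ω i => W (t i) ω) T Q)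
    (p r : ℝ) (hdy : ∃ c, 0 ≤ c ∧ ∀ᶠ n in atTop, ∀ k : ℕ,
      u n ^ 2 * V (d n * (r / 2 ^ k)) ≤ c * (b ^ 4) ^ k) :
    Tendsto (fun n => (P[|{ω | u n < X 0 ω}]).real
        {ω | ∀ s ∈ Icc (0 : ℝ) 1, 0 < scaledExcess (u n) (d n) X (p + r * s) ω}) atTop
      (nhds (Q.real {ω | ∀ s ∈ Icc (0 : ℝ) 1,
        0 < W (p + r * s) ω + m * T ω - G (p + r * s) / m})) := by
  have hm' : (0 : ℝ) < m := by exact_mod_cast hm.bot_lt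
  have hprob : ∀ n, IsProbabilityMeasure (P[|{ω | u n < X 0 ω}]) := fun n =>
    cond_isProbabilityMeasure (measure_lt_ne_zero_of_map_eq_gaussianReal hm (hX.1 0)
      (hX.map_zero_eq hV0 hcov) (u n))
  have hYm : ∀ n t, Measurable (scaledExcess (u n) (d n) X t) := fun n t =>
    ((hX.1 _).sub_const _).const_mul _
  have hWm := hW.1
  have hZm : ∀ t, Measurable fun ω => W t ω + m * T ω - G t / m := fun t => by fun_prop
  have hchar : ∀ {k : ℕ} (t θ : Fin k → ℝ), Tendsto
      (fun n => ∫ ω, Complex.exp (((∑ j, θ j * scaledExcess (u n) (d n) X (t j) ω : ℝ) : ℂ)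
        * Complex.I) ∂(P[|{ω | u n < X 0 ω}])) atTop
      (nhds (∫ ω, Complex.exp (((∑ j, θ j * (W (t j) ω + m * T ω - G (t j) / m) : ℝ) : ℂ)
        * Complex.I) ∂Q)) := fun t θ => by
    rw [integral_exp_sum_limit hW hWcov hT hexp hind θ t]
    exact tendsto_integral_exp_scaledExcess hX hm hV0 hV hcov hu hG θ t
  refine tendsto_measureReal_forall_pos (K := (m : ℝ)⁻¹)
    (Y := fun n s ω => scaledExcess (u n) (d n) X (p + r * s) ω)
    (Z := fun s ω => W (p + r * s) ω + m * T ω - G (p + r * s) / m)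
    (fun s => hZm _) (fun ω => ?_) ?_ ?_ ?_ ?_
  · have := hWc ω
    fun_prop
  · intro N ε hε
    have hF : IsClosed {x : Fin (2 ^ N + 1) → ℝ | ∀ i, 0 ≤ x i} := by
      rw [ofPred_forall]
      exact isClosed_iInter fun i => isClosed_le continuous_const (continuous_apply i)
    exact eventually_measureReal_isClosed_le
      (ξ := fun n (i : Fin (2 ^ N + 1)) => scaledExcess (u n) (d n) X (p + r * ((i : ℕ) / 2 ^ N)))
      (fun n j => hYm _ _) (fun j => hZm _) (fun θ => hchar _ θ) hF hε
  · intro N η hη ε hε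
    have hU : IsOpen {x : Fin (2 ^ N + 1) → ℝ | ∀ i, η < x i} := by
      rw [ofPred_forall]
      exact isOpen_iInter_of_finite fun i => isOpen_lt continuous_const (continuous_apply i)
    exact eventually_le_measureReal_isOpen
      (ξ := fun n (i : Fin (2 ^ N + 1)) => scaledExcess (u n) (d n) X (p + r * ((i : ℕ) / 2 ^ N)))
      (fun n j => hYm _ _) (fun j => hZm _) (fun θ => hchar _ θ) hU hε
  · intro η hη ε hε
    exact exists_forall_cond_oscillation_le hX hXc hm hV0 hV hlip hcov hu hb0 hb1 p r hdy hloc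
      hη hε
  · intro N η hη
    exact measureReal_forall_nonneg_le hT hexp (fun i => hWm _) (hind _ _) _ hm' hη.le

end PositivityLimit

section JointConvergence

open Real Set

lemma measureReal_Ioc_prod_Ioc (ν : Measure (ℝ × ℝ)) [IsFiniteMeasure ν] {a a' b b' : ℝ}
    (ha : a ≤ a') (hb : b ≤ b') :
    ν.real (Ioc a a' ×ˢ Ioc b b') = ν.real (Ioi a ×ˢ Ioi b) - ν.real (Ioi a' ×ˢ Ioi b)
      - (ν.real (Ioi a ×ˢ Ioi b') - ν.real (Ioi a' ×ˢ Ioi b')) := by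
  have h : ∀ b, ν.real (Ioi a ×ˢ Ioi b) - ν.real (Ioi a' ×ˢ Ioi b)
      = ν.real (Ioc a a' ×ˢ Ioi b) := fun b => by
    rw [← Ioc_union_Ioi_eq_Ioi ha, union_prod, measureReal_union _
      (measurableSet_Ioi.prod measurableSet_Ioi)]
    · ring
    · exact Disjoint.set_prod_left (Ioc_disjoint_Ioi le_rfl) _ _
  rw [h, h, ← Ioc_union_Ioi_eq_Ioi hb, prod_union, measureReal_union _
      (measurableSet_Ioc.prod measurableSet_Ioi)]
  · ring
  · exact Disjoint.set_prod_right (Ioc_disjoint_Ioi le_rfl) _ _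

lemma tendsto_probabilityMeasure_of_tendsto_Ioi_prod_Ioi {ι : Type*} {l : Filter ι}
    [l.IsCountablyGenerated] {νn : ι → ProbabilityMeasure (ℝ × ℝ)} {ν : ProbabilityMeasure (ℝ × ℝ)}
    (h : ∀ a b, Tendsto (fun n => (νn n : Measure (ℝ × ℝ)).real (Ioi a ×ˢ Ioi b)) l
      (nhds ((ν : Measure (ℝ × ℝ)).real (Ioi a ×ˢ Ioi b)))) :
    Tendsto νn l (nhds ν) := by
  have hpi : IsPiSystem {s : Set (ℝ × ℝ) | ∃ a a' b b', s = Ioc a a' ×ˢ Ioc b b'} := by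
    rintro _ ⟨a, a', b, b', rfl⟩ _ ⟨c, c', e, e', rfl⟩ -
    exact ⟨_, _, _, _, by rw [prod_inter_prod, Ioc_inter_Ioc, Ioc_inter_Ioc]⟩
  refine hpi.tendsto_probabilityMeasure_of_tendsto_of_mem ?_ ?_ ?_
  · rintro _ ⟨a, a', b, b', rfl⟩
    exact measurableSet_Ioc.prod measurableSet_Ioc
  · rintro U hU ⟨x, y⟩ hxy
    obtain ⟨A, hA, B, hB, hAB⟩ := mem_nhds_prod_iff.1 (hU.mem_nhds hxy)
    obtain ⟨r, hr, hrA⟩ := Metric.mem_nhds_iff.1 hA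
    obtain ⟨r', hr', hrB⟩ := Metric.mem_nhds_iff.1 hB
    refine ⟨_, ⟨x - r / 2, x + r / 2, y - r' / 2, y + r' / 2, rfl⟩,
      prod_mem_nhds (Ioc_mem_nhds (by linarith) (by linarith))
        (Ioc_mem_nhds (by linarith) (by linarith)), (Set.prod_mono ?_ ?_).trans hAB⟩
    · refine fun z hz => hrA ?_
      rw [Metric.mem_ball, Real.dist_eq, abs_lt]
      constructor <;> linarith [hz.1, hz.2]
    · refine fun z hz => hrB ?_
      rw [Metric.mem_ball, Real.dist_eq, abs_lt]
      constructor <;> linarith [hz.1, hz.2]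
  · rintro _ ⟨a, a', b, b', rfl⟩
    rcases lt_or_ge a' a with ha | ha
    · simp [Ioc_eq_empty_of_le ha.le, tendsto_const_nhds]
    rcases lt_or_ge b' b with hb | hb
    · simp [Ioc_eq_empty_of_le hb.le, tendsto_const_nhds]
    have h1 : Tendsto (fun n => (νn n : Measure (ℝ × ℝ)).real (Ioc a a' ×ˢ Ioc b b')) l
        (nhds ((ν : Measure (ℝ × ℝ)).real (Ioc a a' ×ˢ Ioc b b'))) := by
      simp_rw [measureReal_Ioc_prod_Ioc _ ha hb]
      exact ((h _ _).sub (h _ _)).sub ((h _ _).sub (h _ _))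
    rw [← NNReal.tendsto_coe]
    exact h1

lemma tendsto_integral_comp_add {Ω Ω' : Type*} [MeasurableSpace Ω] [MeasurableSpace Ω']
    {Pn : ℕ → Measure Ω} [∀ n, IsProbabilityMeasure (Pn n)] {Q : Measure Ω'}
    [IsProbabilityMeasure Q] {ξ η : ℕ → Ω → ℝ} {ξ' η' : Ω' → ℝ}
    (hξ : ∀ n, Measurable (ξ n)) (hη : ∀ n, Measurable (η n))
    (hξ' : Measurable ξ') (hη' : Measurable η')
    (h : ∀ a b, Tendsto (fun n => (Pn n).real {ω | a < ξ n ω ∧ b < η n ω}) atTop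
      (nhds (Q.real {ω | a < ξ' ω ∧ b < η' ω})))
    (f : BoundedContinuousFunction ℝ ℝ) :
    Tendsto (fun n => ∫ ω, f (ξ n ω + η n ω) ∂(Pn n)) atTop
      (nhds (∫ ω, f (ξ' ω + η' ω) ∂Q)) := by
  have hm : ∀ n, Measurable fun ω => (ξ n ω, η n ω) := fun n => (hξ n).prodMk (hη n)
  have hm' : Measurable fun ω => (ξ' ω, η' ω) := hξ'.prodMk hη'
  set νn : ℕ → ProbabilityMeasure (ℝ × ℝ) := fun n =>
    ⟨(Pn n).map fun ω => (ξ n ω, η n ω), Measure.isProbabilityMeasure_map (hm n).aemeasurable⟩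
    with hνn
  set ν : ProbabilityMeasure (ℝ × ℝ) :=
    ⟨Q.map fun ω => (ξ' ω, η' ω), Measure.isProbabilityMeasure_map hm'.aemeasurable⟩ with hν
  have hlim : Tendsto νn atTop (nhds ν) := by
    refine tendsto_probabilityMeasure_of_tendsto_Ioi_prod_Ioi fun a b => ?_
    have hS : MeasurableSet (Ioi a ×ˢ Ioi b) := measurableSet_Ioi.prod measurableSet_Ioi
    simp only [hνn, hν, ProbabilityMeasure.coe_mk]
    rw [map_measureReal_apply hm' hS]
    simp_rw [map_measureReal_apply (hm _) hS]
    exact h a b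
  have h2 := ProbabilityMeasure.tendsto_iff_forall_integral_tendsto.1 hlim
    (f.compContinuous ⟨fun x : ℝ × ℝ => x.1 + x.2, by fun_prop⟩)
  simp only [hνn, hν, ProbabilityMeasure.coe_mk] at h2
  rw [integral_map hm'.aemeasurable (by fun_prop)] at h2
  simp_rw [integral_map (hm _).aemeasurable (show AEStronglyMeasurable (f.compContinuous
    ⟨fun x : ℝ × ℝ => x.1 + x.2, by fun_prop⟩) _ by fun_prop)] at h2
  exact h2

end JointConvergence

section HittingTime

open Real Set

/-- The first time after `0` at which a path is not positive. -/
noncomputable def exitTime (y : ℝ → ℝ) : ℝ := sInf {t | 0 ≤ t ∧ y t ≤ 0}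

lemma neg_sSup_eq_exitTime_neg (y : ℝ → ℝ) :
    -sSup {t | t ≤ 0 ∧ y t ≤ 0} = exitTime fun t => y (-t) := by
  rw [exitTime, ← Real.sInf_neg]
  congr 1
  ext t
  simp

lemma exitTime_nonneg (y : ℝ → ℝ) : 0 ≤ exitTime y := Real.sInf_nonneg fun _ ht => ht.1

lemma lt_exitTime_iff {y : ℝ → ℝ} (hy : Continuous y) (h : ∃ t, 0 ≤ t ∧ y t ≤ 0) {a : ℝ} :
    a < exitTime y ↔ ∀ t ∈ Icc 0 a, 0 < y t := by
  have hb : BddBelow {t | 0 ≤ t ∧ y t ≤ 0} := ⟨0, fun t ht => ht.1⟩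
  constructor
  · intro h1 t ht
    by_contra h2
    exact absurd (csInf_le hb ⟨ht.1, not_lt.1 h2⟩) (not_le.2 (ht.2.trans_lt h1))
  · intro h1
    have hc : IsClosed {t | 0 ≤ t ∧ y t ≤ 0} :=
      (isClosed_le continuous_const continuous_id).inter (isClosed_le hy continuous_const)
    have h2 := hc.csInf_mem h hb
    by_contra h3
    exact absurd (h1 _ ⟨h2.1, not_lt.1 h3⟩) (not_lt.2 h2.2)

lemma exitTime_eq_zero {y : ℝ → ℝ} (h : ∀ t, 0 ≤ t → 0 < y t) : exitTime y = 0 := by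
  have : {t | 0 ≤ t ∧ y t ≤ 0} = ∅ := by
    ext t
    simp only [mem_ofPred_eq, mem_empty_iff_false, iff_false, not_and, not_le]
    exact h t
  rw [exitTime, this, Real.sInf_empty]

variable {Ω : Type*} [MeasurableSpace Ω] {Y : ℝ → Ω → ℝ}

lemma measurableSet_forall_Icc_pos (hYm : ∀ t, Measurable (Y t))
    (hY : ∀ ω, Continuous fun t => Y t ω) (a b : ℝ) :
    MeasurableSet {ω | ∀ t ∈ Icc a b, 0 < Y t ω} := by
  rcases lt_or_ge b a with hab | hab
  · simp [Icc_eq_empty_of_lt hab]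
  have : Nonempty (Icc a b) := ⟨⟨a, left_mem_Icc.2 hab⟩⟩
  have e : {ω | ∀ t ∈ Icc a b, 0 < Y t ω} = ⋃ j : ℕ, ⋂ k : ℕ,
      {ω | 1 / ((j : ℝ) + 1) ≤ Y (TopologicalSpace.denseSeq (Icc a b) k) ω} := by
    ext ω
    simp only [mem_iUnion, mem_iInter, mem_ofPred_eq]
    constructor
    · intro h
      obtain ⟨s₀, hs₀, hmin⟩ := isCompact_Icc.exists_isMinOn (nonempty_Icc.2 hab)
        (hY ω).continuousOn
      obtain ⟨j, hj⟩ := exists_nat_one_div_lt (h s₀ hs₀)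
      exact ⟨j, fun k => hj.le.trans (hmin (TopologicalSpace.denseSeq (Icc a b) k).2)⟩
    · rintro ⟨j, hj⟩ t ht
      refine lt_of_lt_of_le (by positivity) (?_ : 1 / ((j : ℝ) + 1) ≤ Y t ω)
      have hYc := hY ω
      exact (TopologicalSpace.denseRange_denseSeq (Icc a b)).induction_on
        (p := fun s : Icc a b => 1 / ((j : ℝ) + 1) ≤ Y s ω) ⟨t, ht⟩
        (isClosed_le continuous_const (by fun_prop)) hj
  rw [e]
  exact MeasurableSet.iUnion fun j => MeasurableSet.iInter fun k =>
    measurableSet_le measurable_const (hYm _)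

lemma measurable_exitTime (hYm : ∀ t, Measurable (Y t)) (hY : ∀ ω, Continuous fun t => Y t ω) :
    Measurable fun ω => exitTime fun t => Y t ω := by
  have hE : MeasurableSet {ω | ∀ t, 0 ≤ t → 0 < Y t ω} := by
    have e : {ω | ∀ t, 0 ≤ t → 0 < Y t ω} = ⋂ n : ℕ, {ω | ∀ t ∈ Icc 0 (n : ℝ), 0 < Y t ω} := by
      ext ω
      simp only [mem_iInter, mem_ofPred_eq]
      refine ⟨fun h n t ht => h t ht.1, fun h t ht => ?_⟩
      obtain ⟨n, hn⟩ := exists_nat_ge t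
      exact h n t ⟨ht, hn⟩
    rw [e]
    exact MeasurableSet.iInter fun n => measurableSet_forall_Icc_pos hYm hY _ _
  refine measurable_of_Ioi fun a => ?_
  rcases lt_or_ge a 0 with ha | ha
  · convert MeasurableSet.univ
    ext ω
    simpa using ha.trans_le (exitTime_nonneg _)
  · convert (measurableSet_forall_Icc_pos hYm hY 0 a).inter hE.compl
    ext ω
    simp only [mem_preimage, mem_Ioi, mem_inter_iff, mem_compl_iff, mem_ofPred_eq]
    by_cases h : ∀ t, 0 ≤ t → 0 < Y t ω
    · rw [exitTime_eq_zero h]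
      exact iff_of_false (not_lt.2 ha) fun h' => h'.2 h
    · push Not at h
      rw [lt_exitTime_iff (hY ω) h]
      simpa using fun _ => h

end HittingTime

section ExcursionLength

open Real Set

lemma lt_exitTime_iff_max {y : ℝ → ℝ} (hy : Continuous y) (h0 : 0 < y 0)
    (h : ∃ t, 0 ≤ t ∧ y t ≤ 0) {a : ℝ} :
    a < exitTime y ↔ ∀ t ∈ Icc 0 (max a 0), 0 < y t := by
  rcases le_total a 0 with ha | ha
  · have h1 : 0 < exitTime y := (lt_exitTime_iff hy h).2 (by simpa using h0)
    rw [max_eq_right ha]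
    exact iff_of_true (ha.trans_lt h1) (by simpa using h0)
  · rw [max_eq_left ha, lt_exitTime_iff hy h]

/-- The paths for which the excursion above `0` around the origin is degenerate. -/
def degeneratePaths : Set (ℝ → ℝ) :=
  {y | y 0 ≤ 0} ∪ ({y | ∀ t, 0 ≤ t → 0 < y t} ∪ {y | ∀ t, t ≤ 0 → 0 < y t})

lemma lt_exitTime_and_iff {y : ℝ → ℝ} (hy : Continuous y) (hd : y ∉ degeneratePaths) (a b : ℝ) :
    (a < exitTime y ∧ b < exitTime fun t => y (-t))
      ↔ ∀ t ∈ Icc (-max b 0) (max a 0), 0 < y t := by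
  simp only [degeneratePaths, mem_union, mem_ofPred_eq, not_or, not_le, not_forall, not_lt,
    exists_prop] at hd
  obtain ⟨h0, hp, t₀, ht₀, hn⟩ := hd
  have hn' : ∃ t, 0 ≤ t ∧ y (-t) ≤ 0 := ⟨-t₀, by linarith, by simpa using hn⟩
  rw [lt_exitTime_iff_max hy h0 hp,
    lt_exitTime_iff_max (y := fun t => y (-t)) (hy.comp continuous_neg) (by simpa using h0) hn']
  constructor
  · rintro ⟨h1, h2⟩ t ht
    rcases le_total 0 t with h | h
    · exact h1 t ⟨h, ht.2⟩
    · have := h2 (-t) ⟨by linarith, by linarith [ht.1]⟩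
      simpa using this
  · refine fun h => ⟨fun t ht => h t ⟨?_, ht.2⟩, fun t ht => h (-t) ⟨?_, ?_⟩⟩
    · linarith [ht.1, le_max_right b 0]
    · linarith [ht.2]
    · linarith [ht.1, le_max_right a 0]

variable {Ω Ω' : Type*} [MeasurableSpace Ω] [MeasurableSpace Ω']

lemma abs_measureReal_lt_exitTime_sub_le {P : Measure Ω} [IsFiniteMeasure P] {Y : ℝ → Ω → ℝ}
    (hY : ∀ ω, Continuous fun t => Y t ω) (a b : ℝ) :
    |P.real {ω | a < (exitTime fun t => Y t ω) ∧ b < exitTime fun t => Y (-t) ω}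
        - P.real {ω | ∀ t ∈ Icc (-max b 0) (max a 0), 0 < Y t ω}|
      ≤ P.real {ω | (fun t => Y t ω) ∈ degeneratePaths} := by
  have h1 := measureReal_union_le (μ := P)
    {ω | a < (exitTime fun t => Y t ω) ∧ b < exitTime fun t => Y (-t) ω}
    {ω | (fun t => Y t ω) ∈ degeneratePaths}
  have h2 := measureReal_union_le (μ := P)
    {ω | ∀ t ∈ Icc (-max b 0) (max a 0), 0 < Y t ω} {ω | (fun t => Y t ω) ∈ degeneratePaths}
  have h3 : P.real {ω | ∀ t ∈ Icc (-max b 0) (max a 0), 0 < Y t ω} ≤ _ :=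
    (measureReal_mono fun ω hω => by
      by_cases hd : (fun t => Y t ω) ∈ degeneratePaths
      · exact Or.inr hd
      · exact Or.inl ((lt_exitTime_and_iff (hY ω) hd a b).2 hω)).trans h1
  have h4 : P.real {ω | a < (exitTime fun t => Y t ω) ∧ b < exitTime fun t => Y (-t) ω} ≤ _ :=
    (measureReal_mono fun ω hω => by
      by_cases hd : (fun t => Y t ω) ∈ degeneratePaths
      · exact Or.inr hd
      · exact Or.inl ((lt_exitTime_and_iff (hY ω) hd a b).1 hω)).trans h2
  rw [abs_le]
  constructor <;> linarith

lemma measureReal_degeneratePaths_le {P : Measure Ω} [IsFiniteMeasure P] {Y : ℝ → Ω → ℝ}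
    (h0 : P.real {ω | Y 0 ω ≤ 0} = 0) (K : ℝ) :
    P.real {ω | (fun t => Y t ω) ∈ degeneratePaths}
      ≤ P.real {ω | ∀ t ∈ Icc 0 K, 0 < Y t ω} + P.real {ω | ∀ t ∈ Icc (-K) 0, 0 < Y t ω} := by
  have h1 : P.real {ω | (fun t => Y t ω) ∈ degeneratePaths}
      ≤ P.real {ω | Y 0 ω ≤ 0} + P.real ({ω | ∀ t, 0 ≤ t → 0 < Y t ω}
        ∪ {ω | ∀ t, t ≤ 0 → 0 < Y t ω}) := measureReal_union_le _ _
  have h2 := measureReal_union_le (μ := P) {ω | ∀ t, 0 ≤ t → 0 < Y t ω}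
    {ω | ∀ t, t ≤ 0 → 0 < Y t ω}
  have h3 : P.real {ω | ∀ t, 0 ≤ t → 0 < Y t ω} ≤ P.real {ω | ∀ t ∈ Icc 0 K, 0 < Y t ω} :=
    measureReal_mono fun ω hω t ht => hω t ht.1
  have h4 : P.real {ω | ∀ t, t ≤ 0 → 0 < Y t ω} ≤ P.real {ω | ∀ t ∈ Icc (-K) 0, 0 < Y t ω} :=
    measureReal_mono fun ω hω t ht => hω t ht.2
  linarith

/-- Convergence in distribution of the length of the excursion around the origin, from convergence
of the probabilities of staying positive on compact intervals. -/
lemma tendsto_integral_exitTime_add {Pn : ℕ → Measure Ω} [∀ n, IsProbabilityMeasure (Pn n)]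
    {Q : Measure Ω'} [IsProbabilityMeasure Q] {Y : ℕ → ℝ → Ω → ℝ} {Z : ℝ → Ω' → ℝ}
    (hYm : ∀ n t, Measurable (Y n t)) (hY : ∀ n ω, Continuous fun t => Y n t ω)
    (hZm : ∀ t, Measurable (Z t)) (hZ : ∀ ω, Continuous fun t => Z t ω)
    (hlim : ∀ a b, 0 ≤ a → 0 ≤ b → Tendsto
      (fun n => (Pn n).real {ω | ∀ t ∈ Icc (-b) a, 0 < Y n t ω}) atTop
      (nhds (Q.real {ω | ∀ t ∈ Icc (-b) a, 0 < Z t ω})))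
    (hY0 : ∀ᶠ n in atTop, (Pn n).real {ω | Y n 0 ω ≤ 0} = 0) (hZ0 : Q.real {ω | Z 0 ω ≤ 0} = 0)
    (hZK : ∀ ε > 0, ∃ K, 0 ≤ K ∧ Q.real {ω | ∀ t ∈ Icc 0 K, 0 < Z t ω} < ε
      ∧ Q.real {ω | ∀ t ∈ Icc (-K) 0, 0 < Z t ω} < ε)
    (f : BoundedContinuousFunction ℝ ℝ) :
    Tendsto (fun n => ∫ ω, f ((exitTime fun t => Y n t ω) + exitTime fun t => Y n (-t) ω) ∂(Pn n))
      atTop (nhds (∫ ω, f ((exitTime fun t => Z t ω) + exitTime fun t => Z (-t) ω) ∂Q)) := by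
  refine tendsto_integral_comp_add (fun n => measurable_exitTime (hYm n) (hY n))
    (fun n => measurable_exitTime (Y := fun t => Y n (-t)) (fun t => hYm n _)
      fun ω => (hY n ω).comp continuous_neg)
    (measurable_exitTime hZm hZ) (measurable_exitTime (Y := fun t => Z (-t)) (fun t => hZm _)
      fun ω => (hZ ω).comp continuous_neg) (fun a b => ?_) f
  have hQN : Q.real {ω | (fun t => Z t ω) ∈ degeneratePaths} = 0 := by
    refine le_antisymm (le_of_forall_pos_le_add fun ε hε => ?_) measureReal_nonneg
    obtain ⟨K, -, h1, h2⟩ := hZK (ε / 2) (by positivity)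
    linarith [measureReal_degeneratePaths_le hZ0 K]
  have hPN : Tendsto (fun n => (Pn n).real {ω | (fun t => Y n t ω) ∈ degeneratePaths}) atTop
      (nhds 0) := by
    rw [tendsto_order]
    refine ⟨fun a ha => Eventually.of_forall fun n => ha.trans_le measureReal_nonneg,
      fun ε hε => ?_⟩
    obtain ⟨K, hK, h1, h2⟩ := hZK (ε / 2) (by positivity)
    have l1 := hlim K 0 hK le_rfl
    have l2 := hlim 0 K le_rfl hK
    rw [neg_zero] at l1
    filter_upwards [l1.eventually_lt_const h1, l2.eventually_lt_const h2, hY0] with n e1 e2 e3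
    linarith [measureReal_degeneratePaths_le e3 K]
  have hQE : Q.real {ω | a < (exitTime fun t => Z t ω) ∧ b < exitTime fun t => Z (-t) ω}
      = Q.real {ω | ∀ t ∈ Icc (-max b 0) (max a 0), 0 < Z t ω} := by
    have := abs_measureReal_lt_exitTime_sub_le (P := Q) hZ a b
    rw [hQN] at this
    exact sub_eq_zero.1 (abs_eq_zero.1 (le_antisymm this (abs_nonneg _)))
  rw [hQE]
  have h1 : Tendsto (fun n => (Pn n).real
        {ω | a < (exitTime fun t => Y n t ω) ∧ b < exitTime fun t => Y n (-t) ω}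
      - (Pn n).real {ω | ∀ t ∈ Icc (-max b 0) (max a 0), 0 < Y n t ω}) atTop (nhds 0) :=
    squeeze_zero_norm (fun n => abs_measureReal_lt_exitTime_sub_le (P := Pn n) (hY n) a b)
      hPN
  simpa using h1.add (hlim (max a 0) (max b 0) (le_max_right _ _) (le_max_right _ _))

end ExcursionLength

section LimitTails

open Real Set

variable {Ω' : Type*} [MeasurableSpace Ω'] {Q : Measure Ω'} [IsProbabilityMeasure Q]
  {T : Ω' → ℝ} {W : ℝ → Ω' → ℝ} {G : ℝ → ℝ} {m : ℝ}

lemma measureReal_limit_origin_nonpos (hm : 0 < m)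
    (hW2 : Integrable (fun ω => W 0 ω * W 0 ω) Q)
    (hWcov : ∀ s t, ∫ ω, W s ω * W t ω ∂Q = G s + G t - G (s - t)) (hG0 : G 0 = 0)
    (hT : Measurable T)
    (hexp : ∀ x : ℝ, 0 ≤ x → Q {ω | x < T ω} = ENNReal.ofReal (exp (-x))) :
    Q.real {ω | W 0 ω + m * T ω - G 0 / m ≤ 0} = 0 := by
  have h1 : ∀ᵐ ω ∂Q, W 0 ω = 0 := by
    have h2 := (integral_eq_zero_iff_of_nonneg (fun ω => mul_self_nonneg (W 0 ω)) hW2).1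
      (by rw [hWcov]; simp [hG0])
    filter_upwards [h2] with ω hω
    exact mul_self_eq_zero.1 hω
  have h3 : ∀ᵐ ω ∂Q, 0 < T ω := by
    refine (prob_compl_eq_zero_iff (measurableSet_lt measurable_const hT)).2 ?_
    simpa using hexp 0 le_rfl
  rw [measureReal_eq_zero_iff, measure_eq_zero_iff_ae_notMem]
  filter_upwards [h1, h3] with ω e1 e2
  rw [e1, hG0]
  simp only [zero_add, zero_div, sub_zero, not_le]
  positivity

lemma measureReal_limit_pos_le (hm : 0 < m) {t : ℝ} (ht : 0 < G t)
    (hW2 : Integrable (fun ω => W t ω * W t ω) Q)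
    (hWcov : ∀ s t, ∫ ω, W s ω * W t ω ∂Q = G s + G t - G (s - t)) (hG0 : G 0 = 0)
    (hexp : ∀ x : ℝ, 0 ≤ x → Q {ω | x < T ω} = ENNReal.ofReal (exp (-x))) :
    Q.real {ω | 0 < W t ω + m * T ω - G t / m}
      ≤ 8 * m ^ 2 / G t + exp (-(G t / (2 * m ^ 2))) := by
  have h1 : Q.real {ω | 0 < W t ω + m * T ω - G t / m}
      ≤ Q.real {ω | (G t / (2 * m)) ^ 2 ≤ W t ω * W t ω}
        + Q.real {ω | G t / (2 * m ^ 2) < T ω} := by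
    refine (measureReal_mono fun ω hω => ?_).trans (measureReal_union_le _ _)
    by_contra hcon
    simp only [mem_union, mem_ofPred_eq, not_or, not_le, not_lt] at hcon hω
    obtain ⟨c1, c2⟩ := hcon
    have c3 : W t ω < G t / (2 * m) :=
      lt_of_pow_lt_pow_left₀ 2 (by positivity) (by rwa [sq (W t ω)])
    have c4 : m * T ω ≤ G t / (2 * m) := by
      calc m * T ω ≤ m * (G t / (2 * m ^ 2)) := by gcongr
        _ = _ := by field_simp
    have c5 : G t / m = G t / (2 * m) + G t / (2 * m) := by field_simp; norm_num
    linarith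
  have h2 := mul_meas_ge_le_integral_of_nonneg (μ := Q)
    (Eventually.of_forall fun ω => mul_self_nonneg (W t ω)) hW2 ((G t / (2 * m)) ^ 2)
  rw [hWcov, sub_self, hG0, sub_zero] at h2
  have h3 : Q.real {ω | (G t / (2 * m)) ^ 2 ≤ W t ω * W t ω} ≤ 8 * m ^ 2 / G t := by
    rw [← le_div_iff₀' (by positivity)] at h2
    refine h2.trans_eq ?_
    field_simp
    norm_num
  have h4 : Q.real {ω | G t / (2 * m ^ 2) < T ω} = exp (-(G t / (2 * m ^ 2))) := by
    rw [measureReal_def, hexp _ (by positivity), ENNReal.toReal_ofReal (exp_pos _).le]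
  linarith

lemma forall_mem_Icc_zero_one_iff {φ : ℝ → Prop} {p r : ℝ} (hr : 0 ≤ r) :
    (∀ s ∈ Icc (0 : ℝ) 1, φ (p + r * s)) ↔ ∀ t ∈ Icc p (p + r), φ t := by
  constructor
  · intro h t ht
    rcases hr.eq_or_lt with rfl | hr
    · have : p = t := le_antisymm ht.1 (by simpa using ht.2)
      simpa [this] using h 0 ⟨le_rfl, zero_le_one⟩
    · have := h ((t - p) / r) ⟨div_nonneg (by linarith [ht.1]) hr.le,
        (div_le_one hr).2 (by linarith [ht.2])⟩
      rwa [mul_div_cancel₀ _ hr.ne', add_sub_cancel] at this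
  · intro h s hs
    exact h _ ⟨by nlinarith [hs.1], by nlinarith [hs.2]⟩

end LimitTails

section ScaledExcursion

open Real Set

lemma cond_measureReal_scaledExcess_zero_nonpos {Ω : Type*} [MeasurableSpace Ω] {P : Measure Ω}
    {X : ℝ → Ω → ℝ} {u d : ℝ} (hu : 0 < u) (hX : Measurable (X 0)) :
    (P[|{ω | u < X 0 ω}]).real {ω | scaledExcess u d X 0 ω ≤ 0} = 0 := by
  rw [measureReal_def, cond_apply (measurableSet_lt measurable_const hX)]
  have : {ω | u < X 0 ω} ∩ {ω | scaledExcess u d X 0 ω ≤ 0} = ∅ := by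
    refine eq_empty_of_forall_notMem fun ω ⟨h1, h2⟩ => ?_
    have h3 : 0 < X 0 ω - u := sub_pos.2 h1
    have h4 : u * (X (d * 0) ω - u) ≤ 0 := h2
    rw [mul_zero] at h4
    exact absurd h4 (not_le.2 (by positivity))
  simp [this]

variable {Ω Ω' : Type*} [MeasurableSpace Ω] [MeasurableSpace Ω'] {P : Measure Ω}
  [IsProbabilityMeasure P] {Q : Measure Ω'} [IsProbabilityMeasure Q] {T : Ω' → ℝ}
  {X : ℝ → Ω → ℝ} {W : ℝ → Ω' → ℝ} {V G : ℝ → ℝ} {m : NNReal} {u d : ℕ → ℝ}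

lemma tendsto_cond_integral_scaledExcess_exitTime (hX : IsZeroMeanGaussianProcess P X)
    (hXc : ∀ ω, Continuous fun t => X t ω) (hm : m ≠ 0)
    (hV0 : V 0 = 0) (hV : ∀ t, V (-t) = V t)
    (hlip : ∀ s t l, 0 < l → |V s - V t| ≤ l * V (s - t) + (V s + V t) / (2 * l))
    (hcov : ∀ s t, ∫ ω, X s ω * X t ω ∂P = m - V (s - t))
    (hu : Tendsto u atTop atTop)
    (hG : ∀ t, Tendsto (fun n => u n ^ 2 * V (d n * t)) atTop (nhds (G t)))
    {b : ℝ} (hb0 : 0 < b) (hb1 : b < 1)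
    (hloc : ∀ K, ∃ c, ∀ᶠ n in atTop, ∀ t, |t| ≤ K → u n ^ 2 * V (d n * t) ≤ c)
    (hdy : ∀ r, 0 ≤ r → ∃ c, 0 ≤ c ∧ ∀ᶠ n in atTop, ∀ k : ℕ,
      u n ^ 2 * V (d n * (r / 2 ^ k)) ≤ c * (b ^ 4) ^ k)
    (hW : IsZeroMeanGaussianProcess Q W) (hWc : ∀ ω, Continuous fun t => W t ω)
    (hGc : Continuous G) (hWcov : ∀ s t, ∫ ω, W s ω * W t ω ∂Q = G s + G t - G (s - t))
    (hG0 : G 0 = 0) (hGe : ∀ t, G (-t) = G t) (hGt : Tendsto G atTop atTop)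
    (hT : Measurable T)
    (hexp : ∀ x : ℝ, 0 ≤ x → Q {ω | x < T ω} = ENNReal.ofReal (exp (-x)))
    (hind : ∀ (n : ℕ) (t : Fin n → ℝ), IndepFun (fun ω i => W (t i) ω) T Q)
    (f : BoundedContinuousFunction ℝ ℝ) :
    Tendsto (fun n => ∫ ω, f ((exitTime fun t => scaledExcess (u n) (d n) X t ω)
        + exitTime fun t => scaledExcess (u n) (d n) X (-t) ω) ∂(P[|{ω | u n < X 0 ω}]))
      atTop (nhds (∫ ω, f ((exitTime fun t => W t ω + m * T ω - G t / m)
        + exitTime fun t => W (-t) ω + m * T ω - G (-t) / m) ∂Q)) := by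
  have hm' : (0 : ℝ) < m := by exact_mod_cast hm.bot_lt
  have hprob : ∀ n, IsProbabilityMeasure (P[|{ω | u n < X 0 ω}]) := fun n =>
    cond_isProbabilityMeasure (measure_lt_ne_zero_of_map_eq_gaussianReal hm (hX.1 0)
      (hX.map_zero_eq hV0 hcov) (u n))
  have hWm := hW.1
  have hW2 : ∀ t, Integrable (fun ω => W t ω * W t ω) Q := fun t =>
    IsZeroMeanGaussianProcess.integrable_mul hW (Submodule.subset_span (mem_range_self _))
      (Submodule.subset_span (mem_range_self _))
  refine tendsto_integral_exitTime_add (Y := fun n => scaledExcess (u n) (d n) X)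
    (Z := fun t ω => W t ω + m * T ω - G t / m)
    (fun n t => ((hX.1 _).sub_const _).const_mul _) (fun n ω => ?_) (fun t => by fun_prop)
    (fun ω => ?_) (fun a b' ha hb' => ?_) ?_
    (measureReal_limit_origin_nonpos hm' (hW2 0) hWcov hG0 hT hexp) (fun ε hε => ?_) f
  · have := hXc ω
    unfold scaledExcess
    fun_prop
  · have := hWc ω
    fun_prop
  · have h1 := tendsto_cond_measureReal_forall_pos hX hXc hm hV0 hV hlip hcov hu hG hb0 hb1 hloc hW
      hWc hGc hWcov hT hexp hind (-b') (a + b') (hdy _ (by positivity))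
    have e : -b' + (a + b') = a := by ring
    have e1 : ∀ y : ℝ → ℝ, (∀ s ∈ Icc (0 : ℝ) 1, 0 < y (-b' + (a + b') * s))
        ↔ ∀ t ∈ Icc (-b') a, 0 < y t := fun y => by
      rw [forall_mem_Icc_zero_one_iff (φ := fun t => 0 < y t) (by positivity), e]
    have e2 := fun ω => e1 fun t => W t ω + m * T ω - G t / m
    have e3 := fun n ω => e1 fun t => scaledExcess (u n) (d n) X t ω
    simp only [e2, e3] at h1
    exact h1
  · filter_upwards [hu.eventually_gt_atTop 0] with n hn
    exact cond_measureReal_scaledExcess_zero_nonpos hn (hX.1 0)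
  · have h1 : Tendsto (fun t => 8 * (m : ℝ) ^ 2 / G t + exp (-(G t / (2 * (m : ℝ) ^ 2)))) atTop
        (nhds (0 + 0)) :=
      (hGt.const_div_atTop _).add (tendsto_exp_neg_atTop_nhds_zero.comp
        (hGt.atTop_div_const (by positivity)))
    rw [add_zero] at h1
    obtain ⟨K, hK0, hK1, hK2⟩ := ((eventually_ge_atTop 0).and
      ((h1.eventually_lt_const hε).and (hGt.eventually_gt_atTop 0))).exists
    refine ⟨K, hK0, ?_, ?_⟩
    · refine lt_of_le_of_lt ((measureReal_mono fun ω hω => ?_).trans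
        (measureReal_limit_pos_le hm' hK2 (hW2 _) hWcov hG0 hexp)) hK1
      exact hω K ⟨hK0, le_rfl⟩
    · rw [← hGe] at hK1 hK2
      refine lt_of_le_of_lt ((measureReal_mono fun ω hω => ?_).trans
        (measureReal_limit_pos_le hm' hK2 (hW2 _) hWcov hG0 hexp)) hK1
      exact hω (-K) ⟨le_rfl, by linarith⟩

end ScaledExcursion

section Rescaling

open Real Set Pointwise

lemma exitTime_comp_mul (y : ℝ → ℝ) {d : ℝ} (hd : 0 < d) :
    exitTime (fun t => y (d * t)) = d⁻¹ * exitTime y := by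
  rw [exitTime, exitTime, ← smul_eq_mul, ← Real.sInf_smul_of_nonneg (inv_nonneg.2 hd.le)]
  congr 1
  ext t
  rw [mem_smul_set_iff_inv_smul_mem₀ (inv_ne_zero hd.ne')]
  simp [hd]

lemma exitTime_const_mul (y : ℝ → ℝ) {u : ℝ} (hu : 0 < u) :
    exitTime (fun t => u * y t) = exitTime y := by
  have h : ∀ t, u * y t ≤ 0 ↔ y t ≤ 0 := fun t => by
    constructor
    · intro h
      by_contra h1
      exact absurd h (not_le.2 (mul_pos hu (not_le.1 h1)))
    · exact mul_nonpos_of_nonneg_of_nonpos hu.le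
  simp only [exitTime, h]

lemma exitTime_scaledExcess_add {Ω : Type*} (X : ℝ → Ω → ℝ) {u d : ℝ} (hu : 0 < u) (hd : 0 < d)
    (ω : Ω) :
    (exitTime fun t => scaledExcess u d X t ω) + (exitTime fun t => scaledExcess u d X (-t) ω)
      = d⁻¹ * (sInf {t : ℝ | 0 ≤ t ∧ X t ω ≤ u} - sSup {t : ℝ | t ≤ 0 ∧ X t ω ≤ u}) := by
  have h1 : (exitTime fun t => scaledExcess u d X t ω)
      = d⁻¹ * exitTime fun t => X t ω - u := by
    rw [← exitTime_comp_mul _ hd]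
    exact exitTime_const_mul _ hu
  have h2 : (exitTime fun t => scaledExcess u d X (-t) ω)
      = d⁻¹ * exitTime fun t => X (-t) ω - u := by
    rw [← exitTime_comp_mul _ hd, ← exitTime_const_mul (fun t => X (-(d * t)) ω - u) hu]
    simp only [scaledExcess, mul_neg]
  have h3 := neg_sSup_eq_exitTime_neg fun t => X t ω - u
  have h4 : (exitTime fun t => X t ω - u) = sInf {t : ℝ | 0 ≤ t ∧ X t ω ≤ u} := by
    simp [exitTime]
  rw [h1, h2, h4, ← h3]
  simp only [sub_nonpos]
  ring

lemma exitTime_add_of_pos {y : ℝ → ℝ} (h0 : 0 < y 0) :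
    exitTime y + (exitTime fun t => y (-t))
      = sInf {t : ℝ | 0 ≤ t ∧ y t ≤ 0} - sSup {t : ℝ | t < 0 ∧ y t ≤ 0} := by
  rw [← neg_sSup_eq_exitTime_neg, exitTime, ← sub_eq_add_neg]
  congr 3
  ext t
  refine and_congr_left fun h => ⟨fun ht => ht.lt_of_ne ?_, le_of_lt⟩
  rintro rfl
  exact absurd h (not_le.2 h0)

end Rescaling

section Covariance

open Real Set

lemma eq_sub_variogram {μ : Measure ℝ} [IsFiniteMeasure μ] {R : ℝ → ℝ}
    (hR : ∀ t : ℝ, (R t : ℂ) = ∫ x : ℝ, Complex.exp (Complex.I * t * x) ∂μ) (t : ℝ) :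
    R t = μ.real univ - variogram μ t := by
  have hexp : ∀ x : ℝ, Complex.exp (Complex.I * t * x) = Complex.exp ((t * x : ℝ) * Complex.I) :=
    fun x => by push_cast; ring_nf
  have hint : Integrable (fun x : ℝ => Complex.exp (Complex.I * t * x)) μ := by
    refine Integrable.of_bound (by fun_prop) 1 (Eventually.of_forall fun x => ?_)
    rw [hexp, Complex.norm_exp_ofReal_mul_I]
  have hre : ∀ x : ℝ, (Complex.exp (Complex.I * t * x)).re = cos (t * x) := fun x => by
    rw [hexp, Complex.exp_ofReal_mul_I_re]
  have hcos : Integrable (fun x => cos (t * x)) μ := by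
    refine hint.re.congr (Eventually.of_forall fun x => ?_)
    exact hre x
  have h1 : R t = ∫ x, cos (t * x) ∂μ := by
    have h2 := congrArg Complex.re (hR t)
    rw [Complex.ofReal_re] at h2
    rw [h2, ← Complex.reCLM_apply, ← Complex.reCLM.integral_comp_comm hint]
    simp only [Complex.reCLM_apply, hre]
  rw [h1, variogram, integral_sub (integrable_const _) hcos]
  simp

lemma IsZeroMeanGaussianProcess.const_mul {Ω : Type*} [MeasurableSpace Ω] {P : Measure Ω}
    {X : ℝ → Ω → ℝ} (hX : IsZeroMeanGaussianProcess P X) (a : ℝ) :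
    IsZeroMeanGaussianProcess P fun t ω => a * X t ω := by
  refine ⟨fun t => (hX.1 t).const_mul a, fun n t c => ?_⟩
  obtain ⟨v, hv⟩ := hX.2 n t fun i => c i * a
  exact ⟨v, by simpa only [mul_assoc] using hv⟩

end Covariance

/-- conditionally on `[X₀ > u]`, `δ_u⁻¹ (τ_u⁺ - τ_u⁻)` converges in
distribution, as `u → ∞`, to `τ_*⁺ - τ_*⁻`, the endpoints of the excursion of
`Y_t = √(2C_α) B(t) + R(0) T* - (C_α/R(0)) |t|^α` above `0` around the origin, where `B`
is a fractional Brownian motion with Hurst index `α/2` independent of the standard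
exponential `T*`. -/
theorem excursion_stmt15
    (α : ℝ) (hα0 : 0 < α) (hα2 : α < 2)
    (μ : Measure ℝ) [IsFiniteMeasure μ]
    (hμ_nonnull : μ Set.univ ≠ 0)
    (hμ_symm : μ.map (fun x => -x) = μ)
    (hμ_tail_pos : ∀ x > (0 : ℝ), 0 < μ (Set.Ici x))
    (hμ_rv : ∀ c > (0 : ℝ),
      Tendsto (fun x : ℝ => (μ (Set.Ici (c * x))).toReal / (μ (Set.Ici x)).toReal)
        atTop (nhds (c ^ (-α))))
    (R : ℝ → ℝ)
    (hR : ∀ t : ℝ, (R t : ℂ) = ∫ x : ℝ, Complex.exp (Complex.I * t * x) ∂μ)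
    {Ω : Type*} [MeasurableSpace Ω] (P : Measure Ω) [IsProbabilityMeasure P]
    (X : ℝ → Ω → ℝ)
    (hX_gauss : IsZeroMeanGaussianProcess P X)
    (hX_cont : ∀ ω, Continuous fun t => X t ω)
    (hX_cov : ∀ s t : ℝ, ∫ ω, X s ω * X t ω ∂P = R (s - t))
    (h : ℝ → ℝ)
    (hh : ∀ y : ℝ, h y = sInf {x : ℝ | 0 ≤ x ∧ (μ (Set.Ici x)).toReal ≤ y})
    (δ : ℝ → ℝ)
    (hδ : ∀ u : ℝ, δ u = (h (u ^ (-2 : ℝ)))⁻¹)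
    -- the limit objects: a fractional Brownian motion `B` with Hurst index `α/2` and an
    -- independent standard exponential random variable `T*`, on some probability space.
    {Ω' : Type*} [MeasurableSpace Ω'] (Q : Measure Ω') [IsProbabilityMeasure Q]
    (B : ℝ → Ω' → ℝ) (T : Ω' → ℝ)
    (hB_gauss : IsZeroMeanGaussianProcess Q B)
    (hB_cont : ∀ ω, Continuous fun t => B t ω)
    (hB_cov : ∀ s t : ℝ, ∫ ω, B s ω * B t ω ∂Q
      = (|t| ^ α + |s| ^ α - |t - s| ^ α) / 2)
    (hT_meas : Measurable T)
    (hT_exp : ∀ x : ℝ, 0 ≤ x → Q {ω | x < T ω} = ENNReal.ofReal (Real.exp (-x)))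
    (hBT_indep : ∀ (n : ℕ) (t : Fin n → ℝ),
      IndepFun (fun ω i => B (t i) ω) T Q)
    (Y : ℝ → Ω' → ℝ)
    (hY : ∀ t ω, Y t ω
      = Real.sqrt (2 * (Real.pi / (Real.Gamma α * Real.sin (Real.pi * α / 2)))) * B t ω
        + R 0 * T ω
        - Real.pi / (Real.Gamma α * Real.sin (Real.pi * α / 2)) / R 0 * |t| ^ α) :
    ∀ f : BoundedContinuousFunction ℝ ℝ,
      Tendsto (fun u : ℝ =>
          ∫ ω, f ((δ u)⁻¹ * (sInf {t : ℝ | 0 ≤ t ∧ X t ω ≤ u}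
              - sSup {t : ℝ | t ≤ 0 ∧ X t ω ≤ u})) ∂(P[|{ω | u < X 0 ω}]))
        atTop
        (nhds (∫ ω, f (sInf {t : ℝ | 0 ≤ t ∧ Y t ω ≤ 0}
            - sSup {t : ℝ | t < 0 ∧ Y t ω ≤ 0}) ∂Q)) := by
  intro f
  have hpos : ∀ x > (0 : ℝ), 0 < μ.real (Set.Ici x) := fun x hx =>
    ENNReal.toReal_pos (hμ_tail_pos x hx).ne' (measure_ne_top μ _)
  have hRV := eq_sub_variogram hR
  set C := Real.pi / (Real.Gamma α * Real.sin (Real.pi * α / 2)) with hC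
  have hC0 : 0 < C := pi_div_Gamma_mul_sin_pos hα0 hα2
  set m : NNReal := (μ Set.univ).toNNReal with hm_def
  have hm : m ≠ 0 := (ENNReal.toNNReal_pos hμ_nonnull (measure_ne_top μ _)).ne'
  have hm' : (0 : ℝ) < m := by exact_mod_cast hm.bot_lt
  have hmR : μ.real Set.univ = m := rfl
  have hR0 : R 0 = m := by rw [hRV, variogram_zero, hmR, sub_zero]
  have hcov : ∀ s t, ∫ ω, X s ω * X t ω ∂P = m - variogram μ (s - t) := fun s t => by
    rw [hX_cov, hRV, hmR]
  have hV : ∀ t, variogram μ (-t) = variogram μ t := fun t => by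
    rw [← variogram_abs, abs_neg, variogram_abs]
  set G : ℝ → ℝ := fun t => C * |t| ^ α with hG_def
  set W : ℝ → Ω' → ℝ := fun t ω => Real.sqrt (2 * C) * B t ω with hW_def
  have hG0 : G 0 = 0 := by simp [hG_def, Real.zero_rpow hα0.ne']
  have hGc : Continuous G :=
    (continuous_abs.rpow_const fun _ => Or.inr hα0.le).const_mul C
  have hGt : Tendsto G atTop atTop :=
    ((tendsto_rpow_atTop hα0).comp tendsto_abs_atTop_atTop).const_mul_atTop hC0
  have hWcov : ∀ s t, ∫ ω, W s ω * W t ω ∂Q = G s + G t - G (s - t) := fun s t => by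
    have e : ∀ ω, W s ω * W t ω = 2 * C * (B s ω * B t ω) := fun ω => by
      rw [hW_def, mul_mul_mul_comm, Real.mul_self_sqrt (by positivity)]
    simp_rw [e]
    rw [integral_const_mul, hB_cov, abs_sub_comm t s]
    simp only [hG_def]
    ring
  have hWG : IsZeroMeanGaussianProcess Q W := hB_gauss.const_mul _
  have hind : ∀ (n : ℕ) (t : Fin n → ℝ), IndepFun (fun ω i => W (t i) ω) T Q := fun n t =>
    (hBT_indep n t).comp (φ := fun x i => Real.sqrt (2 * C) * x i) (ψ := id) (by fun_prop)
      measurable_id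
  have hYW : ∀ t ω, Y t ω = W t ω + m * T ω - G t / m := fun t ω => by
    rw [hY, hR0]
    simp only [hW_def, hG_def]
    ring
  have hY0 : ∀ᵐ ω ∂Q, 0 < Y 0 ω := by
    have h1 := measureReal_limit_origin_nonpos hm' (hWG.integrable_mul
      (Submodule.subset_span (Set.mem_range_self 0)) (Submodule.subset_span (Set.mem_range_self 0)))
      hWcov hG0 hT_meas hT_exp
    rw [measureReal_eq_zero_iff, measure_eq_zero_iff_ae_notMem] at h1
    filter_upwards [h1] with ω hω
    rw [hYW]
    exact not_le.1 hω
  have hlimit : ∫ ω, f (sInf {t : ℝ | 0 ≤ t ∧ Y t ω ≤ 0} - sSup {t : ℝ | t < 0 ∧ Y t ω ≤ 0}) ∂Q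
      = ∫ ω, f ((exitTime fun t => W t ω + m * T ω - G t / m)
        + exitTime fun t => W (-t) ω + m * T ω - G (-t) / m) ∂Q := by
    refine integral_congr_ae ?_
    filter_upwards [hY0] with ω hω
    rw [← exitTime_add_of_pos (y := fun t => Y t ω) hω]
    simp only [hYW]
  rw [hlimit]
  refine tendsto_of_seq_tendsto fun u hu => ?_
  have hbpos : (0 : ℝ) < 2 ^ (-α / 8) := by positivity
  have hb1 : (2 : ℝ) ^ (-α / 8) < 1 :=
    Real.rpow_lt_one_of_one_lt_of_neg one_lt_two (by linarith)
  have hb4 : ((2 : ℝ) ^ (-α / 8)) ^ 4 = 2 ^ (-α / 2) := by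
    rw [← Real.rpow_natCast, ← Real.rpow_mul zero_le_two]
    congr 1
    push_cast
    ring
  have hδpos : ∀ᶠ n in atTop, 0 < δ (u n) := by
    filter_upwards [hu.eventually ((tendsto_inv_timeScale hpos hh hδ).eventually_gt_atTop 0)]
      with n hn using inv_pos.1 hn
  refine (tendsto_cond_integral_scaledExcess_exitTime (d := fun n => δ (u n)) hX_gauss hX_cont hm
    (variogram_zero μ) hV (fun s t l hl => abs_variogram_sub_le μ s t hl) hcov hu
    (fun t => (tendsto_scaled_variogram hμ_symm hpos hμ_rv hα0 hα2 hh hδ t).comp hu) hbpos hb1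
    (fun K => ?_) (fun r hr => ?_) hWG (fun ω => (hB_cont ω).const_mul _) hGc hWcov hG0
    (fun t => by simp only [abs_neg]) hGt hT_meas hT_exp hind f).congr' ?_
  · obtain ⟨c, hc⟩ := exists_scaled_variogram_le hμ_symm hpos hμ_rv hα0 hα2 hh hδ K
    exact ⟨c, hu.eventually hc⟩
  · rcases hr.eq_or_lt with rfl | hr
    · exact ⟨0, le_rfl, Eventually.of_forall fun n k => by simp [variogram_zero]⟩
    · obtain ⟨c, hc0, hc⟩ := exists_scaled_variogram_dyadic_le hμ_symm hpos hμ_rv hα0 hα2 hh hδ hr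
      rw [hb4]
      exact ⟨c, hc0, hu.eventually hc⟩
  · filter_upwards [hδpos, hu.eventually_gt_atTop 0] with n h1 h2
    simp only [exitTime_scaledExcess_add X h2 h1, Function.comp]
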